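/- Let d ≥ 3 and p ≥ 2, and let M be the global spherical maximal function on ℝ^d. Then M is bounded on the weighted space L^p(|x|^{1−d}): there is a constant C with ∫_{ℝ^d} |Mf(x)|^p |x|^{1−d} dx ≤ C ∫_{ℝ^d} |f(x)|^p |x|^{1−d} dx for all f. -/

import Mathlib

open MeasureTheory Metric Complex Set Pointwise
open scoped FourierTransform ENNReal NNReal

noncomputable section

/-- The (unnormalized) surface measure on the unit sphere `S^{d-1} ⊆ ℝ^d`. -/
def sphereMeasure (d : ℕ) : Measure (Metric.sphere (0 : EuclideanSpace ℝ (Fin d)) 1) :=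
  (volume : Measure (EuclideanSpace ℝ (Fin d))).toSphere

/-- Spherical average `A_t f(x) = ∫_{S^{d-1}} f(x - ty) dσ(y)`, where `dσ` is the
normalized surface measure on the unit sphere. -/
def sphAvg (d : ℕ) (f : EuclideanSpace ℝ (Fin d) → ℂ) (t : ℝ)
    (x : EuclideanSpace ℝ (Fin d)) : ℂ :=
  ⨍ y, f (x - t • (y : EuclideanSpace ℝ (Fin d))) ∂(sphereMeasure d)

/-- Global spherical maximal function `Mf(x) = sup_{t>0} |A_t f(x)|`. -/
def sphMax (d : ℕ) (f : EuclideanSpace ℝ (Fin d) → ℂ)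
    (x : EuclideanSpace ℝ (Fin d)) : ℝ≥0∞ :=
  ⨆ (t : ℝ) (_ : 0 < t), (‖sphAvg d f t x‖₊ : ℝ≥0∞)

/-- Local spherical maximal function `M_c f(x) = sup_{1<t<2} |A_t f(x)|`. -/
def sphMaxLoc (d : ℕ) (f : EuclideanSpace ℝ (Fin d) → ℂ)
    (x : EuclideanSpace ℝ (Fin d)) : ℝ≥0∞ :=
  ⨆ (t : ℝ) (_ : t ∈ Ioo (1:ℝ) 2), (‖sphAvg d f t x‖₊ : ℝ≥0∞)

/-- Littlewood–Paley projection `P_j`, determined by `(P_j f)^(ξ) = χ(|ξ|/2^j) f̂(ξ)`. -/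
def proj (d : ℕ) (χ : ℝ → ℝ) (j : ℤ) (f : EuclideanSpace ℝ (Fin d) → ℂ) :
    EuclideanSpace ℝ (Fin d) → ℂ :=
  𝓕⁻ (fun ξ => (χ (‖ξ‖ / 2 ^ j) : ℂ) * 𝓕 f ξ)

/-- Projection `P_{<n}`, determined by `(P_{<n} f)^(ξ) = (Σ_{j<n} χ(|ξ|/2^j)) f̂(ξ)`. -/
def projLT (d : ℕ) (χ : ℝ → ℝ) (n : ℤ) (f : EuclideanSpace ℝ (Fin d) → ℂ) :
    EuclideanSpace ℝ (Fin d) → ℂ :=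
  𝓕⁻ (fun ξ => ((∑' j : ℤ, if j < n then χ (‖ξ‖ / 2 ^ j) else 0 : ℝ) : ℂ) * 𝓕 f ξ)

/-- The weight `|x|^{1-d}`, as an `ℝ≥0∞`-valued function. -/
def wt (d : ℕ) (x : EuclideanSpace ℝ (Fin d)) : ℝ≥0∞ :=
  ENNReal.ofReal (‖x‖ ^ ((1:ℝ) - d))

abbrev EE (d : ℕ) := EuclideanSpace ℝ (Fin d)

lemma coord_aux (n : ℕ) (F : ℝ → ℝ → ℝ≥0∞) (hF : Measurable (Function.uncurry F)) :
    ∫⁻ y : EE (n+1), F (y 0) (‖y‖^2) = ∫⁻ z : ℝ, ∫⁻ v : EE n, F z (z^2 + ‖v‖^2) := by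
  have h1 := PiLp.volume_preserving_ofLp (Fin (n+1))
  have h2 := volume_preserving_piFinSuccAbove (fun _ : Fin (n+1) => ℝ) 0
  have h3 := h2.comp h1
  have hmeas : Measurable (fun p : ℝ × (Fin n → ℝ) => F p.1 (p.1^2 + ∑ i, p.2 i ^2)) := by
    have : Measurable (fun p : ℝ × (Fin n → ℝ) => ((p.1, p.1^2 + ∑ i, p.2 i ^2) : ℝ × ℝ)) := by
      fun_prop
    exact hF.comp this
  have e1 : ∫⁻ y : EE (n+1), F (y 0) (‖y‖^2) =
      ∫⁻ p : ℝ × (Fin n → ℝ), F p.1 (p.1^2 + ∑ i, p.2 i ^2) := by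
    rw [← h3.lintegral_comp hmeas]
    congr 1
    ext y
    simp [EuclideanSpace.real_norm_sq_eq, Fin.sum_univ_succ, Fin.tail]
  rw [e1, Measure.volume_eq_prod, lintegral_prod _ hmeas.aemeasurable]
  congr 1
  ext z
  have h4 := PiLp.volume_preserving_ofLp (Fin n)
  have hm2 : Measurable (fun v : Fin n → ℝ => F z (z^2 + ∑ i, v i ^2)) :=
    hmeas.comp (measurable_prodMk_left)
  rw [← h4.lintegral_comp hm2]
  congr 1
  ext y
  simp [EuclideanSpace.real_norm_sq_eq]

lemma coord (n : ℕ) (e : EE (n+1)) (he : ‖e‖ = 1) (F : ℝ → ℝ → ℝ≥0∞)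
    (hF : Measurable (Function.uncurry F)) :
    ∫⁻ y : EE (n+1), F (inner ℝ e y) (‖y‖^2) = ∫⁻ z : ℝ, ∫⁻ v : EE n, F z (z^2 + ‖v‖^2) := by
  obtain ⟨b, hb⟩ := Orthonormal.exists_orthonormalBasis_extension_of_card_eq
    (𝕜 := ℝ) (E := EE (n+1)) (ι := Fin (n+1)) (by simp) (v := fun _ => e) (s := {0}) (by
      rw [orthonormal_iff_ite]
      rintro ⟨i, hi⟩ ⟨j, hj⟩
      have hi' : i = 0 := hi
      have hj' : j = 0 := hj
      subst hi'
      subst hj'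
      simp [he])
  have hb0 : b 0 = e := hb 0 rfl
  rw [← coord_aux n F hF]
  have hm : Measurable (fun y : EE (n+1) => F (y 0) (‖y‖^2)) := by
    have : Measurable (fun y : EE (n+1) => ((y 0, ‖y‖^2) : ℝ × ℝ)) := by fun_prop
    exact hF.comp this
  rw [← b.measurePreserving_repr.lintegral_comp hm]
  congr 1
  ext y
  simp [b.repr_apply_apply, hb0]

lemma polar (d : ℕ) (hd : 1 ≤ d) (f : EE d → ℝ≥0∞) (hf : Measurable f) :
    ∫⁻ x, f x = ∫⁻ θ, (∫⁻ r in Ioi (0:ℝ), ENNReal.ofReal (r^(d-1)) * f (r • (θ : EE d)))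
      ∂(sphereMeasure d) := by
  have : Nonempty (Fin d) := ⟨⟨0, hd⟩⟩
  have hmp := (volume : Measure (EE d)).measurePreserving_homeomorphUnitSphereProd
  have e0 : ∫⁻ x, f x = ∫⁻ x : ({0}ᶜ : Set (EE d)), f x ∂(Measure.comap Subtype.val volume) := by
    rw [lintegral_subtype_comap (measurableSet_singleton _).compl, restrict_compl_singleton]
  have hg : Measurable (fun p : sphere (0 : EE d) 1 × Ioi (0:ℝ) =>
      f ((p.2 : ℝ) • (p.1 : EE d))) := by
    apply hf.comp; fun_prop
  have e1 : ∫⁻ x : ({0}ᶜ : Set (EE d)), f x ∂(Measure.comap Subtype.val volume) =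
      ∫⁻ p : sphere (0 : EE d) 1 × Ioi (0:ℝ), f ((p.2 : ℝ) • (p.1 : EE d))
        ∂((volume : Measure (EE d)).toSphere.prod
          (Measure.volumeIoiPow (Module.finrank ℝ (EE d) - 1))) := by
    rw [← hmp.lintegral_comp hg]
    congr 1
    ext x
    congr 1
    have : ‖(x : EE d)‖ ≠ 0 := norm_ne_zero_iff.mpr x.2
    simp [homeomorphUnitSphereProd, smul_smul, this]
  rw [e0, e1, lintegral_prod _ hg.aemeasurable]
  unfold sphereMeasure
  congr 1
  ext θ
  have hgθ : Measurable (fun r : Ioi (0:ℝ) => f ((r : ℝ) • (θ : EE d))) := by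
    apply hf.comp; fun_prop
  rw [← lintegral_subtype_comap measurableSet_Ioi]
  have := lintegral_withDensity_eq_lintegral_mul (Measure.comap Subtype.val (volume : Measure ℝ))
    (f := fun r : Ioi (0:ℝ) => ENNReal.ofReal ((r:ℝ)^(Module.finrank ℝ (EE d) - 1)))
    (by fun_prop) hgθ
  rw [Measure.volumeIoiPow]
  refine this.trans ?_
  simp

lemma polar_radial (d : ℕ) (hd : 1 ≤ d) (F : ℝ → ℝ≥0∞) (hF : Measurable F) :
    ∫⁻ x : EE d, F ‖x‖ = sphereMeasure d univ *
      ∫⁻ r in Ioi (0:ℝ), ENNReal.ofReal (r^(d-1)) * F r := by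
  rw [polar d hd _ (by fun_prop)]
  have : ∀ θ : sphere (0 : EE d) 1, ∫⁻ r in Ioi (0:ℝ), ENNReal.ofReal (r^(d-1)) *
      F ‖r • (θ : EE d)‖ = ∫⁻ r in Ioi (0:ℝ), ENNReal.ofReal (r^(d-1)) * F r := by
    intro θ
    apply setLIntegral_congr_fun measurableSet_Ioi
    intro r hr
    simp [norm_smul, abs_of_pos (show (0:ℝ) < r from hr)]
  simp_rw [this]
  rw [lintegral_const, mul_comm]

instance (d : ℕ) : IsFiniteMeasure (sphereMeasure d) := by
  unfold sphereMeasure; infer_instance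

lemma sphere_pos (d : ℕ) (hd : 1 ≤ d) : sphereMeasure d univ ≠ 0 := by
  have : Nonempty (Fin d) := ⟨⟨0, hd⟩⟩
  unfold sphereMeasure
  rw [Ne, Measure.measure_univ_eq_zero]
  exact Measure.toSphere_ne_zero _

/-- volume of the unit ball -/
def vb (n : ℕ) : ℝ := volume.real (ball (0 : EE n) 1)

lemma vb_pos (n : ℕ) : 0 < vb n := by
  unfold vb
  rw [measureReal_def]
  exact ENNReal.toReal_pos (measure_ball_pos _ _ one_pos).ne' measure_ball_lt_top.ne

lemma vol_ball_eq (n : ℕ) : volume (ball (0 : EE n) 1) = ENNReal.ofReal (vb n) := by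
  unfold vb
  rw [ofReal_measureReal measure_ball_lt_top.ne]

lemma vol_annulus (n : ℕ) (hn : 1 ≤ n) (α β : ℝ) (hαβ : α ≤ β) :
    volume {v : EE n | α ≤ ‖v‖^2 ∧ ‖v‖^2 ≤ β} =
      ENNReal.ofReal (vb n * (√β ^ n - √α ^ n)) := by
  have : Nonempty (Fin n) := ⟨⟨0, hn⟩⟩
  rcases lt_or_ge β 0 with hβ | hβ
  · have : {v : EE n | α ≤ ‖v‖^2 ∧ ‖v‖^2 ≤ β} = ∅ := by
      ext v
      simp only [mem_ofPred_eq, mem_empty_iff_false, iff_false, not_and, not_le]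
      intro _
      exact hβ.trans_le (by positivity)
    rw [this, Real.sqrt_eq_zero_of_nonpos hβ.le, Real.sqrt_eq_zero_of_nonpos (hαβ.trans hβ.le)]
    simp
  · have hset : {v : EE n | α ≤ ‖v‖^2 ∧ ‖v‖^2 ≤ β} = closedBall 0 (√β) \ ball 0 (√α) := by
      ext v
      simp only [mem_ofPred_eq, mem_sdiff, mem_closedBall, dist_zero_right, mem_ball, not_lt]
      rw [Real.le_sqrt (norm_nonneg _) hβ, Real.sqrt_le_left (norm_nonneg _)]
      tauto
    rw [hset, measure_sdiff (ball_subset_closedBall.trans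
      (closedBall_subset_closedBall (Real.sqrt_le_sqrt hαβ)))
      measurableSet_ball.nullMeasurableSet measure_ball_lt_top.ne,
      Measure.addHaar_closedBall _ _ (Real.sqrt_nonneg _),
      Measure.addHaar_ball _ _ (Real.sqrt_nonneg _), vol_ball_eq, finrank_euclideanSpace_fin,
      ← ENNReal.ofReal_mul (by positivity), ← ENNReal.ofReal_mul (by positivity),
      ← ENNReal.ofReal_sub _ (mul_nonneg (by positivity) (vb_pos n).le)]
    congr 1
    ring

lemma pow_sub_le_aux (m : ℕ) (a b : ℝ) (ha : 0 ≤ a) (hab : a ≤ b) :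
    b^(m+2) - a^(m+2) ≤ (m+2)*b^m*(b^2-a^2) := by
  induction m with
  | zero =>
    norm_num
    nlinarith
  | succ k ih =>
    have h1 : a^(k+2) ≤ b^(k+2) := by gcongr
    have h2 : b^(k+1+2) - a^(k+1+2) = b*(b^(k+2)-a^(k+2)) + a^(k+2)*(b-a) := by ring
    have h4 : b * (b^(k+2)-a^(k+2)) ≤ b * ((k+2)*b^k*(b^2-a^2)) := by gcongr; linarith
    have h3 : a^(k+2)*(b-a) ≤ b^(k+1)*(b^2-a^2) := by
      have : a^(k+2) ≤ b^(k+1)*a := by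
        rw [pow_succ a (k+1)]; gcongr
      have h5 : 0 ≤ b^(k+1) := by have := ha.trans hab; positivity
      nlinarith [mul_nonneg h5 (mul_nonneg (sub_nonneg.2 hab) (ha.trans hab)),
        mul_le_mul_of_nonneg_right this (sub_nonneg.2 hab)]
    push_cast
    rw [h2]
    calc _ ≤ _ := add_le_add h4 h3
     _ = _ := by ring

lemma sqrt_pow_sub_le (n : ℕ) (hn : 2 ≤ n) (α β : ℝ) (hαβ : α ≤ β) :
    √β ^ n - √α ^ n ≤ n * √β ^ (n-2) * (β - α) := by
  obtain ⟨m, rfl⟩ : ∃ m, n = m + 2 := ⟨n-2, by omega⟩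
  have ha := Real.sqrt_nonneg α
  have hb := Real.sqrt_nonneg β
  have hab : √α ≤ √β := Real.sqrt_le_sqrt hαβ
  have hba : 0 ≤ β - α := sub_nonneg.2 hαβ
  rcases le_or_gt β 0 with hβ | hβ
  · have h1 : √β ^ (m+2) - √α ^ (m+2) = 0 := by
      rw [Real.sqrt_eq_zero_of_nonpos hβ, Real.sqrt_eq_zero_of_nonpos (hαβ.trans hβ)]
      simp
    rw [h1]
    positivity
  · refine (pow_sub_le_aux m _ _ ha hab).trans ?_
    push_cast
    have h1 : √β^2 = β := Real.sq_sqrt hβ.le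
    have h2 : α ≤ √α^2 := by
      rcases le_or_gt α 0 with h | h
      · exact h.trans (by positivity)
      · exact (Real.sq_sqrt h.le).ge
    gcongr ?_ * ?_
    linarith

lemma convex_incr (φ : ℝ → ℝ) (hφ : ConvexOn ℝ (Ici 0) φ) (a a' η : ℝ) (ha : 0 ≤ a)
    (haa : a ≤ a') (hη : 0 ≤ η) : φ (a + η) - φ a ≤ φ (a' + η) - φ a' := by
  rcases eq_or_lt_of_le haa with rfl | h
  · rfl
  have hs : 0 < a' - a + η := by linarith
  set l := η / (a' - a + η) with hl
  have hl0 : 0 ≤ l := by positivity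
  have hl1 : l ≤ 1 := by rw [hl, div_le_one hs]; linarith
  have hle : l * (a' - a + η) = η := by rw [hl]; field_simp
  have h1 := hφ.2 (show a ∈ Ici (0:ℝ) from ha) (show a' + η ∈ Ici (0:ℝ) by
    simp only [mem_Ici]; linarith) hl0 (sub_nonneg.2 hl1) (by ring)
  have h2 := hφ.2 (show a ∈ Ici (0:ℝ) from ha) (show a' + η ∈ Ici (0:ℝ) by
    simp only [mem_Ici]; linarith) (sub_nonneg.2 hl1) hl0 (by ring)
  simp only [smul_eq_mul] at h1 h2
  rw [show l * a + (1 - l) * (a' + η) = a' by linear_combination -hle] at h1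
  rw [show (1 - l) * a + l * (a' + η) = a + η by linear_combination hle] at h2
  linarith

lemma sqrt_pow_incr (n : ℕ) (hn : 2 ≤ n) (s s' η : ℝ) (hs : s ≤ s') (hη : 0 ≤ η) :
    √(s + η) ^ n - √s ^ n ≤ √(s' + η) ^ n - √s' ^ n := by
  have key : ∀ x : ℝ, 0 ≤ x → √x ^ n = x ^ ((n:ℝ)/2) := by
    intro x hx
    rw [Real.sqrt_eq_rpow, ← Real.rpow_natCast, ← Real.rpow_mul hx]
    congr 1; ring
  have hconv : ConvexOn ℝ (Ici 0) (fun x : ℝ => x ^ ((n:ℝ)/2)) := convexOn_rpow (by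
    have : (2:ℝ) ≤ n := by exact_mod_cast hn
    linarith)
  have h0 : 0 ^ n = (0:ℝ) := by rw [zero_pow]; omega
  rcases le_or_gt s' 0 with h | h
  · rw [Real.sqrt_eq_zero_of_nonpos h, Real.sqrt_eq_zero_of_nonpos (hs.trans h)]
    gcongr
  · rcases le_or_gt s 0 with h2 | h2
    · rw [Real.sqrt_eq_zero_of_nonpos h2]
      have := convex_incr _ hconv 0 s' η le_rfl h.le hη
      rw [zero_add, ← key _ hη, ← key _ le_rfl, ← key _ (by linarith), ← key _ h.le,
        Real.sqrt_zero] at this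
      refine le_trans ?_ this
      gcongr
      linarith
    · have := convex_incr _ hconv s s' η h2.le hs hη
      rwa [← key _ h.le, ← key _ h2.le, ← key _ (by linarith), ← key _ (by linarith)] at this

/-- marginal profile -/
def WW (n : ℕ) (η z : ℝ) : ℝ := √(1 + η - z^2) ^ n - √(1 - z^2) ^ n

lemma WW_anti (n : ℕ) (hn : 2 ≤ n) (η z z' : ℝ) (hη : 0 ≤ η) (h : |z| ≤ |z'|) :
    WW n η z' ≤ WW n η z := by
  have h2 : z^2 ≤ z'^2 := sq_le_sq.2 h
  have := sqrt_pow_incr n hn (1 - z'^2) (1 - z^2) η (by linarith) hη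
  unfold WW
  rw [show 1 + η - z'^2 = 1 - z'^2 + η by ring, show 1 + η - z^2 = 1 - z^2 + η by ring]
  exact this

lemma WW_nonneg (n : ℕ) (η z : ℝ) (hη : 0 ≤ η) : 0 ≤ WW n η z := by
  unfold WW
  rw [sub_nonneg]
  gcongr
  linarith

lemma WW_le (n : ℕ) (hn : 2 ≤ n) (η z : ℝ) (hη : 0 ≤ η) (hη1 : η ≤ 1) :
    WW n η z ≤ n * √2 ^ (n-2) * η := by
  refine (WW_anti n hn η 0 z hη (by simp)).trans ?_
  unfold WW
  have := sqrt_pow_sub_le n hn (1 - 0^2) (1 + η - 0^2) (by linarith)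
  refine this.trans ?_
  have e : 1 + η - 0^2 - (1 - 0^2) = η := by ring
  rw [e]
  gcongr
  linarith

lemma WW_supp (n : ℕ) (hn : 2 ≤ n) (η z : ℝ) (hη : 0 ≤ η) (hη1 : η ≤ 1) (hz : 2 < |z|) :
    WW n η z = 0 := by
  have : 4 < z^2 := by
    have := abs_nonneg z
    rw [← sq_abs]; nlinarith
  unfold WW
  rw [Real.sqrt_eq_zero_of_nonpos (by linarith), Real.sqrt_eq_zero_of_nonpos (by linarith)]
  simp

lemma WW_cont (n : ℕ) (η : ℝ) : Continuous (WW n η) := by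
  unfold WW; fun_prop

lemma unimodal (W : ℝ → ℝ) (W0 L M : ℝ) (hWm : Measurable W) (hW : ∀ z, 0 ≤ W z)
    (hW0 : ∀ z, W z ≤ W0) (hanti : ∀ z z', |z| ≤ |z'| → W z' ≤ W z)
    (hL : 0 ≤ L) (hsupp : ∀ z, L < |z| → W z = 0) (φ : ℝ → ℝ) (hφ : Continuous φ)
    (hM : ∀ c, 0 ≤ c → c ≤ L → |∫ z in (-c)..c, φ z| ≤ M) :
    |∫ z, W z * φ z| ≤ W0 * M := by
  have hW00 : 0 ≤ W0 := (hW 0).trans (hW0 0)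
  have hM0 : 0 ≤ M := (abs_nonneg _).trans (hM 0 le_rfl hL)
  have e1 : ∀ z, W z * φ z = ∫ l in Ioo 0 W0, {p : ℝ × ℝ | p.2 < W p.1}.indicator (fun p => φ p.1) (z, l) := by
    intro z
    have : ∀ l, {p : ℝ × ℝ | p.2 < W p.1}.indicator (fun p => φ p.1) (z, l) =
        (Iio (W z)).indicator (fun _ => φ z) l := by
      intro l; simp [indicator]
    simp_rw [this]
    rw [setIntegral_indicator measurableSet_Iio]
    have : Ioo 0 W0 ∩ Iio (W z) = Ioo 0 (W z) := by
      ext l; simp only [mem_inter_iff, mem_Ioo, mem_Iio]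
      have := hW0 z
      constructor
      · rintro ⟨⟨a, b⟩, c⟩; exact ⟨a, c⟩
      · rintro ⟨a, b⟩; exact ⟨⟨a, b.trans_le this⟩, b⟩
    rw [this]
    simp [hW z]
  have hms : MeasurableSet {p : ℝ × ℝ | p.2 < W p.1} :=
    measurableSet_lt measurable_snd (hWm.comp measurable_fst)
  have hint : Integrable ({p : ℝ × ℝ | p.2 < W p.1}.indicator (fun p => φ p.1))
      (volume.prod (volume.restrict (Ioo 0 W0))) := by
    have h1 : Integrable ((Icc (-L) L).indicator φ) volume := by
      rw [integrable_indicator_iff measurableSet_Icc]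
      exact hφ.continuousOn.integrableOn_compact isCompact_Icc
    have h2 := h1.comp_fst (ν := volume.restrict (Ioo 0 W0))
    refine h2.mono ((hφ.measurable.comp measurable_fst).indicator hms).aestronglyMeasurable ?_
    have h3 : ∀ᵐ p : ℝ × ℝ ∂(volume.prod (volume.restrict (Ioo 0 W0))), p.2 ∈ Ioo 0 W0 := by
      have : (volume : Measure ℝ).prod (volume.restrict (Ioo 0 W0)) =
          ((volume : Measure ℝ).prod volume).restrict (univ ×ˢ Ioo (0:ℝ) W0) := by
        rw [← Measure.prod_restrict, Measure.restrict_univ]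
      rw [this]
      filter_upwards [ae_restrict_mem (MeasurableSet.univ.prod measurableSet_Ioo)] with p hp
      exact hp.2
    filter_upwards [h3] with p hp
    by_cases h : p.2 < W p.1
    · have : p.1 ∈ Icc (-L) L := by
        refine abs_le.1 ?_
        by_contra hc
        have := hsupp p.1 (not_le.1 hc)
        have := hp.1
        linarith
      simp [indicator, this.1, this.2, h]
    · simp [indicator, h]
  simp_rw [e1]
  rw [integral_integral_swap (f := fun z l =>
    {p : ℝ × ℝ | p.2 < W p.1}.indicator (fun p => φ p.1) (z, l)) hint]
  have hb : ∀ l ∈ Ioo 0 W0, ‖∫ z, {p : ℝ × ℝ | p.2 < W p.1}.indicator (fun p => φ p.1) (z, l)‖ ≤ M := by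
    intro l hl
    have : ∀ z, {p : ℝ × ℝ | p.2 < W p.1}.indicator (fun p => φ p.1) (z, l) =
        {z | l < W z}.indicator φ z := by
      intro z; simp [indicator]
    simp_rw [this]
    have hmS : MeasurableSet {z | l < W z} := measurableSet_lt measurable_const hWm
    rw [integral_indicator hmS, Real.norm_eq_abs]
    set S := {z | l < W z} with hS
    rcases S.eq_empty_or_nonempty with h | ⟨z0, hz0⟩
    · rw [h]; simpa using hM0
    have hbd : ∀ z ∈ S, |z| ≤ L := by
      intro z hz
      by_contra hc
      have h1 := hsupp z (not_le.1 hc)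
      have h2 : l < W z := hz
      have := hl.1
      linarith
    have hbdd : BddAbove (Set.image abs S) := ⟨L, by rintro _ ⟨z, hz, rfl⟩; exact hbd z hz⟩
    set c := sSup (Set.image abs S) with hc
    have hc1 : ∀ z ∈ S, |z| ≤ c := fun z hz => le_csSup hbdd ⟨z, hz, rfl⟩
    have hc0 : 0 ≤ c := (abs_nonneg _).trans (hc1 z0 hz0)
    have hcL : c ≤ L := csSup_le ⟨_, z0, hz0, rfl⟩ (by rintro _ ⟨z, hz, rfl⟩; exact hbd z hz)
    have hsub : Ioo (-c) c ⊆ S := by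
      intro z hz
      have hz' : |z| < c := abs_lt.2 hz
      obtain ⟨_, ⟨w, hw, rfl⟩, hzw⟩ := exists_lt_of_lt_csSup (s := Set.image abs S)
        ⟨_, z0, hz0, rfl⟩ hz'
      exact lt_of_lt_of_le hw (hanti z w hzw.le)
    have hsub2 : S ⊆ Icc (-c) c := fun z hz => abs_le.1 (hc1 z hz)
    have hae : S =ᵐ[volume] (Ioc (-c) c : Set ℝ) := by
      refine (Filter.EventuallyLE.antisymm ?_ ?_)
      · exact (HasSubset.Subset.eventuallyLE hsub2).trans Ioc_ae_eq_Icc.symm.le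
      · exact Ioo_ae_eq_Ioc.symm.le.trans (HasSubset.Subset.eventuallyLE hsub)
    rw [setIntegral_congr_set hae, ← intervalIntegral.integral_of_le (by linarith)]
    exact hM c hc0 hcL
  have := norm_setIntegral_le_of_norm_le_const (μ := (volume : Measure ℝ)) (s := Ioo 0 W0) (by simp) hb
  rw [Real.norm_eq_abs] at this
  refine this.trans ?_
  simp [hW00, mul_comm]

/-- thin spherical shell -/
def shell (d : ℕ) (η t : ℝ) : Set (EE d) := {z | t^2 ≤ ‖z‖^2 ∧ ‖z‖^2 ≤ (1+η)*t^2}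

lemma shell_meas (d : ℕ) (η t : ℝ) : MeasurableSet (shell d η t) := by
  unfold shell
  exact ((isClosed_le (f := fun z : EE d => t^2) (g := fun z => ‖z‖^2) (by fun_prop)
    (by fun_prop)).inter (isClosed_le (f := fun z : EE d => ‖z‖^2) (g := fun z => (1+η)*t^2)
      (by fun_prop) (by fun_prop))).measurableSet

def vs (d : ℕ) (η : ℝ) : ℝ := vb d * (√(1+η)^d - 1)

lemma vs_ge (d : ℕ) (hd : 2 ≤ d) (η : ℝ) (hη : 0 ≤ η) : vb d * η ≤ vs d η := by
  unfold vs
  have := vb_pos d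
  gcongr
  have h1 : (1:ℝ) ≤ √(1+η) := by rw [Real.one_le_sqrt]; linarith
  have h2 : √(1+η)^2 ≤ √(1+η)^d := pow_le_pow_right₀ h1 hd
  rw [Real.sq_sqrt (by linarith)] at h2
  linarith

lemma vs_pos (d : ℕ) (hd : 2 ≤ d) (η : ℝ) (hη : 0 < η) : 0 < vs d η :=
  lt_of_lt_of_le (mul_pos (vb_pos d) hη) (vs_ge d hd η hη.le)

lemma vol_shell (d : ℕ) (hd : 2 ≤ d) (η t : ℝ) (hη : 0 ≤ η) (ht : 0 < t) :
    volume (shell d η t) = ENNReal.ofReal (vs d η * t^d) := by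
  unfold shell vs
  rw [vol_annulus d (by omega) _ _ (by nlinarith [sq_nonneg t]), Real.sqrt_mul (by linarith),
    Real.sqrt_sq ht.le]
  congr 1
  ring

/-- normalized kernel -/
def kk (d : ℕ) (η t : ℝ) (y : EE d) : ℝ := (shell d η t).indicator (fun _ => (vs d η * t^d)⁻¹) y

def mm (d : ℕ) (η r : ℝ) : ℝ :=
  vb (d-1) / vs d η * ∫ u, WW (d-1) η u * Real.cos (2 * Real.pi * r * u)

lemma marginal (n : ℕ) (hn : 1 ≤ n) (η : ℝ) (hη : 0 ≤ η) (e : EE (n+1)) (he : ‖e‖ = 1) :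
    (volume.restrict (shell (n+1) η 1)).map (fun y => inner ℝ e y) =
      volume.withDensity (fun z => ENNReal.ofReal (vb n * WW n η z)) := by
  have hinn : Measurable (fun y : EE (n+1) => inner ℝ e y) := by fun_prop
  ext s hs
  rw [Measure.map_apply hinn hs, Measure.restrict_apply (hinn hs), withDensity_apply _ hs]
  have hF : Measurable (Function.uncurry (fun z r : ℝ =>
      (s ×ˢ Icc (1:ℝ) (1+η)).indicator (fun _ => (1:ℝ≥0∞)) (z, r))) := by
    exact measurable_const.indicator (hs.prod measurableSet_Icc)
  have := coord n e he _ hF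
  rw [← lintegral_indicator_one ((hinn hs).inter (shell_meas _ _ _))]
  convert this using 1
  · congr 1
    ext y
    have hiff : y ∈ (fun y => inner ℝ e y) ⁻¹' s ∩ shell (n+1) η 1 ↔
        (inner ℝ e y, ‖y‖^2) ∈ s ×ˢ Icc (1:ℝ) (1+η) := by
      rw [mem_inter_iff, mem_preimage, shell, mem_ofPred_eq, mem_prod, mem_Icc, one_pow, mul_one]
    by_cases hy : y ∈ (fun y => inner ℝ e y) ⁻¹' s ∩ shell (n+1) η 1
    · rw [indicator_of_mem hy, indicator_of_mem (hiff.1 hy)]; rfl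
    · rw [indicator_of_notMem hy, indicator_of_notMem (fun h => hy (hiff.2 h))]
  · rw [← lintegral_indicator hs]
    congr 1
    ext z
    by_cases hz : z ∈ s
    · have : ∀ v : EE n, (s ×ˢ Icc (1:ℝ) (1+η)).indicator (fun _ => (1:ℝ≥0∞)) (z, z^2 + ‖v‖^2) =
        {v : EE n | 1 - z^2 ≤ ‖v‖^2 ∧ ‖v‖^2 ≤ 1 + η - z^2}.indicator 1 v := by
        intro v
        have h1 : (1 ≤ z^2 + ‖v‖^2) ↔ 1 - z^2 ≤ ‖v‖^2 := by constructor <;> intro <;> linarith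
        have h2 : (z^2 + ‖v‖^2 ≤ 1 + η) ↔ ‖v‖^2 ≤ 1 + η - z^2 := by
          constructor <;> intro <;> linarith
        simp only [indicator, mem_prod, hz, mem_Icc, mem_ofPred_eq, true_and, Pi.one_apply, h1, h2]
      simp_rw [this]
      rw [lintegral_indicator_one, vol_annulus n hn _ _ (by linarith)]
      · simp [hz, WW]
      · exact ((isClosed_le (f := fun v : EE n => 1 - z^2) (g := fun v => ‖v‖^2) (by fun_prop)
          (by fun_prop)).inter (isClosed_le (f := fun v : EE n => ‖v‖^2) (g := fun v => 1 + η - z^2)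
          (by fun_prop) (by fun_prop))).measurableSet
    · simp [indicator, hz]

lemma WW_integrable (n : ℕ) (hn : 2 ≤ n) (η : ℝ) (hη : 0 ≤ η) (hη1 : η ≤ 1) :
    Integrable (WW n η) := by
  apply (WW_cont n η).integrable_of_hasCompactSupport
  apply HasCompactSupport.intro (K := Icc (-2) 2) isCompact_Icc
  intro x hx
  apply WW_supp n hn η x hη hη1
  by_contra hc
  exact hx (abs_le.1 (not_lt.1 hc))

lemma fourier_kk (d : ℕ) (hd : 3 ≤ d) (η t : ℝ) (hη : 0 < η) (hη1 : η ≤ 1) (ht : 0 < t)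
    (ξ : EE d) : 𝓕 (fun y : EE d => (kk d η t y : ℂ)) ξ = (mm d η (t * ‖ξ‖) : ℂ) := by
  obtain ⟨n, rfl⟩ : ∃ n, d = n + 1 := ⟨d-1, by omega⟩
  have hn : 2 ≤ n := by omega
  have hvs := vs_pos (n+1) (by omega) η hη
  obtain ⟨e, he, hξ⟩ : ∃ e : EE (n+1), ‖e‖ = 1 ∧ ξ = ‖ξ‖ • e := by
    by_cases h : ξ = 0
    · refine ⟨EuclideanSpace.single 0 1, by simp, by simp [h]⟩
    · refine ⟨‖ξ‖⁻¹ • ξ, by simp [norm_smul, h], by simp [smul_smul, h]⟩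
  rw [Real.fourier_eq']
  set g : EE (n+1) → ℂ := fun v => cexp (↑(-2 * Real.pi * inner ℝ v ξ) * I) • (kk (n+1) η t v : ℂ) with hg
  have h1 := Measure.integral_comp_smul (volume : Measure (EE (n+1))) g t
  have h2 : ∀ w, g (t • w) = (shell (n+1) η 1).indicator (fun w =>
      ((vs (n+1) η * t^(n+1))⁻¹ : ℂ) * cexp (↑(-2 * Real.pi * (t * ‖ξ‖) * inner ℝ e w) * I)) w := by
    intro w
    have hin : inner ℝ (t • w) ξ = t * ‖ξ‖ * inner ℝ e w := by
      conv_lhs => rw [hξ]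
      rw [inner_smul_left, inner_smul_right, real_inner_comm]
      simp; ring
    have hmem : t • w ∈ shell (n+1) η t ↔ w ∈ shell (n+1) η 1 := by
      have ht2 : 0 < t^2 := by positivity
      simp only [shell, mem_ofPred_eq, norm_smul, mul_pow, Real.norm_eq_abs, sq_abs, one_pow, mul_one]
      rw [mul_comm (1+η), mul_le_mul_iff_right₀ ht2, le_mul_iff_one_le_right ht2]
    by_cases hw : w ∈ shell (n+1) η 1
    · simp only [hg, hin, kk]
      rw [indicator_of_mem hw, indicator_of_mem (hmem.2 hw)]
      simp only [smul_eq_mul]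
      push_cast
      rw [mul_comm]
      congr 2
      ring
    · simp only [hg, hin, kk]
      rw [indicator_of_notMem hw, indicator_of_notMem (fun h => hw (hmem.1 h))]
      simp
  have h3 : ∫ v, g v = ((vs (n+1) η)⁻¹ : ℂ) *
      ∫ w in shell (n+1) η 1, cexp (↑(-2 * Real.pi * (t * ‖ξ‖) * inner ℝ e w) * I) := by
    have : (∫ v, g v) = ((t^(n+1) : ℝ) : ℂ) * ∫ w, g (t • w) := by
      rw [h1]
      have htp : (0:ℝ) < t^(n+1) := by positivity
      rw [finrank_euclideanSpace_fin, abs_of_pos (inv_pos.2 htp), ← Complex.coe_smul, smul_eq_mul,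
        ← mul_assoc, ← ofReal_mul, mul_inv_cancel₀ htp.ne', ofReal_one, one_mul]
    rw [this]
    simp_rw [h2]
    rw [integral_indicator (shell_meas _ _ _), integral_const_mul, ← mul_assoc]
    congr 1
    have htc : (t:ℂ)^(n+1) ≠ 0 := by simp [ht.ne']
    push_cast
    rw [mul_inv]
    field_simp
  rw [h3]
  set a := 2 * Real.pi * (t * ‖ξ‖) with ha
  have h4 : ∫ w in shell (n+1) η 1, cexp (↑(-2 * Real.pi * (t * ‖ξ‖) * inner ℝ e w) * I) =
      ∫ u : ℝ, cexp (↑(-a * u) * I) ∂((volume.restrict (shell (n+1) η 1)).map (fun y => inner ℝ e y)) := by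
    rw [integral_map]
    · congr 1
      ext w
      congr 3
      rw [ha]; ring
    · fun_prop
    · apply Continuous.aestronglyMeasurable; fun_prop
  rw [h4, marginal n (by omega) η hη.le e he, integral_withDensity_eq_integral_toReal_smul
    (by have := (WW_cont n η).measurable; fun_prop) (by simp)]
  have hw : ∀ u : ℝ, (ENNReal.ofReal (vb n * WW n η u)).toReal = vb n * WW n η u := fun u =>
    ENNReal.toReal_ofReal (mul_nonneg (vb_pos n).le (WW_nonneg n η u hη.le))
  simp_rw [hw]
  have hint : ∀ b : ℝ, Integrable (fun u : ℝ => (vb n * WW n η u) • cexp (↑(b * u) * I)) := by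
    intro b
    have := ((WW_integrable n hn η hη.le hη1).const_mul (vb n)).ofReal (𝕜 := ℂ)
    refine (this.bdd_mul (f := fun u : ℝ => cexp (↑(b * u) * I)) (c := 1) ?_ ?_).congr ?_
    · apply Continuous.aestronglyMeasurable; fun_prop
    · refine Filter.Eventually.of_forall fun u => ?_
      rw [Complex.norm_exp_ofReal_mul_I]
    · refine Filter.Eventually.of_forall fun u => ?_
      simp; ring
  have h5 : ∫ u : ℝ, (vb n * WW n η u) • cexp (↑(-a * u) * I) =
      ∫ u : ℝ, (vb n * WW n η u) • cexp (↑(a * u) * I) := by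
    rw [← integral_neg_eq_self]
    congr 1
    ext u
    simp [WW]
  have h6 : ∫ u : ℝ, (vb n * WW n η u) • cexp (↑(-a * u) * I) =
      ∫ u : ℝ, ((vb n * (WW n η u * Real.cos (a * u)) : ℝ) : ℂ) := by
    have : ∫ u : ℝ, (vb n * WW n η u) • cexp (↑(-a * u) * I) =
       (1/2 : ℂ) * (∫ u : ℝ, (vb n * WW n η u) • cexp (↑(-a * u) * I) +
        (vb n * WW n η u) • cexp (↑(a * u) * I)) := by
      rw [integral_add (hint _) (hint _), ← h5]; ring
    rw [this, ← integral_const_mul]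
    congr 1
    ext u
    push_cast
    rw [Complex.cos]
    simp only [Complex.real_smul]
    push_cast
    ring_nf
  rw [h6, integral_complex_ofReal, integral_const_mul]
  unfold mm
  rw [Nat.add_sub_cancel]
  push_cast
  rw [div_eq_inv_mul, mul_assoc]

def CC (d : ℕ) : ℝ := vb (d-1) / vb d * ((d-1 : ℕ) * √2^(d-3))

lemma CC_nonneg (d : ℕ) : 0 ≤ CC d := by
  unfold CC
  have := vb_pos d
  have := vb_pos (d-1)
  positivity

lemma mult_gen (d : ℕ) (hd : 3 ≤ d) (η : ℝ) (hη : 0 < η) (hη1 : η ≤ 1) (φ : ℝ → ℝ)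
    (hφ : Continuous φ) (M : ℝ) (hM : ∀ c ∈ Icc (0:ℝ) 2, |∫ z in (-c)..c, φ z| ≤ M) :
    |vb (d-1) / vs d η * ∫ u, WW (d-1) η u * φ u| ≤ CC d * M := by
  have hn : 2 ≤ d - 1 := by omega
  have hM0 : 0 ≤ M := le_trans (abs_nonneg _) (hM 0 (by simp))
  have h := unimodal (WW (d-1) η) ((d-1:ℕ) * √2^(d-1-2) * η) 2 M (WW_cont _ _).measurable
    (fun z => WW_nonneg _ η z hη.le) (fun z => WW_le _ hn η z hη.le hη1)
    (fun z z' h => WW_anti _ hn η z z' hη.le h) (by norm_num)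
    (fun z hz => WW_supp _ hn η z hη.le hη1 hz) φ hφ (fun c h0 h2 => hM c ⟨h0, h2⟩)
  have hv := vs_ge d (by omega) η hη.le
  have hvp := vs_pos d (by omega) η hη
  have h1 := vb_pos d
  have h2 := vb_pos (d-1)
  rw [abs_mul, abs_of_pos (div_pos h2 hvp)]
  calc vb (d-1) / vs d η * |∫ u, WW (d-1) η u * φ u|
      ≤ vb (d-1) / (vb d * η) * ((d-1:ℕ) * √2^(d-1-2) * η * M) := by gcongr
    _ = CC d * M := by
      unfold CC
      have : d - 1 - 2 = d - 3 := by omega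
      rw [this]
      field_simp

lemma int_cos (r c : ℝ) (hr : r ≠ 0) :
    ∫ u in (-c)..c, Real.cos (2 * Real.pi * r * u) = Real.sin (2 * Real.pi * r * c) / (Real.pi * r) := by
  have hp := Real.pi_pos
  rw [intervalIntegral.integral_comp_mul_left (f := Real.cos) (by positivity)]
  rw [integral_cos]
  simp
  field_simp
  ring

lemma mm_bound (d : ℕ) (hd : 3 ≤ d) (η : ℝ) (hη : 0 < η) (hη1 : η ≤ 1) (r : ℝ) (hr : 0 < r) :
    |mm d η r| ≤ CC d * (1 / r) := by
  unfold mm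
  apply mult_gen d hd η hη hη1 _ (by fun_prop)
  intro c hc
  rw [int_cos r c hr.ne', abs_div, abs_of_pos (mul_pos Real.pi_pos hr)]
  apply div_le_div₀ (by norm_num) (Real.abs_sin_le_one _) hr
  nlinarith [Real.pi_gt_three]

lemma cos_int (d : ℕ) (hd : 3 ≤ d) (η : ℝ) (hη : 0 < η) (hη1 : η ≤ 1) (r : ℝ) :
    Integrable (fun u => WW (d-1) η u * Real.cos (2 * Real.pi * r * u)) := by
  have := WW_integrable (d-1) (by omega) η hη.le hη1
  refine this.mul_bdd (c := 1) ?_ ?_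
  · apply Continuous.aestronglyMeasurable; fun_prop
  · exact Filter.Eventually.of_forall fun u => Real.abs_cos_le_one _

lemma mm_sub (d : ℕ) (hd : 3 ≤ d) (η : ℝ) (hη : 0 < η) (hη1 : η ≤ 1) (r r' : ℝ) :
    mm d η r - mm d η r' = vb (d-1) / vs d η * ∫ u, WW (d-1) η u *
      (Real.cos (2 * Real.pi * r * u) - Real.cos (2 * Real.pi * r' * u)) := by
  unfold mm
  rw [← mul_sub, ← integral_sub (cos_int d hd η hη hη1 r) (cos_int d hd η hη hη1 r')]
  congr 2
  ext u
  ring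

lemma abs_cos_sub (a b : ℝ) : |Real.cos a - Real.cos b| ≤ |a - b| := by
  have := Real.cos_sub_cos a b
  rw [this, abs_mul, abs_mul]
  have h1 := Real.abs_sin_le_one ((a+b)/2)
  have h2 : |Real.sin ((a-b)/2)| ≤ |(a-b)/2| := Real.abs_sin_le_abs
  rw [abs_div] at h2
  simp at h2 ⊢
  nlinarith [abs_nonneg (Real.sin ((a-b)/2)), abs_nonneg (Real.sin ((a+b)/2))]

lemma abs_sin_sub (a b : ℝ) : |Real.sin a - Real.sin b| ≤ |a - b| := by
  have := abs_cos_sub (a - Real.pi/2) (b - Real.pi/2)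
  rw [Real.cos_sub_pi_div_two, Real.cos_sub_pi_div_two] at this
  simpa using this

lemma mm_lip (d : ℕ) (hd : 3 ≤ d) (η : ℝ) (hη : 0 < η) (hη1 : η ≤ 1) (r r' : ℝ) :
    |mm d η r - mm d η r'| ≤ CC d * (64 * |r - r'|) := by
  rw [mm_sub d hd η hη hη1]
  apply mult_gen d hd η hη hη1 _ (by fun_prop)
  intro c hc
  have : ∀ u ∈ Set.uIoc (-c) c, ‖Real.cos (2 * Real.pi * r * u) - Real.cos (2 * Real.pi * r' * u)‖ ≤
      16 * |r - r'| := by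
    intro u hu
    rw [Real.norm_eq_abs]
    refine (abs_cos_sub _ _).trans ?_
    have e : 2 * Real.pi * r * u - 2 * Real.pi * r' * u = (2 * Real.pi * u) * (r - r') := by ring
    rw [e, abs_mul]
    gcongr
    rw [uIoc_of_le (by linarith [hc.1])] at hu
    have : |u| ≤ 2 := abs_le.2 ⟨by linarith [hu.1, hc.2], by linarith [hu.2, hc.2]⟩
    rw [abs_mul, abs_mul, abs_of_pos Real.pi_pos]
    simp
    nlinarith [Real.pi_le_four, Real.pi_pos, abs_nonneg u]
  have h2 := intervalIntegral.norm_integral_le_of_norm_le_const this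
  rw [Real.norm_eq_abs] at h2
  refine h2.trans ?_
  have : |c - -c| ≤ 4 := by rw [abs_of_nonneg] <;> linarith [hc.1, hc.2]
  nlinarith [abs_nonneg (r - r')]

lemma mm_lip2 (d : ℕ) (hd : 3 ≤ d) (η : ℝ) (hη : 0 < η) (hη1 : η ≤ 1) (r r' : ℝ) (hr : 0 < r)
    (hr' : 0 < r') :
    |mm d η r - mm d η r'| ≤ CC d * (8 * (|r - r'| / r)) := by
  rw [mm_sub d hd η hη hη1]
  apply mult_gen d hd η hη hη1 _ (by fun_prop)
  intro c hc
  have hp := Real.pi_gt_three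
  rw [intervalIntegral.integral_sub (by apply Continuous.intervalIntegrable; fun_prop)
    (by apply Continuous.intervalIntegrable; fun_prop), int_cos r c hr.ne', int_cos r' c hr'.ne']
  set a := 2 * Real.pi * r * c with ha
  set b := 2 * Real.pi * r' * c with hb
  have e : Real.sin a / (Real.pi * r) - Real.sin b / (Real.pi * r') =
      (Real.sin a - Real.sin b) / (Real.pi * r) + Real.sin b * (r' - r) / (Real.pi * r * r') := by
    field_simp; ring
  rw [e]
  refine (abs_add_le _ _).trans ?_
  have h1 : |(Real.sin a - Real.sin b) / (Real.pi * r)| ≤ 4 * (|r - r'| / r) := by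
    rw [abs_div, abs_of_pos (show 0 < Real.pi * r by positivity)]
    have : |Real.sin a - Real.sin b| ≤ 4 * Real.pi * |r - r'| := by
      refine (abs_sin_sub a b).trans ?_
      have e : a - b = (2 * Real.pi * c) * (r - r') := by rw [ha, hb]; ring
      rw [e, abs_mul, abs_of_nonneg (by have := hc.1; positivity)]
      have := hc.2
      apply mul_le_mul_of_nonneg_right _ (abs_nonneg _)
      nlinarith
    rw [div_le_iff₀ (by positivity)]
    refine this.trans (le_of_eq ?_)
    field_simp
  have h2 : |Real.sin b * (r' - r) / (Real.pi * r * r')| ≤ 4 * (|r - r'| / r) := by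
    rw [abs_div, abs_mul, abs_of_pos (show 0 < Real.pi * r * r' by positivity), abs_sub_comm r' r]
    have h3 : |Real.sin b| ≤ 4 * Real.pi * r' := by
      refine Real.abs_sin_le_abs.trans ?_
      rw [abs_of_nonneg (by have := hc.1; positivity)]
      have h0 := hc.2
      have : 0 < Real.pi * r' := by positivity
      rw [hb]
      nlinarith
    rw [div_le_iff₀ (by positivity)]
    calc |Real.sin b| * |r - r'| ≤ (4 * Real.pi * r') * |r - r'| := by gcongr
      _ = _ := by field_simp
  linarith

lemma kk_integrable (d : ℕ) (hd : 3 ≤ d) (η t : ℝ) (hη : 0 < η) (ht : 0 < t) :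
    Integrable (kk d η t) := by
  unfold kk
  refine (integrable_indicator_iff (shell_meas _ _ _)).2 ?_
  apply integrableOn_const
  · rw [vol_shell d (by omega) η t hη.le ht]; simp
  · exact enorm_ne_top

lemma kk_integral (d : ℕ) (hd : 3 ≤ d) (η t : ℝ) (hη : 0 < η) (ht : 0 < t) :
    ∫ y, kk d η t y = 1 := by
  have hvs := vs_pos d (by omega) η hη
  have : (fun y => kk d η t y) = (shell d η t).indicator (fun _ => (vs d η * t^d)⁻¹) := rfl
  rw [this, integral_indicator (shell_meas _ _ _), setIntegral_const, Measure.real,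
    vol_shell d (by omega) η t hη.le ht, ENNReal.toReal_ofReal (by positivity), smul_eq_mul]
  apply mul_inv_cancel₀
  positivity

lemma mm_zero (d : ℕ) (hd : 3 ≤ d) (η : ℝ) (hη : 0 < η) (hη1 : η ≤ 1) : mm d η 0 = 1 := by
  have := fourier_kk d hd η 1 hη hη1 one_pos 0
  rw [Real.fourier_eq'] at this
  simp only [inner_zero_right, mul_zero, ofReal_zero, zero_mul, Complex.exp_zero, one_smul, norm_zero] at this
  rw [integral_complex_ofReal, kk_integral d hd η 1 hη one_pos] at this
  exact_mod_cast this.symm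

lemma psi_bound (ρ s x K : ℝ) (hρ : 0 < ρ) (hs : 0 < s) (hs1 : s ≤ 1) (hK : 0 ≤ K) (hx : 0 ≤ x)
    (h1 : x ≤ K * (1/ρ)) (h2 : x ≤ K * s^2) (h3 : x ≤ K * (s^2*ρ)) :
    x^2 ≤ K^2 * (s^3 * min ρ √(1/ρ)) := by
  rcases hK.eq_or_lt with rfl | hK
  · have : x = 0 := by linarith
    simp [this]
  set m := x / K with hm
  have hm0 : 0 ≤ m := by positivity
  have e : x = K * m := by rw [hm]; field_simp
  have h1 : m ≤ 1/ρ := by rw [hm, div_le_iff₀ hK]; linarith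
  have h2 : m ≤ s^2 := by rw [hm, div_le_iff₀ hK]; linarith
  have h3 : m ≤ s^2*ρ := by rw [hm, div_le_iff₀ hK]; linarith
  rw [e, mul_pow]
  gcongr
  rw [mul_min_of_nonneg _ _ (by positivity)]
  apply le_min
  · calc m^2 = m * m := by ring
      _ ≤ s^2 * (s^2*ρ) := by gcongr
      _ = s * (s^3 * ρ) := by ring
      _ ≤ 1 * (s^3 * ρ) := by gcongr
      _ = _ := by ring
  · have ha : √m ≤ s := Real.sqrt_le_iff.2 ⟨hs.le, h2⟩
    have hb : √m ≤ √(1/ρ) := Real.sqrt_le_sqrt h1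
    calc m^2 = (√m ^2)^2 := by rw [Real.sq_sqrt hm0]
      _ = √m^3 * √m := by ring
      _ ≤ s^3 * √(1/ρ) := by gcongr

lemma geo_scale (a : ℝ) (ha : 0 < a) : ∃ m : ℤ, ∀ k : ℤ,
    min ((4:ℝ)^k * a) √(1/((4:ℝ)^k * a)) ≤ 4 * (1/2)^((k - m).natAbs) := by
  obtain ⟨m, hm1, hm2⟩ := exists_mem_Ico_zpow ha (show (1:ℝ) < 4 by norm_num)
  refine ⟨-m, fun k => ?_⟩
  have e : (4:ℝ)^k * a = 4^(k+m) * (a / 4^m) := by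
    rw [zpow_add₀ (by norm_num)]; field_simp
  have h4 : (0:ℝ) < 4^m := by positivity
  set b := a / 4^m with hb
  have hb1 : 1 ≤ b := by rw [hb, le_div_iff₀ h4]; linarith
  have hb2 : b ≤ 4 := by
    rw [hb, div_le_iff₀ h4]
    rw [zpow_add₀ (by norm_num)] at hm2
    linarith
  rw [e, sub_neg_eq_add]
  generalize k + m = j
  rcases le_total 0 j with hj | hj
  · obtain ⟨n, rfl⟩ := Int.eq_ofNat_of_zero_le hj
    apply (min_le_right _ _).trans
    rw [Real.sqrt_le_iff]
    refine ⟨by positivity, ?_⟩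
    simp only [zpow_natCast, Int.natAbs_natCast]
    rw [mul_pow, ← pow_mul, mul_comm n 2, pow_mul, one_div, mul_inv]
    norm_num
    have : b⁻¹ ≤ 1 := inv_le_one_of_one_le₀ hb1
    have h0 : (0:ℝ) < (1/4)^n := by positivity
    have e2 : ((4:ℝ)^n)⁻¹ = (1/4)^n := by simp
    rw [e2]
    nlinarith
  · obtain ⟨n, hn⟩ := Int.eq_ofNat_of_zero_le (neg_nonneg.2 hj)
    obtain rfl : j = -(n:ℤ) := by omega
    apply (min_le_left _ _).trans
    simp only [zpow_neg, zpow_natCast, Int.natAbs_neg, Int.natAbs_natCast]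
    have e2 : ((4:ℝ)^n)⁻¹ ≤ (1/2)^n := by
      rw [one_div, inv_pow]
      apply inv_anti₀ (by positivity)
      gcongr; norm_num
    have h0 : (0:ℝ) < (1/2)^n := by positivity
    calc ((4:ℝ)^n)⁻¹ * b ≤ (1/2)^n * 4 := by gcongr
      _ = _ := by ring

lemma mult_chain (d : ℕ) (hd : 3 ≤ d) (a : ℝ) (ha : 0 < a) : ∃ m : ℤ, ∀ (k : ℤ) (η : ℝ), 0 < η → η ≤ 1 →
    (∀ s r r' : ℝ, 0 < s → s ≤ 1 → 1 ≤ r → 1 ≤ r' → |r - r'| ≤ 3 * s^2 →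
      (mm d η (4^k * r * a) - mm d η (4^k * r' * a))^2 ≤ 4 * (192 * CC d)^2 * s^3 * (1/2)^((k-m).natAbs)) ∧
    (mm d η (4^k*a) - mm d 1 (4^k*a))^2 ≤ 4 * (192 * CC d)^2 * (1/2)^((k-m).natAbs) := by
  obtain ⟨m, hm⟩ := geo_scale a ha
  have hC := CC_nonneg d
  refine ⟨m, fun k η hη hη1 => ⟨fun s r r' hs hs1 hr hr' hrr => ?_, ?_⟩⟩
  · have hρ : 0 < (4:ℝ)^k * a := by positivity
    set ρ := (4:ℝ)^k * a with hρd
    have e1 : (4:ℝ)^k * r * a = r * ρ := by rw [hρd]; ring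
    have e2 : (4:ℝ)^k * r' * a = r' * ρ := by rw [hρd]; ring
    have ed : |r * ρ - r' * ρ| ≤ 3 * s^2 * ρ := by
      rw [← sub_mul, abs_mul, abs_of_pos hρ]; gcongr
    have b1 := mm_bound d hd η hη hη1 (r * ρ) (by positivity)
    have b2 := mm_bound d hd η hη hη1 (r' * ρ) (by positivity)
    have b3 := mm_lip d hd η hη hη1 (r*ρ) (r'*ρ)
    have b4 := mm_lip2 d hd η hη hη1 (r*ρ) (r'*ρ) (by positivity) (by positivity)
    rw [e1, e2, ← sq_abs]
    have key := psi_bound ρ s |mm d η (r*ρ) - mm d η (r'*ρ)| (192 * CC d) hρ hs hs1 (by positivity)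
      (abs_nonneg _) ?_ ?_ ?_
    · refine key.trans ?_
      calc (192 * CC d)^2 * (s^3 * min ρ √(1/ρ)) ≤ (192 * CC d)^2 * (s^3 * (4 * (1/2)^((k - m).natAbs))) := by
            gcongr; exact hm k
        _ = _ := by ring
    · have : 1/(r*ρ) ≤ 1/ρ := by gcongr; nlinarith
      have h' : 1/(r'*ρ) ≤ 1/ρ := by gcongr; nlinarith
      have h0 : 0 < 1/ρ := by positivity
      have := abs_sub (mm d η (r*ρ)) (mm d η (r'*ρ))
      nlinarith
    · have : |r * ρ - r' * ρ| / (r * ρ) ≤ 3 * s^2 := by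
        rw [div_le_iff₀ (by positivity)]
        refine ed.trans ?_
        gcongr; nlinarith
      have h0 : 0 < s^2 := by positivity
      nlinarith
    · nlinarith
  · have hρ : 0 < (4:ℝ)^k * a := by positivity
    set ρ := (4:ℝ)^k * a with hρd
    have b1 := mm_bound d hd η hη hη1 ρ hρ
    have b2 := mm_bound d hd 1 one_pos le_rfl ρ hρ
    have b3 := mm_lip d hd η hη hη1 ρ 0
    have b4 := mm_lip d hd 1 one_pos le_rfl ρ 0
    rw [mm_zero d hd _ hη hη1, sub_zero, abs_of_pos hρ] at b3
    rw [mm_zero d hd _ one_pos le_rfl, sub_zero, abs_of_pos hρ] at b4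
    rw [← sq_abs]
    have t1 : |mm d η ρ - mm d 1 ρ| ≤ 2 * CC d * (1/ρ) := by
      have := abs_sub (mm d η ρ) (mm d 1 ρ)
      linarith
    have t2 : |mm d η ρ - mm d 1 ρ| ≤ 128 * CC d * ρ := by
      have := abs_sub (mm d η ρ - 1) (mm d 1 ρ - 1)
      rw [sub_sub_sub_cancel_right] at this
      linarith
    have h0 : 0 < 1/ρ := by positivity
    have key := psi_bound ρ 1 |mm d η ρ - mm d 1 ρ| (192 * CC d) hρ one_pos le_rfl (by positivity)
      (abs_nonneg _) ?_ ?_ ?_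
    · refine key.trans ?_
      calc (192 * CC d)^2 * (1^3 * min ρ √(1/ρ)) ≤ (192 * CC d)^2 * (1^3 * (4 * (1/2)^((k - m).natAbs))) := by
            gcongr; exact hm k
        _ = _ := by ring
    · nlinarith [mul_nonneg hC h0.le]
    · rcases le_total ρ 1 with h | h
      · nlinarith
      · have : 1/ρ ≤ 1 := by rw [div_le_one hρ]; exact h
        nlinarith
    · nlinarith [mul_nonneg hC hρ.le]

lemma plancherel (d : ℕ) (f : EE d → ℂ) (hf : Integrable f) (hf2 : MemLp f 2) :
    ∫⁻ ξ, ‖𝓕 f ξ‖ₑ^2 = ∫⁻ x, ‖f x‖ₑ^2 := by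
  set F : Lp ℂ 2 (volume : Measure (EE d)) := hf2.toLp f with hF
  have hFf : F =ᵐ[volume] f := hf2.coeFn_toLp
  have hcont : Continuous (𝓕 f) := by
    exact VectorFourier.fourierIntegral_continuous Real.continuous_fourierChar (by exact continuous_inner) hf
  have key : ∀ᵐ ξ, 𝓕 f ξ = (𝓕 F : Lp ℂ 2 (volume : Measure (EE d))) ξ := by
    apply ae_eq_of_integral_contDiff_smul_eq
    · exact hcont.locallyIntegrable
    · exact ((Lp.memLp (𝓕 F)).locallyIntegrable (by norm_num))
    · intro g hg hgc
      have hg' : ContDiff ℝ ((⊤ : ℕ∞) : WithTop ℕ∞) (fun x => (g x : ℂ)) :=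
        Complex.ofRealCLM.contDiff.comp hg
      have hgc' : HasCompactSupport (fun x => (g x : ℂ)) := hgc.comp_left (g := fun x : ℝ => (x:ℂ)) (by simp)
      set φ := hgc'.toSchwartzMap hg' with hφ
      have hφx : ∀ x, φ x = g x := fun x => rfl
      have h1 := congrArg (fun T => T φ) (Lp.fourier_toTemperedDistribution_eq F)
      simp only [TemperedDistribution.fourier_apply, Lp.toTemperedDistribution_apply] at h1
      have h2 : ∫ x, (𝓕 φ) x • F x = ∫ x, (𝓕 (φ : EE d → ℂ)) x • f x := by
        apply integral_congr_ae
        filter_upwards [hFf] with x hx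
        rw [hx, SchwartzMap.fourier_coe]
      have h3 : ∫ x, (𝓕 (φ : EE d → ℂ)) x • f x = ∫ x, φ x • 𝓕 f x := by
        have := VectorFourier.integral_fourierIntegral_smul_eq_flip (L := innerₗ (EE d))
          (μ := (volume : Measure (EE d))) (ν := (volume : Measure (EE d)))
          Real.continuous_fourierChar (by exact continuous_inner) φ.integrable hf
        simpa using! this
      rw [h2, h3] at h1
      simp only [hφx] at h1
      simpa using h1
  have h4 : ∫⁻ ξ, ‖𝓕 f ξ‖ₑ^2 = ∫⁻ ξ, ‖(𝓕 F : Lp ℂ 2 (volume : Measure (EE d))) ξ‖ₑ^2 := by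
    apply lintegral_congr_ae
    filter_upwards [key] with x hx
    rw [hx]
  have h5 : ∫⁻ ξ, ‖f ξ‖ₑ^2 = ∫⁻ ξ, ‖F ξ‖ₑ^2 := by
    apply lintegral_congr_ae
    filter_upwards [hFf] with x hx
    rw [hx]
  have h6 : ∀ G : Lp ℂ 2 (volume : Measure (EE d)), ∫⁻ ξ, ‖G ξ‖ₑ^2 = ‖G‖ₑ^2 := by
    intro G
    rw [Lp.enorm_def, eLpNorm_eq_lintegral_rpow_enorm_toReal (by norm_num) (by norm_num)]
    simp
    rw [← ENNReal.rpow_natCast, ← ENNReal.rpow_mul]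
    simp
  rw [h4, h5, h6, h6]
  congr 1
  rw [← ofReal_norm, ← ofReal_norm, Lp.norm_fourier_eq]

open Convolution in
lemma conv_plancherel (d : ℕ) (κ f : EE d → ℂ) (hκ : Integrable κ) (B : ℝ) (hB : ∀ x, ‖κ x‖ ≤ B)
    (hf : Integrable f) :
    ∫⁻ x, ‖∫ y, κ y * f (x - y)‖ₑ^2 = ∫⁻ ξ, ‖𝓕 κ ξ‖ₑ^2 * ‖𝓕 f ξ‖ₑ^2 := by
  set g : EE d → ℂ := κ ⋆[ContinuousLinearMap.mul ℂ ℂ] f with hg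
  have hgx : ∀ x, g x = ∫ y, κ y * f (x - y) := fun x => rfl
  have hgi : Integrable g := hκ.integrable_convolution _ hf
  have hgb : ∀ x, ‖g x‖ ≤ B * ∫ y, ‖f y‖ := by
    intro x
    rw [hgx]
    have : ∫ y, ‖f y‖ = ∫ y, ‖f (x - y)‖ := (integral_sub_left_eq_self (fun y => ‖f y‖) volume x).symm
    rw [this, ← integral_const_mul]
    apply norm_integral_le_of_norm_le ((hf.comp_sub_left x).norm.const_mul B)
    refine Filter.Eventually.of_forall fun y => ?_
    rw [norm_mul]
    gcongr
    exact hB y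
  have hg2 : MemLp g 2 := by
    rw [memLp_two_iff_integrable_sq_norm hgi.1]
    simp_rw [sq]
    exact hgi.norm.bdd_mul hgi.norm.1 (c := B * ∫ y, ‖f y‖) (Filter.Eventually.of_forall fun x => by
      rw [norm_norm]; exact hgb x)
  have := plancherel d g hgi hg2
  simp_rw [hgx] at this
  rw [← this]
  congr 1
  ext ξ
  have := Real.fourier_mul_convolution_eq hκ hf ξ
  rw [this, enorm_mul, mul_pow]

lemma weak_type (d : ℕ) {ι : Type} (S : Finset ι) (r : ι → ℝ) (hr : ∀ k, 0 < r k)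
    (f : EE d → ℝ≥0∞) (hf : Measurable f) (l : ℝ≥0∞) :
    l * volume {x : EE d | ∃ k ∈ S, l * volume (closedBall x (r k)) < ∫⁻ y in closedBall x (r k), f y} ≤
      4^d * ∫⁻ y, f y := by
  classical
  set A := {x : EE d | ∃ k ∈ S, l * volume (closedBall x (r k)) < ∫⁻ y in closedBall x (r k), f y} with hA
  by_cases hS : S.Nonempty
  swap
  · have : A = ∅ := by
      rw [Finset.not_nonempty_iff_eq_empty] at hS
      rw [hA, hS]; ext x
      constructor
      · rintro ⟨k, hk, _⟩; simp at hk
      · rintro ⟨⟩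
    simp [this]
  obtain ⟨k0, hk0⟩ := hS
  have hex : ∀ x : EE d, ∃ k ∈ S, x ∈ A → l * volume (closedBall x (r k)) < ∫⁻ y in closedBall x (r k), f y := by
    intro x
    by_cases hx : x ∈ A
    · obtain ⟨k, hk, h⟩ := hx
      exact ⟨k, hk, fun _ => h⟩
    · exact ⟨k0, hk0, fun h => absurd h hx⟩
  choose κ hκS hκ using hex
  obtain ⟨u, huA, hdisj, hcov⟩ := Vitali.exists_disjoint_subfamily_covering_enlargement_closedBall A
    (fun x => x) (fun x => r (κ x)) (∑ k ∈ S, r k)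
    (fun a _ => Finset.single_le_sum (f := r) (fun i _ => (hr i).le) (hκS a)) 4 (by norm_num)
  have huc : u.Countable := hdisj.countable_of_nonempty_interior (fun a _ => by
    refine ⟨a, ?_⟩
    exact ball_subset_interior_closedBall (mem_ball_self (hr _)))
  have hsub : A ⊆ ⋃ b ∈ u, closedBall b (4 * r (κ b)) := by
    intro a ha
    obtain ⟨b, hb, h⟩ := hcov a ha
    exact mem_biUnion hb (h (mem_closedBall_self (hr _).le))
  have hvol : ∀ b : EE d, volume (closedBall b (4 * r (κ b))) = 4^d * volume (closedBall b (r (κ b))) := by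
    intro b
    rw [Measure.addHaar_closedBall _ _ (by have := hr (κ b); positivity), Measure.addHaar_closedBall _ _ (hr _).le,
      finrank_euclideanSpace_fin, mul_pow, ENNReal.ofReal_mul (by positivity), mul_assoc]
    congr 1
    rw [ENNReal.ofReal_pow (by norm_num)]
    norm_num
  calc l * volume A ≤ l * volume (⋃ b ∈ u, closedBall b (4 * r (κ b))) := by gcongr
    _ ≤ l * ∑' b : u, volume (closedBall (b:EE d) (4 * r (κ b))) := by
      gcongr
      exact measure_biUnion_le _ huc _
    _ = 4^d * ∑' b : u, l * volume (closedBall (b:EE d) (r (κ b))) := by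
      rw [← ENNReal.tsum_mul_left, ← ENNReal.tsum_mul_left]
      congr 1
      ext b
      rw [hvol]; ring
    _ ≤ 4^d * ∑' b : u, ∫⁻ y in closedBall (b:EE d) (r (κ b)), f y := by
      gcongr with b
      exact (hκ b (huA b.2)).le
    _ = 4^d * ∫⁻ y in ⋃ b ∈ u, closedBall b (r (κ b)), f y := by
      rw [lintegral_biUnion huc (fun b _ => measurableSet_closedBall) hdisj]
    _ ≤ _ := by
      gcongr
      exact Measure.restrict_le_self

lemma sq_layer (u : ℝ≥0∞) : u^2 ≤ ∫⁻ l in Ioi (0:ℝ), ENNReal.ofReal (2*l) * (if ENNReal.ofReal l < u then 1 else 0) := by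
  have key : ∀ a : ℝ≥0, (a:ℝ≥0∞) ≤ u → (a:ℝ≥0∞)^2 ≤ ∫⁻ l in Ioi (0:ℝ), ENNReal.ofReal (2*l) * (if ENNReal.ofReal l < u then 1 else 0) := by
    intro a ha
    have h1 : ∫⁻ l in Ioo (0:ℝ) a, ENNReal.ofReal (2*l) = (a:ℝ≥0∞)^2 := by
      rw [← ofReal_integral_eq_lintegral_ofReal]
      · rw [← integral_Ioc_eq_integral_Ioo, ← intervalIntegral.integral_of_le (show (0:ℝ) ≤ (a:ℝ) from a.2), intervalIntegral.integral_const_mul,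
          integral_id]
        have : 2 * (((a:ℝ)^2 - 0^2)/2) = (a:ℝ)^2 := by ring
        rw [this, ENNReal.ofReal_pow (show (0:ℝ) ≤ (a:ℝ) from a.2)]
        simp
      · exact ((by fun_prop : Continuous (fun l : ℝ => 2 * l)).integrableOn_Icc (a := (0:ℝ)) (b := (a:ℝ))).mono_set Ioo_subset_Icc_self
      · filter_upwards [ae_restrict_mem measurableSet_Ioo] with l hl
        have := hl.1
        simp; linarith
    rw [← h1, ← lintegral_indicator measurableSet_Ioo, ← lintegral_indicator measurableSet_Ioi]
    apply lintegral_mono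
    intro l
    by_cases hl : l ∈ Ioo (0:ℝ) a
    · have : ENNReal.ofReal l < u := lt_of_lt_of_le (by
        rw [ENNReal.ofReal_lt_iff_lt_toReal hl.1.le (by simp)]; exact hl.2) ha
      rw [indicator_of_mem hl, indicator_of_mem (show l ∈ Ioi 0 from hl.1), if_pos this, mul_one]
    · rw [indicator_of_notMem hl]; exact zero_le
  induction u with
  | top =>
    rw [ENNReal.top_pow (by norm_num)]
    apply ENNReal.le_of_forall_nnreal_lt
    intro r hr
    by_cases h : 1 ≤ r
    · refine le_trans ?_ (key r le_top)
      have : r ≤ r^2 := by nlinarith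
      exact_mod_cast this
    · refine le_trans ?_ (key 1 le_top)
      have : r ≤ 1^2 := by simpa using (not_le.1 h).le
      exact_mod_cast this
  | coe a => exact key a le_rfl

lemma avg_meas (d : ℕ) (r : ℝ) (f : EE d → ℝ≥0∞) (hf : Measurable f) :
    Measurable (fun x => ∫⁻ y in closedBall x r, f y) := by
  have : (fun x => ∫⁻ y in closedBall x r, f y) = fun x => ∫⁻ y, {p : EE d × EE d | dist p.2 p.1 ≤ r}.indicator (fun p => f p.2) (x, y) := by
    ext x
    rw [← lintegral_indicator measurableSet_closedBall]
    rfl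
  rw [this]
  apply Measurable.lintegral_prod_right' (f := fun p : EE d × EE d => {p : EE d × EE d | dist p.2 p.1 ≤ r}.indicator (fun p => f p.2) p)
  apply Measurable.indicator (hf.comp measurable_snd)
  exact (isClosed_le (by fun_prop) (by fun_prop)).measurableSet

lemma hardy_littlewood (d : ℕ) {ι : Type} (S : Finset ι) (r : ι → ℝ) (hr : ∀ k, 0 < r k)
    (f : EE d → ℝ≥0∞) (hf : Measurable f) :
    ∫⁻ x, (⨆ k ∈ S, (volume (closedBall x (r k)))⁻¹ * ∫⁻ y in closedBall x (r k), f y)^2 ≤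
      8 * 4^d * ∫⁻ y, f y ^2 := by
  set M : EE d → ℝ≥0∞ := fun x => ⨆ k ∈ S, (volume (closedBall x (r k)))⁻¹ * ∫⁻ y in closedBall x (r k), f y with hM
  have hvol0 : ∀ x : EE d, ∀ k, volume (closedBall x (r k)) ≠ 0 := fun x k =>
    (measure_closedBall_pos _ _ (hr k)).ne'
  have hvolt : ∀ x : EE d, ∀ k, volume (closedBall x (r k)) ≠ ⊤ := fun x k => measure_closedBall_lt_top.ne
  have hMm : Measurable M := by
    have e : M = fun x => ⨆ k ∈ (S : Set ι), (volume (closedBall x (r k)))⁻¹ * ∫⁻ y in closedBall x (r k), f y := by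
      simp [hM]
    rw [e]
    apply Measurable.biSup _ (S.countable_toSet)
    intro k _
    apply Measurable.mul _ (avg_meas d _ f hf)
    have : (fun x : EE d => (volume (closedBall x (r k)))⁻¹) = fun _ => (volume (closedBall (0 : EE d) (r k)))⁻¹ := by
      ext x; rw [Measure.addHaar_closedBall_center]
    rw [this]; exact measurable_const
  -- truncated functions
  have step : ∀ l : ℝ, 0 < l → ENNReal.ofReal (2*l) * volume {x | ENNReal.ofReal l < M x} ≤
      4 * 4^d * ∫⁻ y, f y * (if ENNReal.ofReal (l/2) < f y then 1 else 0) := by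
    intro l hl
    set g : EE d → ℝ≥0∞ := fun y => f y * (if ENNReal.ofReal (l/2) < f y then 1 else 0) with hg
    have hgm : Measurable g := hf.mul (Measurable.ite (measurableSet_lt measurable_const hf) measurable_const measurable_const)
    have hw := weak_type d S r hr g hgm (ENNReal.ofReal (l/2))
    have hsub : {x | ENNReal.ofReal l < M x} ⊆ {x : EE d | ∃ k ∈ S, ENNReal.ofReal (l/2) * volume (closedBall x (r k)) < ∫⁻ y in closedBall x (r k), g y} := by
      intro x hx
      have hx : ENNReal.ofReal l < M x := hx
      rw [hM] at hx
      simp only [lt_iSup_iff] at hx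
      obtain ⟨k, hk, h⟩ := hx
      refine ⟨k, hk, ?_⟩
      rw [← ENNReal.div_eq_inv_mul, ENNReal.lt_div_iff_mul_lt (Or.inl (hvol0 x k)) (Or.inl (hvolt x k))] at h
      by_contra hcon
      rw [not_lt] at hcon
      have : ∫⁻ y in closedBall x (r k), f y ≤ ENNReal.ofReal l * volume (closedBall x (r k)) := by
        calc ∫⁻ y in closedBall x (r k), f y ≤ ∫⁻ y in closedBall x (r k), (g y + ENNReal.ofReal (l/2)) := by
              apply lintegral_mono
              intro y
              simp only [hg]
              split_ifs with hh
              · simp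
              · simp only [mul_zero, zero_add]; exact not_lt.1 hh
          _ = (∫⁻ y in closedBall x (r k), g y) + ENNReal.ofReal (l/2) * volume (closedBall x (r k)) := by
              rw [lintegral_add_left hgm, lintegral_const, Measure.restrict_apply_univ]
          _ ≤ ENNReal.ofReal (l/2) * volume (closedBall x (r k)) + ENNReal.ofReal (l/2) * volume (closedBall x (r k)) := by gcongr
          _ = _ := by rw [← add_mul, ← ENNReal.ofReal_add (by positivity) (by positivity)]; congr 2; ring
      exact absurd h (not_lt.2 this)
    have e : ENNReal.ofReal (2*l) = 4 * ENNReal.ofReal (l/2) := by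
      rw [show (4:ℝ≥0∞) = ENNReal.ofReal 4 by norm_num, ← ENNReal.ofReal_mul (by norm_num)]
      congr 1; ring
    calc _ ≤ 4 * (ENNReal.ofReal (l/2) * volume {x : EE d | ∃ k ∈ S, ENNReal.ofReal (l/2) * volume (closedBall x (r k)) < ∫⁻ y in closedBall x (r k), g y}) := by
          rw [e, mul_assoc]; gcongr
      _ ≤ 4 * (4^d * ∫⁻ y, g y) := by gcongr
      _ = _ := by rw [mul_assoc]
  calc ∫⁻ x, M x ^2 ≤ ∫⁻ x, ∫⁻ l in Ioi (0:ℝ), ENNReal.ofReal (2*l) * (if ENNReal.ofReal l < M x then 1 else 0) :=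
        lintegral_mono fun x => sq_layer _
    _ = ∫⁻ l in Ioi (0:ℝ), ∫⁻ x, ENNReal.ofReal (2*l) * (if ENNReal.ofReal l < M x then 1 else 0) := by
        apply lintegral_lintegral_swap
        apply Measurable.aemeasurable
        apply Measurable.mul (by fun_prop)
        exact Measurable.ite (measurableSet_lt (by fun_prop) (by fun_prop)) measurable_const measurable_const
    _ = ∫⁻ l in Ioi (0:ℝ), ENNReal.ofReal (2*l) * volume {x | ENNReal.ofReal l < M x} := by
        congr 1
        ext l
        have hms : MeasurableSet {x | ENNReal.ofReal l < M x} := measurableSet_lt measurable_const hMm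
        rw [lintegral_const_mul _ (Measurable.ite hms measurable_const measurable_const), ← lintegral_indicator_one hms]
        congr 1
        apply lintegral_congr
        intro x
        by_cases hx : ENNReal.ofReal l < M x
        · rw [if_pos hx, indicator_of_mem (show x ∈ {x | ENNReal.ofReal l < M x} from hx)]; rfl
        · rw [if_neg hx, indicator_of_notMem (show x ∉ {x | ENNReal.ofReal l < M x} from hx)]
    _ ≤ ∫⁻ l in Ioi (0:ℝ), 4 * 4^d * ∫⁻ y, f y * (if ENNReal.ofReal (l/2) < f y then 1 else 0) := by
        apply setLIntegral_mono' measurableSet_Ioi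
        intro l hl
        exact step l hl
    _ = 4 * 4^d * ∫⁻ l in Ioi (0:ℝ), ∫⁻ y, f y * (if ENNReal.ofReal (l/2) < f y then 1 else 0) := by
        rw [lintegral_const_mul']
        exact ENNReal.mul_ne_top (by norm_num) (ENNReal.pow_ne_top (by norm_num))
    _ = 4 * 4^d * ∫⁻ y, ∫⁻ l in Ioi (0:ℝ), f y * (if ENNReal.ofReal (l/2) < f y then 1 else 0) := by
        congr 1
        apply lintegral_lintegral_swap
        apply Measurable.aemeasurable
        apply Measurable.mul (by fun_prop)
        exact Measurable.ite (measurableSet_lt (by fun_prop) (by fun_prop)) measurable_const measurable_const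
    _ ≤ 4 * 4^d * ∫⁻ y, 2 * f y ^2 := by
        gcongr with y
        rw [lintegral_const_mul _ (Measurable.ite (measurableSet_lt (by fun_prop) (by fun_prop)) measurable_const measurable_const)]
        have : ∫⁻ l in Ioi (0:ℝ), (if ENNReal.ofReal (l/2) < f y then (1:ℝ≥0∞) else 0) ≤ 2 * f y := by
          by_cases hy : f y = ⊤
          · rw [hy]; simp
          · rw [← lintegral_indicator measurableSet_Ioi]
            calc _ ≤ ∫⁻ l, (Ioo (0:ℝ) (2 * (f y).toReal)).indicator 1 l := by
                  apply lintegral_mono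
                  intro l
                  by_cases hl : l ∈ Ioi (0:ℝ)
                  · rw [indicator_of_mem hl]
                    split_ifs with h
                    · rw [indicator_of_mem]; simp
                      refine ⟨hl, ?_⟩
                      rw [ENNReal.ofReal_lt_iff_lt_toReal (by have : 0 < l := hl; positivity) hy] at h
                      linarith
                    · exact zero_le
                  · rw [indicator_of_notMem hl]; exact zero_le
              _ = 2 * f y := by
                  rw [lintegral_indicator_one measurableSet_Ioo, Real.volume_Ioo, sub_zero, ENNReal.ofReal_mul (by norm_num),
                    ENNReal.ofReal_toReal hy]
                  norm_num
        calc _ ≤ f y * (2 * f y) := by gcongr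
          _ = _ := by ring
    _ = _ := by
        rw [lintegral_const_mul' _ _ (by norm_num)]; ring

lemma kk_meas (d : ℕ) (η t : ℝ) : Measurable (kk d η t) := by
  unfold kk
  exact measurable_const.indicator (shell_meas _ _ _)

lemma kk_nonneg (d : ℕ) (hd : 3 ≤ d) (η t : ℝ) (hη : 0 < η) (ht : 0 < t) (y : EE d) : 0 ≤ kk d η t y := by
  have := vs_pos d (by omega) η hη
  unfold kk
  apply indicator_nonneg
  intro _ _
  positivity

lemma kk_bdd (d : ℕ) (hd : 3 ≤ d) (η t : ℝ) (hη : 0 < η) (ht : 0 < t) (y : EE d) :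
    ‖kk d η t y‖ ≤ (vs d η * t^d)⁻¹ := by
  have := vs_pos d (by omega) η hη
  rw [Real.norm_eq_abs, abs_of_nonneg (kk_nonneg d hd η t hη ht y)]
  unfold kk
  apply indicator_le_self'
  intro _ _
  positivity

/-- shell averages -/
def AA (d : ℕ) (η t : ℝ) (F : EE d → ℝ≥0∞) (x : EE d) : ℝ≥0∞ :=
  ∫⁻ y, ENNReal.ofReal (kk d η t y) * F (x - y)

lemma AA_meas (d : ℕ) (η t : ℝ) (F : EE d → ℝ≥0∞) (hF : Measurable F) : Measurable (AA d η t F) := by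
  unfold AA
  have := kk_meas d η t
  apply Measurable.lintegral_prod_right' (f := fun p : EE d × EE d => ENNReal.ofReal (kk d η t p.2) * F (p.1 - p.2))
  fun_prop

lemma AA_mono (d : ℕ) (η t : ℝ) (F G : EE d → ℝ≥0∞) (h : ∀ x, F x ≤ G x) (x : EE d) :
    AA d η t F x ≤ AA d η t G x := by
  unfold AA
  gcongr with y
  exact h _

def AR (d : ℕ) (η t : ℝ) (f : EE d → ℝ) (x : EE d) : ℝ := ∫ y, kk d η t y * f (x - y)

lemma AR_integrable (d : ℕ) (hd : 3 ≤ d) (η t : ℝ) (hη : 0 < η) (ht : 0 < t) (f : EE d → ℝ)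
    (hf : Integrable f) (x : EE d) : Integrable (fun y => kk d η t y * f (x - y)) := by
  refine (hf.comp_sub_left x).bdd_mul (kk_meas d η t).aestronglyMeasurable (c := (vs d η * t^d)⁻¹) ?_
  exact Filter.Eventually.of_forall fun y => kk_bdd d hd η t hη ht y

lemma AA_eq_AR (d : ℕ) (hd : 3 ≤ d) (η t : ℝ) (hη : 0 < η) (ht : 0 < t) (f : EE d → ℝ)
    (hf : Integrable f) (hf0 : ∀ x, 0 ≤ f x) (x : EE d) :
    AA d η t (fun x => ENNReal.ofReal (f x)) x = ENNReal.ofReal (AR d η t f x) := by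
  unfold AA AR
  rw [ofReal_integral_eq_lintegral_ofReal (AR_integrable d hd η t hη ht f hf x)
    (Filter.Eventually.of_forall fun y => mul_nonneg (kk_nonneg d hd η t hη ht y) (hf0 _))]
  congr 1
  ext y
  rw [ENNReal.ofReal_mul (kk_nonneg d hd η t hη ht y)]

lemma diff_plancherel (d : ℕ) (hd : 3 ≤ d) (η η' s t : ℝ) (hη : 0 < η) (hη1 : η ≤ 1) (hη' : 0 < η')
    (hη1' : η' ≤ 1) (hs : 0 < s) (ht : 0 < t) (f : EE d → ℝ) (hf : Integrable f) :
    ∫⁻ x, ENNReal.ofReal ((AR d η s f x - AR d η' t f x)^2) =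
      ∫⁻ ξ, ENNReal.ofReal ((mm d η (s * ‖ξ‖) - mm d η' (t * ‖ξ‖))^2) * ‖𝓕 (fun x => (f x : ℂ)) ξ‖ₑ^2 := by
  set κ : EE d → ℂ := fun y => (kk d η s y : ℂ) - (kk d η' t y : ℂ) with hκ
  have i1 : Integrable (fun y => (kk d η s y : ℂ)) := (kk_integrable d hd η s hη hs).ofReal
  have i2 : Integrable (fun y => (kk d η' t y : ℂ)) := (kk_integrable d hd η' t hη' ht).ofReal
  have h := conv_plancherel d κ (fun x => (f x : ℂ)) (i1.sub i2)
    ((vs d η * s^d)⁻¹ + (vs d η' * t^d)⁻¹) (fun y => by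
      refine (norm_sub_le _ _).trans ?_
      rw [Complex.norm_real, Complex.norm_real]
      exact add_le_add (kk_bdd d hd η s hη hs y) (kk_bdd d hd η' t hη' ht y)) hf.ofReal
  have e1 : ∀ x, ∫ y, κ y * (f (x - y) : ℂ) = ((AR d η s f x - AR d η' t f x : ℝ) : ℂ) := by
    intro x
    unfold AR
    rw [← integral_sub (AR_integrable d hd η s hη hs f hf x) (AR_integrable d hd η' t hη' ht f hf x),
      ← integral_complex_ofReal]
    congr 1
    ext y
    simp only [hκ]
    push_cast
    ring
  have e2 : ∀ ξ, 𝓕 κ ξ = ((mm d η (s * ‖ξ‖) - mm d η' (t * ‖ξ‖) : ℝ) : ℂ) := by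
    intro ξ
    have := fourier_kk d hd η s hη hη1 hs ξ
    have := fourier_kk d hd η' t hη' hη1' ht ξ
    push_cast
    rw [← fourier_kk d hd η s hη hη1 hs ξ, ← fourier_kk d hd η' t hη' hη1' ht ξ]
    rw [Real.fourier_eq', Real.fourier_eq', Real.fourier_eq', ← integral_sub]
    · congr 1
      ext y
      simp only [hκ, smul_sub]
    · simpa [Real.fourier_eq', Circle.smul_def, Real.fourierChar_apply] using (Real.fourierIntegral_convergent_iff ξ).2 i1
    · simpa [Real.fourier_eq', Circle.smul_def, Real.fourierChar_apply] using (Real.fourierIntegral_convergent_iff ξ).2 i2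
  have e3 : ∀ r : ℝ, ‖(r:ℂ)‖ₑ^2 = ENNReal.ofReal (r^2) := by
    intro r
    rw [← ofReal_norm, Complex.norm_real, ← ENNReal.ofReal_pow (norm_nonneg _), Real.norm_eq_abs, sq_abs]
  simp_rw [e1, e2, e3] at h
  exact h

/-- dyadic grid -/
def tt (k : ℤ) (n i : ℕ) : ℝ := 4^k * (1 + 3 * i / 16^n)

lemma tt_pos (k : ℤ) (n i : ℕ) : 0 < tt k n i := by unfold tt; positivity

lemma tt_succ (k : ℤ) (n i : ℕ) : tt k (n+1) (16*i) = tt k n i := by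
  unfold tt
  push_cast
  rw [pow_succ]
  field_simp

lemma chain_abs (a : ℕ → ℕ → ℝ) (b : ℕ → ℝ) (ha : ∀ n i, a (n+1) (16*i) = a n i)
    (hb0 : ∀ n, 0 ≤ b n)
    (hb : ∀ n i, i < 16^n → |a n (i+1) - a n i| ≤ b n) (N : ℕ) :
    ∀ i ≤ 16^N, |a N i| ≤ |a 0 0| + 15 * ∑ n ∈ Finset.range (N+1), b n := by
  induction N with
  | zero =>
    intro i hi
    have hb00 := hb0 0
    simp at hi ⊢
    interval_cases i
    · linarith
    · have := hb 0 0 (by simp)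
      have h2 := abs_sub_abs_le_abs_sub (a 0 1) (a 0 0)
      simp at this
      linarith
  | succ N ih =>
    intro i hi
    have key : ∀ m ≤ 15, ∀ j, 16 * j + m ≤ 16^(N+1) → |a (N+1) (16*j+m)| ≤ |a N j| + m * b (N+1) := by
      intro m
      induction m with
      | zero => intro _ j _; simp [ha]
      | succ m ihm =>
        intro hm j hj
        have h1 := ihm (by omega) j (by omega)
        have h2 := hb (N+1) (16*j+m) (by omega)
        have h3 := abs_sub_abs_le_abs_sub (a (N+1) (16*j+m+1)) (a (N+1) (16*j+m))
        rw [← add_assoc]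
        push_cast
        linarith
    have hpow : 16^(N+1) = 16 * 16^N := by ring
    have h1 := key (i % 16) (by omega) (i/16) (by omega)
    rw [Nat.div_add_mod] at h1
    have h2 := ih (i/16) (by omega)
    rw [Finset.sum_range_succ]
    have h3 : ((i % 16 : ℕ) : ℝ) ≤ 15 := by
      have : i % 16 ≤ 15 := by omega
      exact_mod_cast this
    have := hb0 (N+1)
    nlinarith

lemma chain_sq (a : ℕ → ℕ → ℝ) (ha : ∀ n i, a (n+1) (16*i) = a n i) (N : ℕ) (i : ℕ) (hi : i ≤ 16^N) :
    (a N i)^2 ≤ 2 * (a 0 0)^2 + 900 * ∑ n ∈ Finset.range (N+1), 2^n * ∑ i ∈ Finset.range (16^n), (a n (i+1) - a n i)^2 := by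
  set b : ℕ → ℝ := fun n => √(∑ i ∈ Finset.range (16^n), (a n (i+1) - a n i)^2) with hbd
  have h := chain_abs a b ha (fun n => Real.sqrt_nonneg _) (fun n i hi => by
    apply Real.le_sqrt_of_sq_le
    rw [sq_abs]
    exact Finset.single_le_sum (f := fun i => (a n (i+1) - a n i)^2) (fun i _ => sq_nonneg _) (Finset.mem_range.2 hi)) N i hi
  have hb2 : ∀ n, b n ^2 = ∑ i ∈ Finset.range (16^n), (a n (i+1) - a n i)^2 := fun n =>
    Real.sq_sqrt (Finset.sum_nonneg fun i _ => sq_nonneg _)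
  have hcs : (∑ n ∈ Finset.range (N+1), b n)^2 ≤ 2 * ∑ n ∈ Finset.range (N+1), 2^n * b n ^2 := by
    have := Finset.sum_mul_sq_le_sq_mul_sq (Finset.range (N+1)) (fun n => √((1/2:ℝ)^n)) (fun n => √((2:ℝ)^n) * b n)
    have e1 : ∀ n, √((1/2:ℝ)^n) * (√((2:ℝ)^n) * b n) = b n := by
      intro n
      rw [← mul_assoc, ← Real.sqrt_mul (by positivity), ← mul_pow]
      norm_num
    simp_rw [e1, mul_pow] at this
    have e2 : ∀ n : ℕ, √((1/2:ℝ)^n)^2 = (1/2)^n := fun n => Real.sq_sqrt (by positivity)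
    have e3 : ∀ n : ℕ, √((2:ℝ)^n)^2 = 2^n := fun n => Real.sq_sqrt (by positivity)
    simp_rw [e2, e3] at this
    refine this.trans ?_
    gcongr
    exact sum_geometric_two_le _
  have hs0 : 0 ≤ ∑ n ∈ Finset.range (N+1), b n := Finset.sum_nonneg fun n _ => Real.sqrt_nonneg _
  simp_rw [hb2] at hcs
  set s := ∑ n ∈ Finset.range (N+1), b n
  rw [← sq_abs, ← sq_abs (a 0 0)]
  have : |a N i|^2 ≤ (|a 0 0| + 15 * s)^2 := by gcongr
  nlinarith [sq_nonneg (|a 0 0| - 15 * s)]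

lemma geom_Z : ∃ Z : ℝ, 0 ≤ Z ∧ ∀ (m : ℤ) (S : Finset ℤ), ∑ k ∈ S, (1/2:ℝ)^((k-m).natAbs) ≤ Z := by
  have hs : Summable (fun k : ℤ => (1/2:ℝ)^(k.natAbs)) := by
    apply Summable.of_nat_of_neg
    · simpa using summable_geometric_two
    · simpa using summable_geometric_two
  refine ⟨∑' k : ℤ, (1/2:ℝ)^(k.natAbs), tsum_nonneg fun k => by positivity, fun m S => ?_⟩
  have : ∑ k ∈ S, (1/2:ℝ)^((k-m).natAbs) = ∑ k ∈ S.map (Equiv.subRight m).toEmbedding, (1/2:ℝ)^(k.natAbs) := by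
    rw [Finset.sum_map]; rfl
  rw [this]
  exact hs.sum_le_tsum _ fun k _ => by positivity

def Good (d : ℕ) (f : EE d → ℝ) (q qh : EE d → ℝ) : Prop :=
  (∀ x, 0 ≤ q x) ∧ Measurable q ∧ (∀ x, 0 ≤ qh x) ∧ Measurable qh ∧
    ∫⁻ x, ENNReal.ofReal (q x) = ∫⁻ ξ, ENNReal.ofReal (qh ξ) * ‖𝓕 (fun x => (f x : ℂ)) ξ‖ₑ^2

lemma fourier_meas (d : ℕ) (f : EE d → ℝ) (hf : Integrable f) :
    Measurable (fun ξ : EE d => ‖𝓕 (fun x => (f x : ℂ)) ξ‖ₑ^2) := by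
  have : Continuous (𝓕 (fun x => (f x : ℂ))) :=
    VectorFourier.fourierIntegral_continuous Real.continuous_fourierChar (by exact continuous_inner) hf.ofReal
  have := this.measurable
  fun_prop

lemma Good.smul {d : ℕ} {f q qh : EE d → ℝ} (h : Good d f q qh) (c : ℝ) (hc : 0 ≤ c) :
    Good d f (fun x => c * q x) (fun x => c * qh x) := by
  obtain ⟨h1, h2, h3, h4, h5⟩ := h
  refine ⟨fun x => mul_nonneg hc (h1 x), h2.const_mul c, fun x => mul_nonneg hc (h3 x), h4.const_mul c, ?_⟩
  simp_rw [ENNReal.ofReal_mul hc, mul_assoc]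
  rw [lintegral_const_mul' _ _ (by simp), lintegral_const_mul' _ _ (by simp), h5]

lemma Good.add {d : ℕ} {f q qh q' qh' : EE d → ℝ} (hf : Integrable f) (h : Good d f q qh) (h' : Good d f q' qh') :
    Good d f (fun x => q x + q' x) (fun x => qh x + qh' x) := by
  obtain ⟨h1, h2, h3, h4, h5⟩ := h
  obtain ⟨h1', h2', h3', h4', h5'⟩ := h'
  refine ⟨fun x => add_nonneg (h1 x) (h1' x), h2.add h2', fun x => add_nonneg (h3 x) (h3' x), h4.add h4', ?_⟩
  have := fourier_meas d f hf
  simp_rw [ENNReal.ofReal_add (h1 _) (h1' _), ENNReal.ofReal_add (h3 _) (h3' _), add_mul]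
  rw [lintegral_add_left (by fun_prop), lintegral_add_left (by fun_prop), h5, h5']

lemma Good.sum {d : ℕ} {ι : Type} (S : Finset ι) {f : EE d → ℝ} {q qh : ι → EE d → ℝ} (hf : Integrable f)
    (h : ∀ i, Good d f (q i) (qh i)) :
    Good d f (fun x => ∑ i ∈ S, q i x) (fun x => ∑ i ∈ S, qh i x) := by
  classical
  induction S using Finset.induction_on with
  | empty => simp [Good]
  | insert a S ha ih =>
    simp_rw [Finset.sum_insert ha]
    exact Good.add hf (h a) ih

lemma mm_cont (d : ℕ) (hd : 3 ≤ d) (η : ℝ) (hη : 0 < η) (hη1 : η ≤ 1) : Continuous (mm d η) := by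
  have : LipschitzWith (Real.toNNReal (CC d * 64)) (mm d η) := by
    apply LipschitzWith.of_dist_le_mul
    intro r r'
    rw [Real.dist_eq, Real.dist_eq, Real.coe_toNNReal _ (by have := CC_nonneg d; positivity), mul_assoc]
    exact mm_lip d hd η hη hη1 r r'
  exact this.continuous

lemma AR_meas (d : ℕ) (η t : ℝ) (f : EE d → ℝ) (hf : Measurable f) : Measurable (AR d η t f) := by
  unfold AR
  have := kk_meas d η t
  have h : StronglyMeasurable (fun p : EE d × EE d => kk d η t p.2 * f (p.1 - p.2)) := by
    apply Measurable.stronglyMeasurable; fun_prop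
  exact h.integral_prod_right'.measurable

lemma Good.diff (d : ℕ) (hd : 3 ≤ d) (η η' s t : ℝ) (hη : 0 < η) (hη1 : η ≤ 1) (hη' : 0 < η')
    (hη1' : η' ≤ 1) (hs : 0 < s) (ht : 0 < t) (f : EE d → ℝ) (hf : Integrable f) (hfm : Measurable f) :
    Good d f (fun x => (AR d η s f x - AR d η' t f x)^2) (fun ξ => (mm d η (s * ‖ξ‖) - mm d η' (t * ‖ξ‖))^2) := by
  have h1 := AR_meas d η s f hfm
  have h2 := AR_meas d η' t f hfm
  have h3 := mm_cont d hd η hη hη1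
  have h4 := mm_cont d hd η' hη' hη1'
  refine ⟨fun x => sq_nonneg _, by fun_prop, fun x => sq_nonneg _, ?_, diff_plancherel d hd η η' s t hη hη1 hη' hη1' hs ht f hf⟩
  apply Continuous.measurable
  fun_prop

lemma AA_le_ball (d : ℕ) (hd : 3 ≤ d) : ∃ c : ℝ≥0, ∀ (t : ℝ), 0 < t → ∀ (F : EE d → ℝ≥0∞), Measurable F → ∀ x,
    AA d 1 t F x ≤ c * ((volume (closedBall x (2*t)))⁻¹ * ∫⁻ y in closedBall x (2*t), F y) := by
  have hvs := vs_pos d (by omega) 1 one_pos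
  have hvb := vb_pos d
  refine ⟨(2^d * vb d / vs d 1).toNNReal, fun t ht F hF x => ?_⟩
  have hv : volume (closedBall x (2*t)) = ENNReal.ofReal ((2*t)^d * vb d) := by
    rw [Measure.addHaar_closedBall _ _ (by positivity), vol_ball_eq, finrank_euclideanSpace_fin,
      ← ENNReal.ofReal_mul (by positivity)]
  rw [hv, ← ENNReal.ofReal_inv_of_pos (by positivity), ← mul_assoc]
  have e : ((2^d * vb d / vs d 1).toNNReal : ℝ≥0∞) * ENNReal.ofReal (((2*t)^d * vb d)⁻¹) = ENNReal.ofReal ((vs d 1 * t^d)⁻¹) := by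
    change ENNReal.ofReal _ * _ = _
    rw [← ENNReal.ofReal_mul (by positivity)]
    congr 1
    rw [mul_pow]
    field_simp
  rw [e, ← lintegral_const_mul' _ _ (by simp), ← lintegral_indicator measurableSet_closedBall]
  unfold AA
  rw [← lintegral_sub_left_eq_self _ x]
  apply lintegral_mono
  intro y
  simp only [sub_sub_cancel]
  by_cases hy : x - y ∈ shell d 1 t
  · have hmem : y ∈ closedBall x (2*t) := by
      rw [mem_closedBall, dist_comm, dist_eq_norm]
      have := hy.2
      exact abs_le_of_sq_le_sq' (by nlinarith) (by positivity) |>.2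
    rw [indicator_of_mem hmem]
    simp only [kk]
    rw [indicator_of_mem hy]
  · simp only [kk]
    rw [indicator_of_notMem hy]
    simp

/-- grid maximal function -/
def MG (d : ℕ) (η : ℝ) (N : ℕ) (F : EE d → ℝ≥0∞) (x : EE d) : ℝ≥0∞ :=
  ⨆ k ∈ Finset.Icc (-N:ℤ) N, ⨆ i ∈ Finset.range (16^N+1), AA d η (tt k N i) F x

lemma tt_zero (k : ℤ) : tt k 0 0 = 4^k := by simp [tt]

lemma unweighted_real (d : ℕ) (hd : 3 ≤ d) : ∃ C : ℝ≥0, ∀ (η : ℝ), 0 < η → η ≤ 1 → ∀ (N : ℕ) (f : EE d → ℝ),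
    Measurable f → Integrable f → MemLp f 2 → (∀ x, 0 ≤ f x) →
    ∫⁻ x, (MG d η N (fun x => ENNReal.ofReal (f x)) x)^2 ≤ C * ∫⁻ x, ENNReal.ofReal (f x)^2 := by
  obtain ⟨Z, hZ0, hZ⟩ := geom_Z
  obtain ⟨c, hc⟩ := AA_le_ball d hd
  set K : ℝ := 4 * (192 * CC d)^2 with hK
  have hK0 : 0 ≤ K := by positivity
  refine ⟨4 * c^2 * (8 * 4^d) + ((4 + 900 * 2) * K * Z).toNNReal, fun η hη hη1 N f hfm hf hf2 hf0 => ?_⟩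
  set F : EE d → ℝ≥0∞ := fun x => ENNReal.ofReal (f x) with hF
  have hFm : Measurable F := by fun_prop
  set S := Finset.Icc (-N:ℤ) N with hS
  set q : ℤ → EE d → ℝ := fun k x => 4 * (AR d η (4^k) f x - AR d 1 (4^k) f x)^2 +
    900 * ∑ n ∈ Finset.range (N+1), 2^n * ∑ i ∈ Finset.range (16^n), (AR d η (tt k n (i+1)) f x - AR d η (tt k n i) f x)^2 with hq
  set qh : ℤ → EE d → ℝ := fun k ξ => 4 * (mm d η (4^k * ‖ξ‖) - mm d 1 (4^k * ‖ξ‖))^2 +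
    900 * ∑ n ∈ Finset.range (N+1), 2^n * ∑ i ∈ Finset.range (16^n), (mm d η (tt k n (i+1) * ‖ξ‖) - mm d η (tt k n i * ‖ξ‖))^2 with hqh
  have hgood : ∀ k, Good d f (q k) (qh k) := by
    intro k
    refine Good.add hf (Good.smul (Good.diff d hd η 1 (4^k) (4^k) hη hη1 one_pos le_rfl (by positivity) (by positivity) f hf hfm) 4 (by norm_num)) ?_
    refine Good.smul ?_ 900 (by norm_num)
    refine Good.sum (Finset.range (N+1)) hf (fun n => Good.smul (Good.sum (Finset.range (16^n)) hf fun i => ?_) (2^n) (by positivity))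
    exact Good.diff d hd η η _ _ hη hη1 hη hη1 (tt_pos _ _ _) (tt_pos _ _ _) f hf hfm
  have hG := Good.sum S hf hgood
  have hqhb : ∀ ξ, ∑ k ∈ S, qh k ξ ≤ (4 + 900 * 2) * K * Z := by
    intro ξ
    by_cases hξ : ξ = 0
    · have : ∀ k, qh k ξ = 0 := by
        intro k
        simp [hqh, hξ, mm_zero d hd η hη hη1, mm_zero d hd 1 one_pos le_rfl]
      simp [this]
      positivity
    · obtain ⟨m, hm⟩ := mult_chain d hd ‖ξ‖ (norm_pos_iff.2 hξ)
      have hk : ∀ k, qh k ξ ≤ (4 + 900 * 2) * K * (1/2)^((k-m).natAbs) := by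
        intro k
        obtain ⟨h1, h2⟩ := hm k η hη hη1
        have h3 : ∑ n ∈ Finset.range (N+1), 2^n * ∑ i ∈ Finset.range (16^n), (mm d η (tt k n (i+1) * ‖ξ‖) - mm d η (tt k n i * ‖ξ‖))^2
            ≤ ∑ n ∈ Finset.range (N+1), (1/2)^n * (K * (1/2)^((k-m).natAbs)) := by
          apply Finset.sum_le_sum
          intro n _
          have h4 : ∀ i ∈ Finset.range (16^n), (mm d η (tt k n (i+1) * ‖ξ‖) - mm d η (tt k n i * ‖ξ‖))^2 ≤ K * ((1/4)^n)^3 * (1/2)^((k-m).natAbs) := by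
            intro i _
            unfold tt
            apply h1 ((1/4)^n)
            · positivity
            · exact pow_le_one₀ (by norm_num) (by norm_num)
            · rw [le_add_iff_nonneg_right]; positivity
            · rw [le_add_iff_nonneg_right]; positivity
            · have : (1 + 3 * ((i+1 : ℕ):ℝ) / 16^n) - (1 + 3 * (i:ℝ)/16^n) = 3 * (((1/4)^n)^2) := by
                have h16 : (((1/4:ℝ)^n)^2) = 1/16^n := by
                  rw [← pow_mul, mul_comm n 2, pow_mul, show (1/4:ℝ)^2 = 1/16 by norm_num, div_pow, one_pow]
                rw [h16]
                push_cast
                have : (16:ℝ)^n ≠ 0 := by positivity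
                field_simp
                ring
              rw [this, abs_of_nonneg (by positivity)]
          have h5 := Finset.sum_le_sum h4
          rw [Finset.sum_const, Finset.card_range, nsmul_eq_mul] at h5
          calc _ ≤ (2:ℝ)^n * (((16^n : ℕ):ℝ) * (K * ((1/4)^n)^3 * (1/2)^((k-m).natAbs))) := by gcongr
            _ = (2 * 16 * (1/4)^3)^n * (K * (1/2)^((k-m).natAbs)) := by
              push_cast
              have h64 : (((1/4:ℝ)^n)^3) = ((1/4)^3)^n := by
                rw [← pow_mul, mul_comm n 3, pow_mul]
              rw [h64, mul_pow, mul_pow]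
              generalize ((1/4:ℝ)^3)^n = a
              ring
            _ = _ := by norm_num
        rw [← Finset.sum_mul] at h3
        have h6 := sum_geometric_two_le (N+1)
        have h7 : 0 ≤ K * (1/2)^((k-m).natAbs) := by positivity
        simp only [hqh]
        have h8 : (∑ n ∈ Finset.range (N+1), (1/2:ℝ)^n) * (K * (1/2)^((k-m).natAbs)) ≤ 2 * (K * (1/2)^((k-m).natAbs)) := by gcongr
        linarith
      calc ∑ k ∈ S, qh k ξ ≤ ∑ k ∈ S, (4 + 900 * 2) * K * (1/2)^((k-m).natAbs) := Finset.sum_le_sum fun k _ => hk k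
        _ = (4 + 900 * 2) * K * ∑ k ∈ S, (1/2)^((k-m).natAbs) := by rw [Finset.mul_sum]
        _ ≤ _ := by gcongr; exact hZ m S
  set H : EE d → ℝ≥0∞ := fun x => ⨆ k ∈ S, (volume (closedBall x (2*(4:ℝ)^k)))⁻¹ * ∫⁻ y in closedBall x (2*(4:ℝ)^k), F y with hH
  have hHL := hardy_littlewood d S (fun k : ℤ => 2*(4:ℝ)^k) (fun k => by positivity) F hFm
  have hpt : ∀ x, (MG d η N F x)^2 ≤ 4 * c^2 * H x ^2 + ENNReal.ofReal (∑ k ∈ S, q k x) := by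
    intro x
    have hall : ∀ k ∈ S, ∀ i ∈ Finset.range (16^N+1), (AA d η (tt k N i) F x)^2 ≤ 4 * c^2 * H x ^2 + ENNReal.ofReal (∑ k ∈ S, q k x) := by
      intro k hk i hi
      rw [Finset.mem_range] at hi
      have hch := chain_sq (fun n i => AR d η (tt k n i) f x) (fun n i => by simp only [tt_succ]) N i (by omega)
      simp only [tt_zero] at hch
      have h1 : (AR d η (tt k N i) f x)^2 ≤ 4 * (AR d 1 (4^k) f x)^2 + q k x := by
        simp only [hq]
        nlinarith [sq_nonneg (AR d η (4^k) f x - 2 * AR d 1 (4^k) f x)]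
      have h2 : q k x ≤ ∑ k ∈ S, q k x := Finset.single_le_sum (f := fun k => q k x) (fun k _ => (hgood k).1 x) hk
      have hAR0 : ∀ η' t, 0 < η' → 0 < t → 0 ≤ AR d η' t f x := fun η' t h h' =>
        integral_nonneg fun y => mul_nonneg (kk_nonneg d hd η' t h h' y) (hf0 _)
      rw [AA_eq_AR d hd η _ hη (tt_pos _ _ _) f hf hf0, ← ENNReal.ofReal_pow (hAR0 _ _ hη (tt_pos _ _ _))]
      have h3 : ENNReal.ofReal ((AR d 1 (4^k) f x)^2) ≤ c^2 * H x ^2 := by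
        rw [ENNReal.ofReal_pow (hAR0 _ _ one_pos (by positivity)), ← AA_eq_AR d hd 1 _ one_pos (by positivity) f hf hf0, ← mul_pow]
        gcongr
        refine (hc (4^k) (by positivity) F hFm x).trans ?_
        gcongr
        exact le_iSup₂_of_le (f := fun k (_ : k ∈ S) => (volume (closedBall x (2*(4:ℝ)^k)))⁻¹ * ∫⁻ y in closedBall x (2*(4:ℝ)^k), F y) k hk le_rfl
      calc ENNReal.ofReal ((AR d η (tt k N i) f x)^2) ≤ ENNReal.ofReal (4 * (AR d 1 (4^k) f x)^2 + ∑ k ∈ S, q k x) :=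
            ENNReal.ofReal_le_ofReal (by linarith)
        _ = 4 * ENNReal.ofReal ((AR d 1 (4^k) f x)^2) + ENNReal.ofReal (∑ k ∈ S, q k x) := by
            rw [ENNReal.ofReal_add (by positivity) (hG.1 x), ENNReal.ofReal_mul (by norm_num)]
            norm_num
        _ ≤ 4 * (c^2 * H x ^2) + ENNReal.ofReal (∑ k ∈ S, q k x) := by gcongr
        _ = _ := by ring
    have hroot : ∀ a b : ℝ≥0∞, a^2 ≤ b ↔ a ≤ b^(1/2:ℝ) := by
      intro a b
      rw [one_div, ENNReal.le_rpow_inv_iff (by norm_num)]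
      norm_num
    rw [hroot]
    unfold MG
    refine iSup₂_le fun k hk => iSup₂_le fun i hi => ?_
    rw [← hroot]
    exact hall k hk i hi
  have hpl : ∫⁻ ξ, ‖𝓕 (fun x => (f x : ℂ)) ξ‖ₑ^2 = ∫⁻ x, F x ^2 := by
    refine (plancherel d (fun x => (f x : ℂ)) hf.ofReal hf2.ofReal).trans ?_
    congr 1
    ext x
    rw [← ofReal_norm, Complex.norm_real, Real.norm_eq_abs, abs_of_nonneg (hf0 x)]
  calc ∫⁻ x, (MG d η N F x)^2 ≤ ∫⁻ x, (4 * c^2 * H x ^2 + ENNReal.ofReal (∑ k ∈ S, q k x)) := lintegral_mono hpt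
    _ = 4 * c^2 * (∫⁻ x, H x ^2) + ∫⁻ x, ENNReal.ofReal (∑ k ∈ S, q k x) := by
        rw [lintegral_add_right _ (by have := hG.2.1; fun_prop), lintegral_const_mul' _ _ (by
          exact ENNReal.mul_ne_top (by norm_num) (by simp))]
    _ ≤ 4 * c^2 * (8 * 4^d * ∫⁻ x, F x ^2) + ∫⁻ ξ, ENNReal.ofReal ((4 + 900 * 2) * K * Z) * ‖𝓕 (fun x => (f x : ℂ)) ξ‖ₑ^2 := by
        rw [hG.2.2.2.2]
        gcongr with ξ
        exact hqhb ξ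
    _ = _ := by
        rw [lintegral_const_mul' _ _ (by simp), hpl]
        have e1 : ((4 * c^2 * (8 * 4^d) : ℝ≥0) : ℝ≥0∞) = 4 * (c:ℝ≥0∞)^2 * (8 * 4^d) := by push_cast; rfl
        rw [ENNReal.coe_add, e1]
        generalize hKZ : (4 + 900 * 2) * K * Z = L
        rw [add_mul, mul_assoc (4 * (c:ℝ≥0∞)^2)]
        rfl

lemma sq_le_iff_root (a b : ℝ≥0∞) : a^2 ≤ b ↔ a ≤ b^(1/2:ℝ) := by
  rw [one_div, ENNReal.le_rpow_inv_iff (by norm_num)]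
  norm_num

lemma MG_sq_le (d : ℕ) (η : ℝ) (N : ℕ) (F : EE d → ℝ≥0∞) (x : EE d) (b : ℝ≥0∞)
    (h : ∀ k ∈ Finset.Icc (-N:ℤ) N, ∀ i ∈ Finset.range (16^N+1), (AA d η (tt k N i) F x)^2 ≤ b) :
    (MG d η N F x)^2 ≤ b := by
  rw [sq_le_iff_root]
  refine iSup₂_le fun k hk => iSup₂_le fun i hi => ?_
  rw [← sq_le_iff_root]
  exact h k hk i hi

lemma le_MG (d : ℕ) (η : ℝ) (N : ℕ) (F : EE d → ℝ≥0∞) (x : EE d) (k : ℤ) (hk : k ∈ Finset.Icc (-N:ℤ) N)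
    (i : ℕ) (hi : i ∈ Finset.range (16^N+1)) : AA d η (tt k N i) F x ≤ MG d η N F x := by
  unfold MG
  refine le_iSup₂_of_le k hk ?_
  exact le_iSup₂_of_le (f := fun i _ => AA d η (tt k N i) F x) i hi le_rfl

lemma MG_mono (d : ℕ) (η : ℝ) (N : ℕ) (F G : EE d → ℝ≥0∞) (h : ∀ x, F x ≤ G x) (x : EE d) :
    MG d η N F x ≤ MG d η N G x :=
  iSup₂_mono fun _ _ => iSup₂_mono fun _ _ => AA_mono d η _ F G h x

lemma MG_meas (d : ℕ) (η : ℝ) (N : ℕ) (F : EE d → ℝ≥0∞) (hF : Measurable F) : Measurable (MG d η N F) := by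
  unfold MG
  refine Measurable.iSup fun k => Measurable.iSup fun _ => Measurable.iSup fun i => Measurable.iSup fun _ => ?_
  exact AA_meas d η _ F hF

lemma AA_iSup (d : ℕ) (η t : ℝ) (F : ℕ → EE d → ℝ≥0∞) (hF : ∀ n, Measurable (F n)) (hm : Monotone F) (x : EE d) :
    AA d η t (fun y => ⨆ n, F n y) x = ⨆ n, AA d η t (F n) x := by
  unfold AA
  simp_rw [ENNReal.mul_iSup]
  have := kk_meas d η t
  rw [lintegral_iSup]
  · intro n
    have := hF n
    fun_prop
  · intro n m h y
    dsimp only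
    gcongr
    exact hm h _

def trn (d : ℕ) (F : EE d → ℝ≥0∞) (n : ℕ) : EE d → ℝ≥0∞ :=
  (closedBall (0 : EE d) n).indicator (fun x => min (F x) n)

lemma trn_meas (d : ℕ) (F : EE d → ℝ≥0∞) (hF : Measurable F) (n : ℕ) : Measurable (trn d F n) :=
  Measurable.indicator (hF.min measurable_const) measurableSet_closedBall

lemma trn_mono (d : ℕ) (F : EE d → ℝ≥0∞) : Monotone (trn d F) := by
  intro n m h x
  have h' : (n:ℝ) ≤ m := by exact_mod_cast h
  have h'' : (n:ℝ≥0∞) ≤ m := by exact_mod_cast h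
  unfold trn
  by_cases hx : x ∈ closedBall (0 : EE d) n
  · rw [indicator_of_mem hx, indicator_of_mem (closedBall_subset_closedBall h' hx)]
    gcongr
  · rw [indicator_of_notMem hx]; exact zero_le

lemma trn_le (d : ℕ) (F : EE d → ℝ≥0∞) (n : ℕ) (x : EE d) : trn d F n x ≤ F x := by
  unfold trn
  by_cases hx : x ∈ closedBall (0 : EE d) n
  · rw [indicator_of_mem hx]; exact min_le_left _ _
  · rw [indicator_of_notMem hx]; exact zero_le

lemma trn_le_nat (d : ℕ) (F : EE d → ℝ≥0∞) (n : ℕ) (x : EE d) : trn d F n x ≤ n := by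
  unfold trn
  by_cases hx : x ∈ closedBall (0 : EE d) n
  · rw [indicator_of_mem hx]; exact min_le_right _ _
  · rw [indicator_of_notMem hx]; exact zero_le

lemma trn_iSup (d : ℕ) (F : EE d → ℝ≥0∞) (x : EE d) : ⨆ n, trn d F n x = F x := by
  apply le_antisymm (iSup_le fun n => trn_le d F n x)
  obtain ⟨m, hm⟩ := exists_nat_ge ‖x‖
  have hmem : ∀ n, m ≤ n → trn d F n x = min (F x) n := by
    intro n hn
    unfold trn
    rw [indicator_of_mem]
    rw [mem_closedBall, dist_zero_right]
    exact hm.trans (by exact_mod_cast hn)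
  apply le_of_forall_lt
  intro c hc
  obtain ⟨k, hk⟩ := ENNReal.exists_nat_gt (lt_of_lt_of_le hc le_top).ne
  refine lt_of_lt_of_le ?_ (le_iSup (fun n => trn d F n x) (max m k))
  rw [hmem _ (le_max_left _ _)]
  exact lt_min hc (hk.trans_le (by exact_mod_cast le_max_right m k))

lemma trn_ne_top (d : ℕ) (F : EE d → ℝ≥0∞) (n : ℕ) (x : EE d) : trn d F n x ≠ ∞ :=
  ((trn_le_nat d F n x).trans_lt (ENNReal.natCast_lt_top n)).ne

lemma trn_lintegral_ne_top (d : ℕ) (F : EE d → ℝ≥0∞) (n : ℕ) (μ : Measure (EE d)) (hμ : μ (closedBall 0 n) ≠ ∞) (q : ℕ) (hq : q ≠ 0) :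
    ∫⁻ x, (trn d F n x)^q ∂μ ≠ ∞ := by
  have : ∀ x, (trn d F n x)^q ≤ (closedBall (0 : EE d) n).indicator (fun _ => (n:ℝ≥0∞)^q) x := by
    intro x
    by_cases hx : x ∈ closedBall (0 : EE d) n
    · rw [indicator_of_mem hx]; gcongr; exact trn_le_nat d F n x
    · rw [indicator_of_notMem hx]; unfold trn; rw [indicator_of_notMem hx]; simp [hq]
  refine ((lintegral_mono this).trans_lt ?_).ne
  rw [lintegral_indicator measurableSet_closedBall, setLIntegral_const]
  exact ENNReal.mul_lt_top (by simp) hμ.lt_top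

lemma unweighted (d : ℕ) (hd : 3 ≤ d) : ∃ C : ℝ≥0, ∀ (η : ℝ), 0 < η → η ≤ 1 → ∀ (N : ℕ) (F : EE d → ℝ≥0∞),
    Measurable F → ∫⁻ x, (MG d η N F x)^2 ≤ C * ∫⁻ x, (F x)^2 := by
  obtain ⟨C, hC⟩ := unweighted_real d hd
  refine ⟨C, fun η hη hη1 N F hF => ?_⟩
  have hfin : ∀ n, ∫⁻ x, (MG d η N (trn d F n) x)^2 ≤ C * ∫⁻ x, (F x)^2 := by
    intro n
    have hmeas := trn_meas d F hF n
    have hb : volume (closedBall (0:EE d) n) ≠ ∞ := measure_closedBall_lt_top.ne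
    have e : (fun x => ENNReal.ofReal ((trn d F n x).toReal)) = trn d F n := by
      ext x; rw [ENNReal.ofReal_toReal (trn_ne_top d F n x)]
    have hmr : Measurable (fun x => (trn d F n x).toReal) := hmeas.ennreal_toReal
    have hint : Integrable (fun x => (trn d F n x).toReal) := by
      apply integrable_toReal_of_lintegral_ne_top hmeas.aemeasurable
      simpa using trn_lintegral_ne_top d F n volume hb 1 one_ne_zero
    have hL2 : MemLp (fun x => (trn d F n x).toReal) 2 := by
      rw [memLp_two_iff_integrable_sq hmr.aestronglyMeasurable]
      have := integrable_toReal_of_lintegral_ne_top (hmeas.pow_const 2).aemeasurable (trn_lintegral_ne_top d F n volume hb 2 two_ne_zero)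
      simpa [ENNReal.toReal_pow] using this
    have := hC η hη hη1 N (fun x => (trn d F n x).toReal) hmr hint hL2 (fun x => ENNReal.toReal_nonneg)
    rw [e] at this
    refine this.trans ?_
    gcongr with x
    rw [congrFun e x]
    exact trn_le d F n x
  have hpt : ∀ x, (MG d η N F x)^2 ≤ ⨆ n, (MG d η N (trn d F n) x)^2 := by
    intro x
    apply MG_sq_le
    intro k hk i hi
    have : F = fun y => ⨆ n, trn d F n y := by ext y; rw [trn_iSup]
    rw [sq_le_iff_root]
    conv_lhs => rw [this]
    rw [AA_iSup d η _ _ (trn_meas d F hF) (trn_mono d F)]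
    refine iSup_le fun n => ?_
    rw [← sq_le_iff_root]
    refine le_trans ?_ (le_iSup _ n)
    gcongr
    exact le_MG d η N _ x k hk i hi
  refine (lintegral_mono hpt).trans ?_
  rw [lintegral_iSup]
  · exact iSup_le hfin
  · intro n
    exact (MG_meas d η N _ (trn_meas d F hF n)).pow_const 2
  · intro n m h x
    dsimp only
    gcongr
    exact MG_mono d η N _ _ (trn_mono d F h) x

lemma wt_meas (d : ℕ) : Measurable (wt d) := by
  unfold wt
  fun_prop

def ann (d : ℕ) (j : ℤ) : Set (EE d) := {x | (2:ℝ)^j ≤ ‖x‖ ∧ ‖x‖ < (2:ℝ)^(j+1)}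

lemma ann_meas (d : ℕ) (j : ℤ) : MeasurableSet (ann d j) := by
  unfold ann
  exact (measurableSet_le measurable_const measurable_norm).inter (measurableSet_lt measurable_norm measurable_const)

lemma ann_disj (d : ℕ) : Pairwise (Function.onFun Disjoint (ann d)) := by
  intro j k hjk
  rw [Function.onFun, Set.disjoint_left]
  rintro x ⟨h1, h2⟩ ⟨h3, h4⟩
  have a := (zpow_lt_zpow_iff_right₀ (by norm_num : (1:ℝ) < 2)).1 (h1.trans_lt h4)
  have b := (zpow_lt_zpow_iff_right₀ (by norm_num : (1:ℝ) < 2)).1 (h3.trans_lt h2)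
  omega

lemma ann_cover (d : ℕ) (x : EE d) (hx : x ≠ 0) : ∃ j, x ∈ ann d j :=
  exists_mem_Ico_zpow (norm_pos_iff.2 hx) (by norm_num)

lemma lintegral_ann (d : ℕ) (hd : 3 ≤ d) (G : EE d → ℝ≥0∞) : ∫⁻ x, G x = ∑' j, ∫⁻ x in ann d j, G x := by
  rw [← lintegral_iUnion (ann_meas d) (ann_disj d)]
  have : Nonempty (Fin d) := ⟨⟨0, by omega⟩⟩
  have h : (⋃ j, ann d j) =ᵐ[volume] (univ : Set (EE d)) := by
    rw [Filter.eventuallyEq_univ]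
    have : ∀ᵐ x : EE d, x ≠ 0 := by
      rw [ae_iff]; simp
    filter_upwards [this] with x hx
    exact mem_iUnion.2 (ann_cover d x hx)
  rw [setLIntegral_congr h, setLIntegral_univ]

/-- enlarged annulus -/
def ban (d : ℕ) (j : ℤ) : Set (EE d) := ann d (j-1) ∪ (ann d j ∪ ann d (j+1))

lemma ban_meas (d : ℕ) (j : ℤ) : MeasurableSet (ban d j) :=
  (ann_meas d _).union ((ann_meas d _).union (ann_meas d _))

lemma mem_ban (d : ℕ) (j : ℤ) (y : EE d) (h1 : (2:ℝ)^(j-1) ≤ ‖y‖) (h2 : ‖y‖ < (2:ℝ)^(j+2)) : y ∈ ban d j := by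
  rcases lt_or_ge ‖y‖ ((2:ℝ)^j) with h | h
  · left; exact ⟨h1, by simpa using h⟩
  · right
    rcases lt_or_ge ‖y‖ ((2:ℝ)^(j+1)) with h' | h'
    · left; exact ⟨h, h'⟩
    · right; exact ⟨h', by rwa [add_assoc]⟩

lemma ban_bound (d : ℕ) (j : ℤ) (y : EE d) (hy : y ∈ ban d j) : 0 < ‖y‖ ∧ ‖y‖ ≤ 4 * (2:ℝ)^j := by
  have e1 : (2:ℝ)^(j+1) = 2 * 2^j := by rw [zpow_add₀ (by norm_num)]; ring
  have e2 : (2:ℝ)^(j+1+1) = 4 * 2^j := by rw [zpow_add₀ (by norm_num), e1]; ring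
  have e0 : (0:ℝ) < 2^j := by positivity
  rcases hy with h | h | h
  · have := h.2; rw [sub_add_cancel] at this
    exact ⟨lt_of_lt_of_le (by positivity) h.1, by linarith⟩
  · have := h.2; rw [e1] at this
    exact ⟨lt_of_lt_of_le (by positivity) h.1, by linarith⟩
  · have := h.2; rw [e2] at this
    exact ⟨lt_of_lt_of_le (by positivity) h.1, by linarith⟩

/-- small radius part -/
def MS (d : ℕ) (η : ℝ) (N : ℕ) (F : EE d → ℝ≥0∞) (x : EE d) : ℝ≥0∞ :=
  ⨆ k ∈ Finset.Icc (-N:ℤ) N, ⨆ i ∈ Finset.range (16^N+1), if 4 * tt k N i ≤ ‖x‖ then AA d η (tt k N i) F x else 0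

lemma MS_le (d : ℕ) (hd : 3 ≤ d) (η : ℝ) (hη : 0 < η) (hη1 : η ≤ 1) (N : ℕ) (F : EE d → ℝ≥0∞) (j : ℤ) (x : EE d) (hx : x ∈ ann d j) :
    MS d η N F x ≤ MG d η N ((ban d j).indicator F) x := by
  refine iSup₂_mono fun k hk => iSup₂_mono fun i hi => ?_
  split_ifs with h
  · set t := tt k N i with ht
    have ht0 : 0 < t := tt_pos _ _ _
    unfold AA
    apply lintegral_mono
    intro y
    dsimp only
    by_cases hy : y ∈ shell d η t
    · have hyn : ‖y‖ ≤ 2 * t := by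
        have := hy.2
        exact abs_le_of_sq_le_sq' (by nlinarith) (by positivity) |>.2
      have hxy : x - y ∈ ban d j := by
        have h1 := norm_sub_norm_le x y
        have h2 := norm_sub_le x y
        have h3 := hx.1
        have h4 := hx.2
        have e1 : (2:ℝ)^(j+1) = 2 * 2^j := by rw [zpow_add₀ (by norm_num)]; ring
        have e2 : (2:ℝ)^(j+2) = 4 * 2^j := by rw [zpow_add₀ (by norm_num)]; norm_num; ring
        have e3 : (2:ℝ)^(j-1) = 2^j / 2 := by rw [zpow_sub₀ (by norm_num)]; norm_num
        apply mem_ban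
        · rw [e3]; linarith
        · rw [e2]; rw [e1] at h4; linarith
      rw [indicator_of_mem hxy]
    · simp only [kk]
      rw [indicator_of_notMem hy]
      simp
  · exact zero_le

lemma small_part (d : ℕ) (hd : 3 ≤ d) : ∃ C : ℝ≥0, ∀ (η : ℝ), 0 < η → η ≤ 1 → ∀ (N : ℕ) (F : EE d → ℝ≥0∞),
    Measurable F → ∫⁻ x, (MS d η N F x)^2 * wt d x ≤ C * ∫⁻ x, (F x)^2 * wt d x := by
  obtain ⟨C, hC⟩ := unweighted d hd
  set b : ℝ := 4^((d:ℝ)-1) with hb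
  refine ⟨C * b.toNNReal * 3, fun η hη hη1 N F hF => ?_⟩
  have hd' : (1:ℝ) - d ≤ 0 := by
    have : (3:ℝ) ≤ d := by exact_mod_cast hd
    linarith
  have hw := wt_meas d
  have hj : ∀ j, ∫⁻ x in ann d j, (MS d η N F x)^2 * wt d x ≤ C * b.toNNReal * ∫⁻ x in ban d j, (F x)^2 * wt d x := by
    intro j
    set a : ℝ≥0∞ := ENNReal.ofReal (((2:ℝ)^j)^((1:ℝ)-d)) with ha
    have h0 : (0:ℝ) < 2^j := by positivity
    calc ∫⁻ x in ann d j, (MS d η N F x)^2 * wt d x ≤ ∫⁻ x in ann d j, a * (MG d η N ((ban d j).indicator F) x)^2 := by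
          apply setLIntegral_mono' (ann_meas d j)
          intro x hx
          rw [mul_comm]
          gcongr
          · unfold wt
            apply ENNReal.ofReal_le_ofReal
            exact Real.rpow_le_rpow_of_nonpos h0 hx.1 hd'
          · exact MS_le d hd η hη hη1 N F j x hx
      _ ≤ ∫⁻ x, a * (MG d η N ((ban d j).indicator F) x)^2 := setLIntegral_le_lintegral _ _
      _ = a * ∫⁻ x, (MG d η N ((ban d j).indicator F) x)^2 := lintegral_const_mul' _ _ (by simp [ha])
      _ ≤ a * (C * ∫⁻ x, ((ban d j).indicator F x)^2) := by
          gcongr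
          exact hC η hη hη1 N _ (hF.indicator (ban_meas d j))
      _ = C * (∫⁻ x in ban d j, a * (F x)^2) := by
          have : ∀ x, ((ban d j).indicator F x)^2 = (ban d j).indicator (fun x => (F x)^2) x := by
            intro x
            by_cases hx : x ∈ ban d j
            · rw [indicator_of_mem hx, indicator_of_mem hx]
            · rw [indicator_of_notMem hx, indicator_of_notMem hx]; simp
          simp_rw [this]
          rw [lintegral_indicator (ban_meas d j), lintegral_const_mul' _ _ (by simp [ha])]
          ring
      _ ≤ C * (∫⁻ x in ban d j, b.toNNReal * ((F x)^2 * wt d x)) := by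
          gcongr C * ?_
          apply setLIntegral_mono' (ban_meas d j)
          intro x hx
          obtain ⟨hx0, hx1⟩ := ban_bound d j x hx
          have : a ≤ b.toNNReal * wt d x := by
            change _ ≤ ENNReal.ofReal b * _
            unfold wt
            rw [← ENNReal.ofReal_mul (by positivity)]
            apply ENNReal.ofReal_le_ofReal
            calc ((2:ℝ)^j)^((1:ℝ)-d) = b * (4 * (2:ℝ)^j)^((1:ℝ)-d) := by
                  rw [Real.mul_rpow (by norm_num) h0.le, hb, ← mul_assoc, ← Real.rpow_add (by norm_num)]
                  simp
              _ ≤ b * ‖x‖^((1:ℝ)-d) := by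
                  gcongr b * ?_
                  exact Real.rpow_le_rpow_of_nonpos hx0 hx1 hd'
          calc a * (F x)^2 ≤ (b.toNNReal * wt d x) * (F x)^2 := by gcongr
            _ = _ := by ring
      _ = _ := by
          rw [lintegral_const_mul' _ _ (by simp)]
          ring
  rw [lintegral_ann d hd, lintegral_ann d hd (fun x => (F x)^2 * wt d x)]
  set I : ℤ → ℝ≥0∞ := fun j => ∫⁻ x in ann d j, (F x)^2 * wt d x with hI
  have hban : ∀ j, ∫⁻ x in ban d j, (F x)^2 * wt d x ≤ I (j-1) + (I j + I (j+1)) := by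
    intro j
    refine (lintegral_union_le _ _ _).trans ?_
    gcongr
    exact lintegral_union_le _ _ _
  calc ∑' j, ∫⁻ x in ann d j, (MS d η N F x)^2 * wt d x ≤ ∑' j, C * b.toNNReal * (I (j-1) + (I j + I (j+1))) := by
        refine ENNReal.tsum_le_tsum fun j => (hj j).trans ?_
        gcongr
        exact hban j
    _ = C * b.toNNReal * (∑' j, I j + (∑' j, I j + ∑' j, I j)) := by
        rw [ENNReal.tsum_mul_left, ENNReal.tsum_add, ENNReal.tsum_add]
        have e1 := (Equiv.subRight (1:ℤ)).tsum_eq I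
        have e2 := (Equiv.addRight (1:ℤ)).tsum_eq I
        simp only [Equiv.subRight_apply, Equiv.coe_addRight] at e1 e2
        rw [e1, e2]
    _ = _ := by push_cast; ring

lemma shell_inter (n : ℕ) (hn : 2 ≤ n) (η t t' : ℝ) (hη : 0 < η) (hη1 : η ≤ 1) (ht : 0 < t) (htt' : t ≤ t')
    (a : EE (n+1)) (ha : a ≠ 0) :
    volume {u : EE (n+1) | u ∈ shell (n+1) η t ∧ a + u ∈ shell (n+1) η t'} ≤
      ENNReal.ofReal (η * t'^2 / ‖a‖) * ENNReal.ofReal (vb n * (n * (2*t)^(n-2) * (η * t^2))) := by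
  set R := ‖a‖ with hR
  have hR0 : 0 < R := norm_pos_iff.2 ha
  set e : EE (n+1) := R⁻¹ • a with he
  have hen : ‖e‖ = 1 := by
    rw [he, norm_smul, norm_inv, Real.norm_eq_abs, abs_of_pos hR0, ← hR]; field_simp
  have hae : a = R • e := by rw [he, smul_smul, mul_inv_cancel₀ hR0.ne', one_smul]
  set P : Set (ℝ × ℝ) := {p | (t^2 ≤ p.2 ∧ p.2 ≤ (1+η)*t^2) ∧ (t'^2 ≤ R^2 + 2*R*p.1 + p.2 ∧ R^2 + 2*R*p.1 + p.2 ≤ (1+η)*t'^2)} with hP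
  have hPm : MeasurableSet P := by
    apply IsClosed.measurableSet
    have hcl := ((isClosed_le (f := fun _ : ℝ × ℝ => t^2) (g := fun p => p.2) (by fun_prop) (by fun_prop)).inter
      (isClosed_le (f := fun p : ℝ × ℝ => p.2) (g := fun p => (1+η)*t^2) (by fun_prop) (by fun_prop))).inter
      ((isClosed_le (f := fun _ : ℝ × ℝ => t'^2) (g := fun p => R^2 + 2*R*p.1 + p.2) (by fun_prop) (by fun_prop)).inter
      (isClosed_le (f := fun p : ℝ × ℝ => R^2 + 2*R*p.1 + p.2) (g := fun p => (1+η)*t'^2) (by fun_prop) (by fun_prop)))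
    exact hcl
  set F : ℝ → ℝ → ℝ≥0∞ := fun z q => P.indicator 1 (z, q) with hF
  have hFm : Measurable (Function.uncurry F) := by
    have : Function.uncurry F = P.indicator 1 := by ext ⟨z, q⟩; rfl
    rw [this]
    exact measurable_one.indicator hPm
  have hset : MeasurableSet {u : EE (n+1) | u ∈ shell (n+1) η t ∧ a + u ∈ shell (n+1) η t'} :=
    (shell_meas _ η t).inter ((measurable_const_add a) (shell_meas _ η t'))
  have hnorm : ∀ u : EE (n+1), ‖a + u‖^2 = R^2 + 2*R*(inner ℝ e u) + ‖u‖^2 := by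
    intro u
    rw [norm_add_sq_real, ← hR]
    conv_lhs => rw [hae]
    rw [inner_smul_left]
    simp
    ring
  have h1 : volume {u : EE (n+1) | u ∈ shell (n+1) η t ∧ a + u ∈ shell (n+1) η t'} = ∫⁻ u : EE (n+1), F (inner ℝ e u) (‖u‖^2) := by
    rw [← lintegral_indicator_one hset]
    congr 1
    ext u
    have hiff : u ∈ {u : EE (n+1) | u ∈ shell (n+1) η t ∧ a + u ∈ shell (n+1) η t'} ↔ (inner ℝ e u, ‖u‖^2) ∈ P := by
      simp only [hP, shell, mem_ofPred_eq, hnorm]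
    by_cases hu : u ∈ {u : EE (n+1) | u ∈ shell (n+1) η t ∧ a + u ∈ shell (n+1) η t'}
    · rw [indicator_of_mem hu, hF]
      simp only
      rw [indicator_of_mem (hiff.1 hu)]; rfl
    · rw [indicator_of_notMem hu, hF]
      simp only
      rw [indicator_of_notMem (fun h => hu (hiff.2 h))]
  rw [h1, coord n e hen F hFm]
  set lo := (t'^2 - R^2 - (1+η)*t^2) / (2*R) with hlo
  set hi := ((1+η)*t'^2 - R^2 - t^2) / (2*R) with hhi
  have h2 : ∀ z, ∫⁻ v : EE n, F z (z^2 + ‖v‖^2) ≤ (Icc lo hi).indicator (fun _ => ENNReal.ofReal (vb n * (n * (2*t)^(n-2) * (η * t^2)))) z := by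
    intro z
    by_cases hz : z ∈ Icc lo hi
    · rw [indicator_of_mem hz]
      have hle : ∀ v : EE n, F z (z^2 + ‖v‖^2) ≤ {v : EE n | t^2 - z^2 ≤ ‖v‖^2 ∧ ‖v‖^2 ≤ (1+η)*t^2 - z^2}.indicator 1 v := by
        intro v
        by_cases hv : (z, z^2 + ‖v‖^2) ∈ P
        · have hv' : v ∈ {v : EE n | t^2 - z^2 ≤ ‖v‖^2 ∧ ‖v‖^2 ≤ (1+η)*t^2 - z^2} := by
            obtain ⟨⟨a1, a2⟩, _⟩ := hv
            simp only at a1 a2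
            exact ⟨by linarith, by linarith⟩
          rw [indicator_of_mem hv', hF]
          simp only
          rw [indicator_of_mem hv]; exact le_rfl
        · rw [hF]
          simp only
          rw [indicator_of_notMem hv]; exact zero_le
      have hm : MeasurableSet {v : EE n | t^2 - z^2 ≤ ‖v‖^2 ∧ ‖v‖^2 ≤ (1+η)*t^2 - z^2} := by
        apply IsClosed.measurableSet
        exact (isClosed_le (f := fun _ : EE n => t^2 - z^2) (g := fun v => ‖v‖^2) (by fun_prop) (by fun_prop)).inter
          (isClosed_le (f := fun v : EE n => ‖v‖^2) (g := fun _ => (1+η)*t^2 - z^2) (by fun_prop) (by fun_prop))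
      have hηt : 0 ≤ η * t^2 := by positivity
      refine (lintegral_mono hle).trans ?_
      rw [lintegral_indicator_one hm, vol_annulus n (by omega) _ _ (by linarith)]
      apply ENNReal.ofReal_le_ofReal
      have := vb_pos n
      gcongr
      refine (sqrt_pow_sub_le n hn _ _ (by linarith)).trans ?_
      have e1 : (1+η)*t^2 - z^2 - (t^2 - z^2) = η * t^2 := by ring
      rw [e1]
      gcongr
      apply Real.sqrt_le_iff.2
      refine ⟨by positivity, ?_⟩
      nlinarith [sq_nonneg z, sq_nonneg t]
    · rw [indicator_of_notMem hz]
      rw [nonpos_iff_eq_zero, lintegral_eq_zero_iff']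
      · apply Filter.Eventually.of_forall
        intro v
        simp only [hF]
        rw [indicator_of_notMem]; · rfl
        intro hv
        apply hz
        obtain ⟨⟨a1, a2⟩, a3, a4⟩ := hv
        simp only at a1 a2 a3 a4
        constructor
        · rw [hlo, div_le_iff₀ (by positivity)]; nlinarith
        · rw [hhi, le_div_iff₀ (by positivity)]; nlinarith
      · apply Measurable.aemeasurable
        have : Measurable (fun v : EE n => ((z, z^2 + ‖v‖^2) : ℝ × ℝ)) := by fun_prop
        exact hFm.comp this
  refine (lintegral_mono h2).trans ?_
  rw [lintegral_indicator measurableSet_Icc, setLIntegral_const, Real.volume_Icc, mul_comm]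
  gcongr
  rw [hlo, hhi, ← sub_div, div_le_div_iff₀ (by positivity) hR0]
  have : t^2 ≤ t'^2 := by gcongr
  have : η * t^2 ≤ η * t'^2 := by gcongr
  nlinarith

def wti (d : ℕ) (y : EE d) : ℝ≥0∞ := ENNReal.ofReal (‖y‖^(d-1))

/-- constant in the kernel bound -/
def KJ (n : ℕ) : ℝ := (vb (n+1))⁻¹^2 * 6^n * (vb n * (n * 2^(n-2)))

lemma KJ_pos (n : ℕ) (hn : 1 ≤ n) : 0 < KJ n := by
  unfold KJ
  have := vb_pos n
  have := vb_pos (n+1)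
  have : (0:ℝ) < n := by exact_mod_cast hn
  positivity

lemma J_bound_aux (n : ℕ) (hn : 2 ≤ n) (η t t' : ℝ) (hη : 0 < η) (hη1 : η ≤ 1) (ht : 0 < t) (htt' : t ≤ t')
    (x x' : EE (n+1)) (hne : x ≠ x') (hx : ‖x‖ ≤ 4 * t) :
    ∫⁻ y, ENNReal.ofReal (kk (n+1) η t (x - y)) * ENNReal.ofReal (kk (n+1) η t' (x' - y)) * wti (n+1) y ≤
      ENNReal.ofReal (KJ n / ‖x - x'‖) := by
  have ht' : 0 < t' := ht.trans_le htt'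
  have ha : x' - x ≠ 0 := sub_ne_zero.2 hne.symm
  have hR0 : 0 < ‖x - x'‖ := norm_pos_iff.2 (sub_ne_zero.2 hne)
  set A : Set (EE (n+1)) := {u : EE (n+1) | u ∈ shell (n+1) η t ∧ (x' - x) + u ∈ shell (n+1) η t'} with hA
  have hAm : MeasurableSet A :=
    (shell_meas _ η t).inter ((measurable_const_add (x'-x)) (shell_meas _ η t'))
  have hv := vs_pos (n+1) (by omega) η hη
  have hvg := vs_ge (n+1) (by omega) η hη.le
  have hb := vb_pos (n+1)
  have hb' := vb_pos n
  set c : ℝ := (vs (n+1) η * t^(n+1))⁻¹ * (vs (n+1) η * t'^(n+1))⁻¹ * (6*t)^n with hc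
  have hc0 : 0 ≤ c := by positivity
  rw [← lintegral_sub_left_eq_self _ x]
  have hle : ∀ u, ENNReal.ofReal (kk (n+1) η t (x - (x - u))) * ENNReal.ofReal (kk (n+1) η t' (x' - (x - u))) * wti (n+1) (x - u) ≤
      A.indicator (fun _ => ENNReal.ofReal c) u := by
    intro u
    have e1 : x - (x - u) = u := by abel
    have e2 : x' - (x - u) = (x' - x) + u := by abel
    rw [e1, e2]
    by_cases h1 : u ∈ shell (n+1) η t
    · by_cases h2 : (x' - x) + u ∈ shell (n+1) η t'
      · have hu : u ∈ A := ⟨h1, h2⟩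
        rw [indicator_of_mem hu]
        simp only [kk]
        rw [indicator_of_mem h1, indicator_of_mem h2]
        unfold wti
        rw [← ENNReal.ofReal_mul (by positivity), ← ENNReal.ofReal_mul (by positivity)]
        apply ENNReal.ofReal_le_ofReal
        rw [hc, Nat.add_sub_cancel]
        gcongr
        have hun : ‖u‖ ≤ 2 * t := by
          have := h1.2
          exact abs_le_of_sq_le_sq' (by nlinarith) (by positivity) |>.2
        have := norm_sub_le x u
        linarith
      · simp only [kk]
        rw [indicator_of_notMem h2]
        simp
    · simp only [kk]
      rw [indicator_of_notMem h1]
      simp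
  refine (lintegral_mono hle).trans ?_
  rw [lintegral_indicator hAm, setLIntegral_const]
  calc _ ≤ ENNReal.ofReal c * (ENNReal.ofReal (η * t'^2 / ‖x' - x‖) * ENNReal.ofReal (vb n * (n * (2*t)^(n-2) * (η * t^2)))) := by
        gcongr
        exact shell_inter n hn η t t' hη hη1 ht htt' _ ha
    _ ≤ _ := by
        rw [← ENNReal.ofReal_mul (by positivity), ← ENNReal.ofReal_mul (by positivity)]
        apply ENNReal.ofReal_le_ofReal
        rw [norm_sub_rev x' x]
        set R := ‖x - x'‖
        have hc1 : c ≤ (vb (n+1) * η * t^(n+1))⁻¹ * (vb (n+1) * η * t'^(n+1))⁻¹ * (6*t)^n := by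
          rw [hc]; gcongr
        obtain ⟨m, rfl⟩ : ∃ m, n = m + 2 := ⟨n - 2, by omega⟩
        have hm : (m + 2 - 2) = m := by omega
        unfold KJ
        rw [hm] at *
        calc c * (η * t'^2 / R * (vb (m+2) * (((m+2:ℕ):ℝ) * (2*t)^m * (η*t^2))))
            ≤ ((vb (m+2+1) * η * t^(m+2+1))⁻¹ * (vb (m+2+1) * η * t'^(m+2+1))⁻¹ * (6*t)^(m+2)) * (η * t'^2 / R * (vb (m+2) * (((m+2:ℕ):ℝ) * (2*t)^m * (η*t^2)))) := by gcongr
          _ = ((vb (m+2+1))⁻¹^2 * 6^(m+2) * (vb (m+2) * (((m+2:ℕ):ℝ) * 2^m)) / R) * (t/t')^(m+1) := by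
            rw [mul_pow, mul_pow, div_pow]
            field_simp
            try ring
          _ ≤ ((vb (m+2+1))⁻¹^2 * 6^(m+2) * (vb (m+2) * (((m+2:ℕ):ℝ) * 2^m)) / R) * 1 := by
            gcongr
            exact pow_le_one₀ (by positivity) ((div_le_one ht').2 htt')
          _ = _ := by rw [mul_one]

lemma J_bound (n : ℕ) (hn : 2 ≤ n) (η t t' : ℝ) (hη : 0 < η) (hη1 : η ≤ 1) (ht : 0 < t) (ht' : 0 < t')
    (x x' : EE (n+1)) (hx : ‖x‖ ≤ 4 * t) (hx' : ‖x'‖ ≤ 4 * t') :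
    ∫⁻ y, ENNReal.ofReal (kk (n+1) η t (x - y)) * ENNReal.ofReal (kk (n+1) η t' (x' - y)) * wti (n+1) y ≤
      ENNReal.ofReal (KJ n) * (‖x - x'‖ₑ)⁻¹ := by
  have hK := KJ_pos n (by omega)
  by_cases hne : x = x'
  · subst hne
    simp [hK]
  · have hR0 : 0 < ‖x - x'‖ := norm_pos_iff.2 (sub_ne_zero.2 hne)
    have e : ENNReal.ofReal (KJ n) * (‖x - x'‖ₑ)⁻¹ = ENNReal.ofReal (KJ n / ‖x - x'‖) := by
      rw [← ofReal_norm, ENNReal.ofReal_div_of_pos hR0, div_eq_mul_inv]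
    rw [e]
    rcases le_total t t' with h | h
    · exact J_bound_aux n hn η t t' hη hη1 ht h x x' hne hx
    · have := J_bound_aux n hn η t' t hη hη1 ht' h x' x (Ne.symm hne) hx'
      rw [norm_sub_rev]
      refine le_trans (le_of_eq ?_) this
      congr 1
      ext y
      ring

def hh (d : ℕ) (x : EE d) : ℝ≥0∞ := ENNReal.ofReal (‖x‖^(-(1/2):ℝ))

lemma radial_int (R : ℝ) (hR : 0 < R) :
    ∫⁻ r in Ioi (0:ℝ), ENNReal.ofReal (r^(-(1/2):ℝ) / max r R) ≤ 4 * ENNReal.ofReal (R^(-(1/2):ℝ)) := by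
  have hsplit : Ioi (0:ℝ) = Ioc 0 R ∪ Ioi R := (Ioc_union_Ioi_eq_Ioi hR.le).symm
  have hp : (0:ℝ) ≤ R^(-(1/2):ℝ) := by positivity
  have h1 : ∫⁻ r in Ioc 0 R, ENNReal.ofReal (r^(-(1/2):ℝ) / max r R) = ENNReal.ofReal (2 * R^(-(1/2):ℝ)) := by
    have e1 : ∫⁻ r in Ioc 0 R, ENNReal.ofReal (r^(-(1/2):ℝ) / max r R) = ∫⁻ r in Ioc 0 R, ENNReal.ofReal (r^(-(1/2):ℝ) / R) := by
      apply setLIntegral_congr_fun measurableSet_Ioc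
      intro r hr
      simp only
      rw [max_eq_right hr.2]
    have hi : IntervalIntegrable (fun r : ℝ => r^(-(1/2):ℝ) / R) volume 0 R :=
      (intervalIntegral.intervalIntegrable_rpow' (by norm_num)).div_const R
    rw [intervalIntegrable_iff_integrableOn_Ioc_of_le hR.le] at hi
    rw [e1, ← ofReal_integral_eq_lintegral_ofReal hi]
    · congr 1
      rw [← intervalIntegral.integral_of_le hR.le, intervalIntegral.integral_div, integral_rpow (by left; norm_num)]
      have e3 : R^(-(1/2)+1:ℝ) = R^(-(1/2):ℝ) * R := by rw [Real.rpow_add hR, Real.rpow_one]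
      rw [Real.zero_rpow (by norm_num), e3]
      field_simp
      norm_num
    · filter_upwards [ae_restrict_mem measurableSet_Ioc] with r hr
      have := hr.1
      positivity
  have h2 : ∫⁻ r in Ioi R, ENNReal.ofReal (r^(-(1/2):ℝ) / max r R) = ENNReal.ofReal (2 * R^(-(1/2):ℝ)) := by
    have e1 : ∫⁻ r in Ioi R, ENNReal.ofReal (r^(-(1/2):ℝ) / max r R) = ∫⁻ r in Ioi R, ENNReal.ofReal (r^(-(3/2):ℝ)) := by
      apply setLIntegral_congr_fun measurableSet_Ioi
      intro r hr
      have hr0 : 0 < r := hR.trans hr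
      simp only
      rw [max_eq_left (le_of_lt hr), div_eq_mul_inv, ← Real.rpow_neg_one r, ← Real.rpow_add hr0]
      norm_num
    rw [e1, ← ofReal_integral_eq_lintegral_ofReal (integrableOn_Ioi_rpow_of_lt (by norm_num) hR)]
    · congr 1
      rw [integral_Ioi_rpow_of_lt (by norm_num) hR]
      norm_num
      ring
    · filter_upwards [ae_restrict_mem measurableSet_Ioi] with r hr
      have : 0 < r := hR.trans hr
      positivity
  rw [hsplit]
  refine (lintegral_union_le _ _ _).trans ?_
  rw [h1, h2, ← ENNReal.ofReal_add (by positivity) (by positivity)]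
  have : (4:ℝ≥0∞) = ENNReal.ofReal 4 := by norm_num
  rw [this, ← ENNReal.ofReal_mul (by norm_num)]
  apply ENNReal.ofReal_le_ofReal
  linarith

lemma schur_pt (d : ℕ) (hd : 3 ≤ d) (a b R : ℝ) (ha : 0 < a) (hb : 0 < b) (hR : 0 < R) (h : R ≤ a + b) :
    a^((1/2:ℝ)-d) * b⁻¹ ≤ 2 * (a^((1/2:ℝ)-d) / max a R) + 2 * (b^((1/2:ℝ)-d) / max b R) := by
  have hma : 0 < max a R := lt_max_of_lt_left ha
  have hmb : 0 < max b R := lt_max_of_lt_left hb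
  have hd' : (3:ℝ) ≤ d := by exact_mod_cast hd
  rcases le_or_gt a b with hab | hab
  · have h1 : max a R ≤ 2 * b := max_le (by linarith) (by linarith)
    have h2 : b⁻¹ ≤ 2 * (max a R)⁻¹ := by
      rw [← div_eq_mul_inv, le_div_iff₀ hma, inv_mul_le_iff₀ hb]; linarith
    have h3 : 0 ≤ 2 * (b^((1/2:ℝ)-d) / max b R) := by positivity
    have h4 : a^((1/2:ℝ)-d) * b⁻¹ ≤ a^((1/2:ℝ)-d) * (2 * (max a R)⁻¹) := by gcongr
    rw [div_eq_mul_inv _ (max a R)]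
    linarith
  · have h1 : max b R ≤ 2 * a := max_le (by linarith) (by linarith)
    have h2 : a⁻¹ ≤ 2 * (max b R)⁻¹ := by
      rw [← div_eq_mul_inv, le_div_iff₀ hmb, inv_mul_le_iff₀ ha]; linarith
    have h3 : 0 ≤ 2 * (a^((1/2:ℝ)-d) / max a R) := by positivity
    have e1 : a^((1/2:ℝ)-d) = a^((3/2:ℝ)-d) * a⁻¹ := by
      rw [← Real.rpow_neg_one a, ← Real.rpow_add ha]; congr 1; ring
    have e2 : b^((1/2:ℝ)-d) = b^((3/2:ℝ)-d) * b⁻¹ := by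
      rw [← Real.rpow_neg_one b, ← Real.rpow_add hb]; congr 1; ring
    have h5 : a^((3/2:ℝ)-d) ≤ b^((3/2:ℝ)-d) := Real.rpow_le_rpow_of_nonpos hb hab.le (by linarith)
    have h4 : a^((1/2:ℝ)-d) * b⁻¹ ≤ (b^((3/2:ℝ)-d) * (2 * (max b R)⁻¹)) * b⁻¹ := by rw [e1]; gcongr
    have e3 : (b^((3/2:ℝ)-d) * (2 * (max b R)⁻¹)) * b⁻¹ = 2 * (b^((1/2:ℝ)-d) / max b R) := by
      rw [e2, div_eq_mul_inv]; ring
    linarith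

lemma schur (d : ℕ) (hd : 3 ≤ d) (x : EE d) (hx : x ≠ 0) :
    ∫⁻ x', wt d x' * hh d x' * (‖x - x'‖ₑ)⁻¹ ≤ 16 * sphereMeasure d univ * hh d x := by
  have : Nonempty (Fin d) := ⟨⟨0, by omega⟩⟩
  set R := ‖x‖ with hR
  have hR0 : 0 < R := norm_pos_iff.2 hx
  set Φ : ℝ → ℝ≥0∞ := fun r => ENNReal.ofReal (r^((1/2:ℝ)-d) / max r R) with hΦ
  have hΦm : Measurable Φ := by fun_prop
  have hΦi : ∫⁻ u : EE d, Φ ‖u‖ ≤ sphereMeasure d univ * (4 * hh d x) := by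
    rw [polar_radial d (by omega) Φ hΦm]
    gcongr
    refine le_trans (le_of_eq ?_) (radial_int R hR0)
    apply setLIntegral_congr_fun measurableSet_Ioi
    intro r hr
    have hr0 : 0 < r := hr
    simp only [hΦ]
    rw [← ENNReal.ofReal_mul (by positivity)]
    congr 1
    rw [← mul_div_assoc, ← Real.rpow_natCast, ← Real.rpow_add hr0, Nat.cast_sub (by omega)]
    congr 2
    push_cast
    ring
  have hpt : ∀ᵐ x' : EE d, wt d x' * hh d x' * (‖x - x'‖ₑ)⁻¹ ≤ 2 * Φ ‖x'‖ + 2 * Φ ‖x - x'‖ := by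
    have n1 : ∀ᵐ x' : EE d, x' ≠ 0 := by rw [ae_iff]; simp
    have n2 : ∀ᵐ x' : EE d, x' ≠ x := by rw [ae_iff]; simp
    filter_upwards [n1, n2] with x' h0 h1
    have ha : 0 < ‖x'‖ := norm_pos_iff.2 h0
    have hb : 0 < ‖x - x'‖ := norm_pos_iff.2 (sub_ne_zero.2 h1.symm)
    have e2 : ∀ r : ℝ, (2:ℝ≥0∞) * ENNReal.ofReal r = ENNReal.ofReal (2 * r) := by
      intro r; rw [ENNReal.ofReal_mul (by norm_num)]; norm_num
    simp only [hΦ, wt, hh]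
    rw [← ofReal_norm, ← ENNReal.ofReal_inv_of_pos hb, e2, e2, ← ENNReal.ofReal_mul (by positivity), ← ENNReal.ofReal_mul (by positivity), ← ENNReal.ofReal_add (by positivity) (by positivity)]
    apply ENNReal.ofReal_le_ofReal
    refine le_trans (le_of_eq ?_) (schur_pt d hd ‖x'‖ ‖x - x'‖ R ha hb hR0 ?_)
    · rw [← Real.rpow_add ha]
      congr 2
      ring
    · have := norm_add_le x' (x - x')
      rwa [add_sub_cancel] at this
  refine (lintegral_mono_ae hpt).trans ?_
  rw [lintegral_add_left (by fun_prop), lintegral_const_mul' _ _ (by simp), lintegral_const_mul' _ _ (by simp),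
    lintegral_sub_left_eq_self (fun u => Φ ‖u‖) x]
  calc _ ≤ 2 * (sphereMeasure d univ * (4 * hh d x)) + 2 * (sphereMeasure d univ * (4 * hh d x)) := by gcongr
    _ = _ := by ring

lemma amgm (a b u : ℝ≥0∞) (hu : u ≠ 0) (hu' : u ≠ ∞) : a * b ≤ a^2 * u + b^2 * u⁻¹ := by
  rcases le_total (a * u) b with h | h
  · refine le_trans ?_ le_add_self
    calc a * b = (a * u) * b * u⁻¹ := by
          rw [mul_assoc a u b, mul_comm u b, ← mul_assoc, mul_assoc (a*b), ENNReal.mul_inv_cancel hu hu', mul_one]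
      _ ≤ b * b * u⁻¹ := by gcongr
      _ = _ := by ring
  · refine le_trans ?_ le_self_add
    calc a * b ≤ a * (a * u) := by gcongr
      _ = _ := by ring

lemma wt_ne (d : ℕ) (x : EE d) (hx : x ≠ 0) : wt d x ≠ 0 ∧ wt d x ≠ ∞ := by
  have := norm_pos_iff.2 hx
  unfold wt
  refine ⟨?_, by simp⟩
  have : 0 < ‖x‖^((1:ℝ)-d) := by positivity
  simpa using this

lemma hh_ne (d : ℕ) (x : EE d) (hx : x ≠ 0) : hh d x ≠ 0 ∧ hh d x ≠ ∞ := by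
  have := norm_pos_iff.2 hx
  unfold hh
  refine ⟨?_, by simp⟩
  have : 0 < ‖x‖^(-(1/2):ℝ) := by positivity
  simpa using this

lemma wt_inv (d : ℕ) (hd : 3 ≤ d) (x : EE d) (hx : x ≠ 0) : (wt d x)⁻¹ = wti d x := by
  have := norm_pos_iff.2 hx
  unfold wt wti
  rw [← ENNReal.ofReal_inv_of_pos (by positivity), ← Real.rpow_neg (by positivity), ← Real.rpow_natCast]
  congr 2
  rw [Nat.cast_sub (by omega)]
  push_cast
  ring

lemma wti_meas (d : ℕ) : Measurable (wti d) := by unfold wti; fun_prop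
lemma hh_meas (d : ℕ) : Measurable (hh d) := by unfold hh; fun_prop

lemma wt_ball (d : ℕ) (hd : 3 ≤ d) (n : ℝ) : ∫⁻ x in closedBall (0:EE d) n, wt d x ≠ ∞ := by
  have hm := wt_meas d
  set F : ℝ → ℝ≥0∞ := fun r => (Iic n).indicator (fun r => ENNReal.ofReal (r^((1:ℝ)-d))) r with hF
  have hFm : Measurable F := by
    apply Measurable.indicator _ measurableSet_Iic
    fun_prop
  have e : ∫⁻ x in closedBall (0:EE d) n, wt d x = ∫⁻ x : EE d, F ‖x‖ := by
    rw [← lintegral_indicator measurableSet_closedBall]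
    congr 1
    ext x
    by_cases hx : ‖x‖ ≤ n
    · have h1 : x ∈ closedBall (0:EE d) n := by simpa using hx
      have h2 : ‖x‖ ∈ Iic n := hx
      simp only [hF]
      rw [indicator_of_mem h1, indicator_of_mem h2]; rfl
    · have h1 : x ∉ closedBall (0:EE d) n := by simpa using hx
      have h2 : ‖x‖ ∉ Iic n := hx
      simp only [hF]
      rw [indicator_of_notMem h1, indicator_of_notMem h2]
  rw [e, polar_radial d (by omega) F hFm]
  apply ENNReal.mul_ne_top (measure_ne_top _ _)
  have hle : ∫⁻ r in Ioi (0:ℝ), ENNReal.ofReal (r^(d-1)) * F r ≤ ∫⁻ r in Ioi (0:ℝ), (Ioc 0 n).indicator 1 r := by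
    apply setLIntegral_mono' measurableSet_Ioi
    intro r hr
    have hr0 : 0 < r := hr
    by_cases h : r ≤ n
    · have h1 : r ∈ Iic n := h
      have h2 : r ∈ Ioc 0 n := ⟨hr0, h⟩
      simp only [hF]
      rw [indicator_of_mem h1, indicator_of_mem h2, ← ENNReal.ofReal_mul (by positivity), ← Real.rpow_natCast, ← Real.rpow_add hr0,
        Nat.cast_sub (by omega)]
      simp
    · have h1 : r ∉ Iic n := h
      simp only [hF]
      rw [indicator_of_notMem h1, mul_zero]
      exact zero_le
  refine (hle.trans_lt ((setLIntegral_le_lintegral _ _).trans_lt ?_)).ne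
  rw [lintegral_indicator_one measurableSet_Ioc]
  simp

lemma ttstar_G (d : ℕ) (hd : 3 ≤ d) (Cj : ℝ≥0∞) (hCj : Cj ≠ ∞) (κ : EE d → EE d → ℝ≥0∞)
    (hκ : Measurable (Function.uncurry κ))
    (hJ : ∀ x x', ∫⁻ y, κ x y * κ x' y * wti d y ≤ Cj * (‖x - x'‖ₑ)⁻¹) (V : EE d → ℝ≥0∞) (hV : Measurable V) :
    ∫⁻ y, (∫⁻ x, V x * wt d x * κ x y)^2 * wti d y ≤ (Cj * (2 * (16 * sphereMeasure d univ))) * ∫⁻ x, (V x)^2 * wt d x := by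
  have : Nonempty (Fin d) := ⟨⟨0, by omega⟩⟩
  have hw := wt_meas d
  have hwi := wti_meas d
  have hhm := hh_meas d
  set σ := 16 * sphereMeasure d univ with hσ
  have hκ1 : ∀ {α : Type} [MeasurableSpace α] {u v : α → EE d}, Measurable u → Measurable v → Measurable (fun a => κ (u a) (v a)) := by
    intro α _ u v hu hv
    exact hκ.comp (hu.prodMk hv)
  set g : EE d → ℝ≥0∞ := fun x => V x * wt d x with hg
  have hgm : Measurable g := by fun_prop
  have e1 : ∀ y, (∫⁻ x, g x * κ x y)^2 * wti d y = ∫⁻ x, ∫⁻ x', g x * κ x y * (g x' * κ x' y) * wti d y := by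
    intro y
    have hm : Measurable (fun x => g x * κ x y) := hgm.mul (hκ1 measurable_id measurable_const)
    have : ∀ x, ∫⁻ x', g x * κ x y * (g x' * κ x' y) * wti d y = g x * κ x y * ((∫⁻ x', g x' * κ x' y) * wti d y) := by
      intro x
      rw [← lintegral_mul_const _ hm, ← lintegral_const_mul _ (hm.mul_const (wti d y))]
      congr 1; ext x'; ring
    simp_rw [this]
    rw [lintegral_mul_const _ hm]
    ring
  have m3 : Measurable (fun p : (EE d × EE d) × EE d => g p.1.2 * κ p.1.2 p.1.1 * (g p.2 * κ p.2 p.1.1) * wti d p.1.1) := by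
    have a1 := hκ1 (α := (EE d × EE d) × EE d) (u := fun p => p.1.2) (v := fun p => p.1.1) (by fun_prop) (by fun_prop)
    have a2 := hκ1 (α := (EE d × EE d) × EE d) (u := fun p => p.2) (v := fun p => p.1.1) (by fun_prop) (by fun_prop)
    fun_prop
  have e2 : ∫⁻ y, (∫⁻ x, g x * κ x y)^2 * wti d y = ∫⁻ x, ∫⁻ x', ∫⁻ y, g x * κ x y * (g x' * κ x' y) * wti d y := by
    simp_rw [e1]
    rw [lintegral_lintegral_swap]
    · congr 1; ext x
      rw [lintegral_lintegral_swap]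
      apply Measurable.aemeasurable
      have a1 := hκ1 (α := EE d × EE d) (u := fun p => x) (v := fun p => p.1) (by fun_prop) (by fun_prop)
      have a2 := hκ1 (α := EE d × EE d) (u := fun p => p.2) (v := fun p => p.1) (by fun_prop) (by fun_prop)
      change Measurable (fun p : EE d × EE d => g x * κ x p.1 * (g p.2 * κ p.2 p.1) * wti d p.1)
      fun_prop
    · exact (m3.lintegral_prod_right').aemeasurable
  have e3 : ∀ x x', ∫⁻ y, g x * κ x y * (g x' * κ x' y) * wti d y ≤ Cj * (g x * g x' * (‖x - x'‖ₑ)⁻¹) := by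
    intro x x'
    have hm : Measurable (fun y => κ x y * κ x' y * wti d y) := by
      have a1 := hκ1 (α := EE d) (u := fun p => x) (v := fun p => p) (by fun_prop) (by fun_prop)
      have a2 := hκ1 (α := EE d) (u := fun p => x') (v := fun p => p) (by fun_prop) (by fun_prop)
      fun_prop
    calc ∫⁻ y, g x * κ x y * (g x' * κ x' y) * wti d y = ∫⁻ y, (g x * g x') * (κ x y * κ x' y * wti d y) := by
          congr 1; ext y; ring
      _ = (g x * g x') * ∫⁻ y, κ x y * κ x' y * wti d y := lintegral_const_mul _ hm
      _ ≤ (g x * g x') * (Cj * (‖x - x'‖ₑ)⁻¹) := by gcongr; exact hJ x x'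
      _ = _ := by ring
  set T : EE d → EE d → ℝ≥0∞ := fun x x' => (V x)^2 * wt d x * (hh d x)⁻¹ * (wt d x' * hh d x' * (‖x - x'‖ₑ)⁻¹) with hT
  have hTm : Measurable (fun p : EE d × EE d => T p.1 p.2) := by fun_prop
  have n1 : ∀ᵐ x' : EE d, x' ≠ 0 := by rw [ae_iff]; simp
  have e4 : ∫⁻ x, ∫⁻ x', T x x' ≤ σ * ∫⁻ x, (V x)^2 * wt d x := by
    rw [← lintegral_const_mul _ (by fun_prop)]
    apply lintegral_mono_ae
    filter_upwards [n1] with x hx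
    simp only [hT]
    rw [lintegral_const_mul _ (by fun_prop)]
    calc _ ≤ (V x)^2 * wt d x * (hh d x)⁻¹ * (σ * hh d x) := by gcongr; exact schur d hd x hx
      _ = σ * ((V x)^2 * wt d x) * ((hh d x)⁻¹ * hh d x) := by ring
      _ = _ := by rw [ENNReal.inv_mul_cancel (hh_ne d x hx).1 (hh_ne d x hx).2, mul_one]
  have e5 : ∫⁻ x, ∫⁻ x', g x * g x' * (‖x - x'‖ₑ)⁻¹ ≤ 2 * (σ * ∫⁻ x, (V x)^2 * wt d x) := by
    calc ∫⁻ x, ∫⁻ x', g x * g x' * (‖x - x'‖ₑ)⁻¹ ≤ ∫⁻ x, ∫⁻ x', (T x x' + T x' x) := by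
          apply lintegral_mono_ae
          filter_upwards [n1] with x hx
          apply lintegral_mono_ae
          filter_upwards [n1] with x' hx'
          obtain ⟨a1, a2⟩ := hh_ne d x hx
          obtain ⟨b1, b2⟩ := hh_ne d x' hx'
          have hu0 : hh d x' * (hh d x)⁻¹ ≠ 0 := mul_ne_zero b1 (ENNReal.inv_ne_zero.2 a2)
          have hu1 : hh d x' * (hh d x)⁻¹ ≠ ∞ := ENNReal.mul_ne_top b2 (ENNReal.inv_ne_top.2 a1)
          have h := amgm (V x) (V x') _ hu0 hu1
          have hi : (hh d x' * (hh d x)⁻¹)⁻¹ = hh d x * (hh d x')⁻¹ := by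
            rw [ENNReal.mul_inv (Or.inl b1) (Or.inl b2), inv_inv, mul_comm]
          rw [hi] at h
          have hs : ‖x' - x‖ₑ = ‖x - x'‖ₑ := by rw [← enorm_neg, neg_sub]
          simp only [hT, hg, hs]
          calc V x * wt d x * (V x' * wt d x') * (‖x - x'‖ₑ)⁻¹ = (V x * V x') * (wt d x * wt d x' * (‖x - x'‖ₑ)⁻¹) := by ring
            _ ≤ ((V x)^2 * (hh d x' * (hh d x)⁻¹) + (V x')^2 * (hh d x * (hh d x')⁻¹)) * (wt d x * wt d x' * (‖x - x'‖ₑ)⁻¹) := by gcongr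
            _ = _ := by ring
      _ = (∫⁻ x, ∫⁻ x', T x x') + ∫⁻ x, ∫⁻ x', T x' x := by
          have hTi : Measurable (fun x => ∫⁻ x', T x x') := hTm.lintegral_prod_right'
          rw [← lintegral_add_left hTi]
          congr 1; ext x
          rw [lintegral_add_left]
          exact hTm.comp (measurable_const.prodMk measurable_id)
      _ = (∫⁻ x, ∫⁻ x', T x x') + ∫⁻ x, ∫⁻ x', T x x' := by
          congr 1
          rw [lintegral_lintegral_swap]
          exact (hTm.comp measurable_swap).aemeasurable
      _ ≤ _ := by rw [two_mul]; gcongr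
  calc ∫⁻ y, (∫⁻ x, g x * κ x y)^2 * wti d y = ∫⁻ x, ∫⁻ x', ∫⁻ y, g x * κ x y * (g x' * κ x' y) * wti d y := e2
    _ ≤ ∫⁻ x, ∫⁻ x', Cj * (g x * g x' * (‖x - x'‖ₑ)⁻¹) := lintegral_mono fun x => lintegral_mono fun x' => e3 x x'
    _ = Cj * ∫⁻ x, ∫⁻ x', g x * g x' * (‖x - x'‖ₑ)⁻¹ := by
        simp_rw [lintegral_const_mul' _ _ hCj]
    _ ≤ Cj * (2 * (σ * ∫⁻ x, (V x)^2 * wt d x)) := by gcongr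
    _ = _ := by ring

lemma ttstar (d : ℕ) (hd : 3 ≤ d) (Cj : ℝ≥0∞) (hCj : Cj ≠ ∞) (hCj0 : Cj ≠ 0) (κ : EE d → EE d → ℝ≥0∞)
    (hκ : Measurable (Function.uncurry κ))
    (hJ : ∀ x x', ∫⁻ y, κ x y * κ x' y * wti d y ≤ Cj * (‖x - x'‖ₑ)⁻¹) (F : EE d → ℝ≥0∞) (hF : Measurable F) :
    ∫⁻ x, (∫⁻ y, κ x y * F y)^2 * wt d x ≤ 4 * (Cj * (2 * (16 * sphereMeasure d univ))) * ∫⁻ x, (F x)^2 * wt d x := by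
  have : Nonempty (Fin d) := ⟨⟨0, by omega⟩⟩
  have hw := wt_meas d
  have hwi := wti_meas d
  set C1 := Cj * (2 * (16 * sphereMeasure d univ)) with hC1
  have hσ0 : sphereMeasure d univ ≠ 0 := sphere_pos d (by omega)
  have hC10 : C1 ≠ 0 := by
    rw [hC1]
    exact mul_ne_zero hCj0 (mul_ne_zero (by norm_num) (mul_ne_zero (by norm_num) hσ0))
  have hC1t : C1 ≠ ∞ := by
    rw [hC1]
    exact ENNReal.mul_ne_top hCj (ENNReal.mul_ne_top (by norm_num) (ENNReal.mul_ne_top (by norm_num) (measure_ne_top _ _)))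
  set U : EE d → ℝ≥0∞ := fun x => ∫⁻ y, κ x y * F y with hU
  have hm2 : Measurable (fun p : EE d × EE d => κ p.1 p.2 * F p.2) := by
    have : Measurable (fun p : EE d × EE d => κ p.1 p.2) := hκ
    fun_prop
  have hUm : Measurable U := hm2.lintegral_prod_right'
  set Y := ∫⁻ x, (F x)^2 * wt d x with hY
  have n1 : ∀ᵐ x' : EE d, x' ≠ 0 := by rw [ae_iff]; simp
  have key : ∀ n, ∫⁻ x, (trn d U n x)^2 * wt d x ≤ 4 * C1 * Y := by
    intro n
    set V := trn d U n with hV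
    have hVm : Measurable V := trn_meas d U hUm n
    set X := ∫⁻ x, (V x)^2 * wt d x with hX
    have hXt : X ≠ ∞ := by
      have := trn_lintegral_ne_top d U n (volume.withDensity (wt d)) (by
        rw [withDensity_apply _ measurableSet_closedBall]; exact wt_ball d hd n) 2 two_ne_zero
      rw [lintegral_withDensity_eq_lintegral_mul _ hw (hVm.pow_const 2)] at this
      have e : X = ∫⁻ x, (wt d * fun x => trn d U n x ^ 2) x := by
        rw [hX]; congr 1; ext x; rw [Pi.mul_apply, mul_comm]
      rw [e]
      exact this
    set G : EE d → ℝ≥0∞ := fun y => ∫⁻ x, V x * wt d x * κ x y with hG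
    have hGb : ∫⁻ y, (G y)^2 * wti d y ≤ C1 * X := ttstar_G d hd Cj hCj κ hκ hJ V hVm
    set lam := 2 * C1 with hlam
    have hl0 : lam ≠ 0 := mul_ne_zero (by norm_num) hC10
    have hlt : lam ≠ ∞ := ENNReal.mul_ne_top (by norm_num) hC1t
    have hm3 : Measurable (fun p : EE d × EE d => V p.1 * wt d p.1 * (κ p.1 p.2 * F p.2)) := by fun_prop
    have hκ2 : ∀ y, Measurable (fun x => κ x y) := fun y => hκ.comp (measurable_id.prodMk measurable_const)
    have hκ3 : ∀ x, Measurable (κ x) := fun x => hκ.comp (measurable_const.prodMk measurable_id)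
    have h1 : X ≤ lam * Y + lam⁻¹ * (C1 * X) := by
      calc X ≤ ∫⁻ x, V x * wt d x * U x := by
            rw [hX]; apply lintegral_mono; intro x
            dsimp only
            calc (V x)^2 * wt d x = V x * wt d x * V x := by ring
              _ ≤ _ := by gcongr; exact trn_le d U n x
        _ = ∫⁻ x, ∫⁻ y, V x * wt d x * (κ x y * F y) := by
            congr 1; ext x
            have hmm : Measurable (fun y => κ x y * F y) := (hκ3 x).mul hF
            rw [lintegral_const_mul _ hmm]
        _ = ∫⁻ y, ∫⁻ x, V x * wt d x * (κ x y * F y) := lintegral_lintegral_swap hm3.aemeasurable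
        _ = ∫⁻ y, F y * G y := by
            congr 1; ext y
            rw [hG, ← lintegral_const_mul _ (by have := hκ2 y; fun_prop)]
            congr 1; ext x; ring
        _ ≤ ∫⁻ y, (lam * ((F y)^2 * wt d y) + lam⁻¹ * ((G y)^2 * wti d y)) := by
            apply lintegral_mono_ae
            filter_upwards [n1] with y hy
            obtain ⟨a1, a2⟩ := wt_ne d y hy
            have := amgm (F y) (G y) (lam * wt d y) (mul_ne_zero hl0 a1) (ENNReal.mul_ne_top hlt a2)
            refine this.trans (le_of_eq ?_)
            rw [ENNReal.mul_inv (Or.inl hl0) (Or.inl hlt), wt_inv d hd y hy]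
            ring
        _ = lam * Y + lam⁻¹ * ∫⁻ y, (G y)^2 * wti d y := by
            rw [lintegral_add_left (by fun_prop), lintegral_const_mul' _ _ hlt,
              lintegral_const_mul' _ _ (ENNReal.inv_ne_top.2 hl0)]
        _ ≤ _ := by gcongr
    have h2 : lam⁻¹ * (C1 * X) = X / 2 := by
      rw [hlam, ENNReal.mul_inv (Or.inl (by norm_num)) (Or.inl (by norm_num)), mul_assoc, ← mul_assoc C1⁻¹,
        ENNReal.inv_mul_cancel hC10 hC1t, one_mul, mul_comm, div_eq_mul_inv]
    rw [h2] at h1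
    have h3 : X / 2 + X / 2 ≤ lam * Y + X / 2 := by rwa [ENNReal.add_halves]
    have h4 : X / 2 ≤ lam * Y := (ENNReal.add_le_add_iff_right (ENNReal.div_ne_top hXt (by norm_num))).1 h3
    calc X = X/2 + X/2 := (ENNReal.add_halves X).symm
      _ ≤ lam * Y + lam * Y := by gcongr
      _ = _ := by rw [hlam]; ring
  have hle : ∀ x, (U x)^2 * wt d x ≤ ⨆ n, (trn d U n x)^2 * wt d x := by
    intro x
    rw [← ENNReal.iSup_mul]
    gcongr
    rw [sq_le_iff_root, ← trn_iSup d U x]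
    refine iSup_le fun n => ?_
    rw [← sq_le_iff_root]
    exact le_iSup (fun n => (trn d U n x)^2) n
  refine (lintegral_mono hle).trans ?_
  rw [lintegral_iSup]
  · exact iSup_le key
  · intro n; have := trn_meas d U hUm n; fun_prop
  · intro n m h x
    dsimp only
    gcongr
    exact trn_mono d U h x

lemma selection {E : Type} [MeasurableSpace E] (T : Finset ℝ) (hT : T.Nonempty) (g : ℝ → E → ℝ≥0∞) (hg : ∀ t, Measurable (g t)) :
    ∃ τ : E → ℝ, Measurable τ ∧ Measurable (fun x => g (τ x) x) ∧ (∀ x, τ x ∈ T) ∧ ∀ x, ∀ t ∈ T, g t x ≤ g (τ x) x := by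
  classical
  induction hT using Finset.Nonempty.cons_induction with
  | singleton a =>
    exact ⟨fun _ => a, measurable_const, hg a, fun x => by simp, fun x t ht => by simp at ht; rw [ht]⟩
  | cons a s ha hs ih =>
    obtain ⟨τ, h1, h2, h3, h4⟩ := ih
    have hm : MeasurableSet {x | g (τ x) x ≤ g a x} := measurableSet_le h2 (hg a)
    refine ⟨fun x => if g (τ x) x ≤ g a x then a else τ x, Measurable.ite hm measurable_const h1, ?_, ?_, ?_⟩
    · have : (fun x => g (if g (τ x) x ≤ g a x then a else τ x) x) = fun x => if g (τ x) x ≤ g a x then g a x else g (τ x) x := by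
        ext x; split_ifs <;> rfl
      rw [this]
      exact Measurable.ite hm (hg a) h2
    · intro x
      dsimp only
      split_ifs
      · simp
      · simp [h3 x]
    · intro x t ht
      rw [Finset.mem_cons] at ht
      dsimp only
      split_ifs with h
      · rcases ht with rfl | ht
        · exact le_rfl
        · exact (h4 x t ht).trans h
      · rcases ht with rfl | ht
        · exact (not_le.1 h).le
        · exact h4 x t ht

lemma AA_eq (d : ℕ) (η t : ℝ) (F : EE d → ℝ≥0∞) (x : EE d) :
    AA d η t F x = ∫⁻ y, ENNReal.ofReal (kk d η t (x - y)) * F y := by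
  unfold AA
  rw [← lintegral_sub_left_eq_self _ x]
  simp

lemma kk_joint (d : ℕ) (η : ℝ) : Measurable (fun p : ℝ × EE d => kk d η p.1 p.2) := by
  classical
  have hcl := (isClosed_le (f := fun p : ℝ × EE d => p.1^2) (g := fun p => ‖p.2‖^2) (by fun_prop) (by fun_prop)).inter
    (isClosed_le (f := fun p : ℝ × EE d => ‖p.2‖^2) (g := fun p => (1+η)*p.1^2) (by fun_prop) (by fun_prop))
  have e : (fun p : ℝ × EE d => kk d η p.1 p.2) = indicator ({p : ℝ × EE d | p.1^2 ≤ ‖p.2‖^2} ∩ {p : ℝ × EE d | ‖p.2‖^2 ≤ (1+η)*p.1^2})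
      (fun p => (vs d η * p.1^d)⁻¹) := by
    ext p
    simp only [kk]
    by_cases h : p.2 ∈ shell d η p.1
    · have h' : p ∈ {p : ℝ × EE d | p.1^2 ≤ ‖p.2‖^2} ∩ {p : ℝ × EE d | ‖p.2‖^2 ≤ (1+η)*p.1^2} := h
      rw [indicator_of_mem h, indicator_of_mem h']
    · have h' : p ∉ {p : ℝ × EE d | p.1^2 ≤ ‖p.2‖^2} ∩ {p : ℝ × EE d | ‖p.2‖^2 ≤ (1+η)*p.1^2} := h
      rw [indicator_of_notMem h, indicator_of_notMem h']
  rw [e]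
  exact Measurable.indicator (by fun_prop) hcl.measurableSet

lemma large_part (d : ℕ) (hd : 3 ≤ d) : ∃ C : ℝ≥0, ∀ (η : ℝ), 0 < η → η ≤ 1 → ∀ (T : Finset ℝ), T.Nonempty → (∀ t ∈ T, 0 < t) →
    ∀ (F : EE d → ℝ≥0∞), Measurable F → ∃ U : EE d → ℝ≥0∞, Measurable U ∧
      (∀ x, ∀ t ∈ T, ‖x‖ < 4 * t → AA d η t F x ≤ U x) ∧
      ∫⁻ x, (U x)^2 * wt d x ≤ C * ∫⁻ x, (F x)^2 * wt d x := by
  classical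
  obtain ⟨n, rfl⟩ : ∃ n, d = n + 1 := ⟨d - 1, by omega⟩
  have hn : 2 ≤ n := by omega
  have hK := KJ_pos n (by omega)
  set C0 : ℝ≥0∞ := 4 * (ENNReal.ofReal (KJ n) * (2 * (16 * sphereMeasure (n+1) univ))) with hC0
  have hC0t : C0 ≠ ∞ := by
    rw [hC0]
    exact ENNReal.mul_ne_top (by norm_num) (ENNReal.mul_ne_top (by simp) (ENNReal.mul_ne_top (by norm_num) (ENNReal.mul_ne_top (by norm_num) (measure_ne_top _ _))))
  refine ⟨C0.toNNReal, fun η hη hη1 T hT hTp F hF => ?_⟩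
  rw [ENNReal.coe_toNNReal hC0t]
  set g : ℝ → EE (n+1) → ℝ≥0∞ := fun t x => if ‖x‖ < 4 * t then AA (n+1) η t F x else 0 with hg
  have hgm : ∀ t, Measurable (g t) := fun t =>
    Measurable.ite (measurableSet_lt measurable_norm measurable_const) (AA_meas _ η t F hF) measurable_const
  obtain ⟨τ, h1, h2, h3, h4⟩ := selection T hT g hgm
  refine ⟨fun x => g (τ x) x, h2, ?_, ?_⟩
  · intro x t ht hx
    refine le_trans (le_of_eq ?_) (h4 x t ht)
    simp only [hg]
    rw [if_pos hx]
  · set κ : EE (n+1) → EE (n+1) → ℝ≥0∞ := fun x y => if ‖x‖ < 4 * τ x then ENNReal.ofReal (kk (n+1) η (τ x) (x - y)) else 0 with hκ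
    have hκm : Measurable (Function.uncurry κ) := by
      have hm : MeasurableSet {p : EE (n+1) × EE (n+1) | ‖p.1‖ < 4 * τ p.1} := by
        apply measurableSet_lt <;> fun_prop
      refine Measurable.ite hm ?_ measurable_const
      apply ENNReal.measurable_ofReal.comp
      exact (kk_joint (n+1) η).comp (((h1.comp measurable_fst)).prodMk (measurable_fst.sub measurable_snd))
    have hU : ∀ x, g (τ x) x = ∫⁻ y, κ x y * F y := by
      intro x
      simp only [hg, hκ]
      split_ifs
      · rw [AA_eq]
      · simp
    simp_rw [hU]
    refine ttstar (n+1) hd (ENNReal.ofReal (KJ n)) (by simp) (by simpa using hK) κ hκm ?_ F hF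
    intro x x'
    simp only [hκ]
    by_cases hx : ‖x‖ < 4 * τ x
    · by_cases hx' : ‖x'‖ < 4 * τ x'
      · simp only [if_pos hx, if_pos hx']
        exact J_bound n hn η _ _ hη hη1 (hTp _ (h3 x)) (hTp _ (h3 x')) x x' hx.le hx'.le
      · simp [if_neg hx']
    · simp [if_neg hx]

lemma grid_weighted (d : ℕ) (hd : 3 ≤ d) : ∃ C : ℝ≥0, ∀ (η : ℝ), 0 < η → η ≤ 1 → ∀ (N : ℕ) (F : EE d → ℝ≥0∞),
    Measurable F → ∫⁻ x, (MG d η N F x)^2 * wt d x ≤ C * ∫⁻ x, (F x)^2 * wt d x := by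
  classical
  obtain ⟨C1, h1⟩ := small_part d hd
  obtain ⟨C2, h2⟩ := large_part d hd
  refine ⟨C1 + C2, fun η hη hη1 N F hF => ?_⟩
  set T : Finset ℝ := ((Finset.Icc (-N:ℤ) N) ×ˢ (Finset.range (16^N+1))).image (fun p => tt p.1 N p.2) with hT
  have hTmem : ∀ k ∈ Finset.Icc (-N:ℤ) N, ∀ i ∈ Finset.range (16^N+1), tt k N i ∈ T := by
    intro k hk i hi
    rw [hT, Finset.mem_image]
    exact ⟨(k, i), Finset.mem_product.2 ⟨hk, hi⟩, rfl⟩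
  have hTne : T.Nonempty := ⟨_, hTmem 0 (by simp) 0 (by simp)⟩
  have hTp : ∀ t ∈ T, 0 < t := by
    intro t ht
    rw [hT, Finset.mem_image] at ht
    obtain ⟨p, _, rfl⟩ := ht
    exact tt_pos _ _ _
  obtain ⟨U, hUm, hU1, hU2⟩ := h2 η hη hη1 T hTne hTp F hF
  have hw := wt_meas d
  have hpt : ∀ x, (MG d η N F x)^2 * wt d x ≤ (MS d η N F x)^2 * wt d x + (U x)^2 * wt d x := by
    intro x
    rw [← add_mul]
    gcongr
    apply MG_sq_le
    intro k hk i hi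
    rcases le_or_gt (4 * tt k N i) ‖x‖ with h | h
    · refine le_trans ?_ le_self_add
      gcongr
      unfold MS
      refine le_iSup₂_of_le k hk ?_
      refine le_iSup₂_of_le (f := fun i _ => if 4 * tt k N i ≤ ‖x‖ then AA d η (tt k N i) F x else 0) i hi ?_
      rw [if_pos h]
    · refine le_trans ?_ le_add_self
      gcongr
      exact hU1 x _ (hTmem k hk i hi) h
  calc _ ≤ ∫⁻ x, ((MS d η N F x)^2 * wt d x + (U x)^2 * wt d x) := lintegral_mono hpt
    _ = (∫⁻ x, (MS d η N F x)^2 * wt d x) + ∫⁻ x, (U x)^2 * wt d x := lintegral_add_right _ (by fun_prop)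
    _ ≤ C1 * (∫⁻ x, (F x)^2 * wt d x) + C2 * ∫⁻ x, (F x)^2 * wt d x := by
        gcongr
        exact h1 η hη hη1 N F hF
    _ = _ := by push_cast; ring

/-- normalized surface measure -/
def nsm (d : ℕ) : Measure (Metric.sphere (0 : EE d) 1) := (sphereMeasure d univ)⁻¹ • sphereMeasure d

lemma nsm_prob (d : ℕ) (hd : 1 ≤ d) : IsProbabilityMeasure (nsm d) := by
  constructor
  unfold nsm
  rw [Measure.smul_apply, smul_eq_mul]
  exact ENNReal.inv_mul_cancel (sphere_pos d hd) (measure_ne_top _ _)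

def SA (d : ℕ) (t : ℝ) (F : EE d → ℝ≥0∞) (x : EE d) : ℝ≥0∞ :=
  ∫⁻ θ, F (x - t • (θ : EE d)) ∂(nsm d)

lemma sphAvg_le (d : ℕ) (f : EE d → ℂ) (t : ℝ) (x : EE d) :
    (‖sphAvg d f t x‖₊ : ℝ≥0∞) ≤ SA d t (fun y => (‖f y‖₊ : ℝ≥0∞)) x := by
  unfold sphAvg SA nsm average
  exact enorm_integral_le_lintegral_enorm _

lemma SA_jensen (d : ℕ) (hd : 1 ≤ d) (q : ℝ) (hq : 1 ≤ q) (g : EE d → ℝ≥0∞) (hg : Measurable g) (t : ℝ) (x : EE d) :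
    (SA d t g x) ^ q ≤ SA d t (fun y => g y ^ q) x := by
  have := nsm_prob d hd
  rcases eq_or_lt_of_le hq with rfl | hq1
  · simp
  have hc : q.HolderConjugate (q.conjExponent) := Real.HolderConjugate.conjExponent hq1
  have hm : Measurable (fun θ : Metric.sphere (0 : EE d) 1 => g (x - t • (θ : EE d))) := by
    apply hg.comp; fun_prop
  have h := ENNReal.lintegral_mul_le_Lp_mul_Lq (nsm d) hc hm.aemeasurable
    (measurable_const (a := (1:ℝ≥0∞))).aemeasurable
  simp only [Pi.mul_apply, mul_one, ENNReal.one_rpow, lintegral_const, measure_univ] at h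
  unfold SA
  calc _ ≤ ((∫⁻ θ, g (x - t • (θ : EE d)) ^ q ∂(nsm d)) ^ (1/q)) ^ q := by
        gcongr
    _ = _ := by
        rw [← ENNReal.rpow_mul, one_div, inv_mul_cancel₀ (by linarith), ENNReal.rpow_one]

lemma SA_lsc (d : ℕ) (F : EE d → ℝ≥0∞) (hF : LowerSemicontinuous F) (t : ℝ) (x : EE d) (a : ℝ≥0∞)
    (ha : a < SA d t F x) : ∀ᶠ r in nhds t, a < SA d r F x := by
  have hFm := hF.measurable
  have h1 : SA d t F x ≤ Filter.liminf (fun r => SA d r F x) (nhds t) := by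
    unfold SA
    refine le_trans ?_ (lintegral_liminf_le (fun r => ?_))
    · apply lintegral_mono
      intro θ
      have hcont : Continuous (fun r : ℝ => x - r • (θ : EE d)) := by fun_prop
      have hc : LowerSemicontinuousAt (fun r : ℝ => F (x - r • (θ : EE d))) t :=
        fun y hy => hcont.continuousAt.eventually (hF _ y hy)
      exact lowerSemicontinuousAt_iff_le_liminf.1 hc
    · apply hFm.comp; fun_prop
  exact Filter.eventually_lt_of_lt_liminf (lt_of_lt_of_le ha h1)

lemma AA_ge (d : ℕ) (hd : 2 ≤ d) (F : EE d → ℝ≥0∞) (hF : Measurable F) (η s : ℝ) (hη : 0 < η) (hs : 0 < s)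
    (x : EE d) (a : ℝ≥0∞) (ha : ∀ r, s ≤ r → r ≤ (1+η) * s → a ≤ SA d r F x) : a ≤ AA d η s F x := by
  have hd1 : 1 ≤ d := by omega
  set K : ℝ → ℝ≥0∞ := fun r => indicator {r : ℝ | s^2 ≤ r^2 ∧ r^2 ≤ (1+η)*s^2} (fun _ => ENNReal.ofReal ((vs d η * s^d)⁻¹)) r with hK
  have hset : MeasurableSet {r : ℝ | s^2 ≤ r^2 ∧ r^2 ≤ (1+η)*s^2} :=
    ((isClosed_le (f := fun r : ℝ => s^2) (g := fun r => r^2) (by fun_prop) (by fun_prop)).inter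
      (isClosed_le (f := fun r : ℝ => r^2) (g := fun r => (1+η)*s^2) (by fun_prop) (by fun_prop))).measurableSet
  have hKm : Measurable K := measurable_const.indicator hset
  have hkk : ∀ y : EE d, ENNReal.ofReal (kk d η s y) = K ‖y‖ := by
    intro y
    simp only [kk, hK]
    by_cases h : y ∈ shell d η s
    · rw [indicator_of_mem h, indicator_of_mem (show ‖y‖ ∈ {r : ℝ | s^2 ≤ r^2 ∧ r^2 ≤ (1+η)*s^2} from h)]
    · rw [indicator_of_notMem h, indicator_of_notMem (show ‖y‖ ∉ {r : ℝ | s^2 ≤ r^2 ∧ r^2 ≤ (1+η)*s^2} from h)]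
      simp
  have hvs := vs_pos d hd η hη
  have hone : ∫⁻ y : EE d, K ‖y‖ = 1 := by
    simp_rw [← hkk]
    have : ∀ y, ENNReal.ofReal (kk d η s y) = (shell d η s).indicator (fun _ => ENNReal.ofReal ((vs d η * s^d)⁻¹)) y := by
      intro y
      simp only [kk]
      by_cases h : y ∈ shell d η s
      · rw [indicator_of_mem h, indicator_of_mem h]
      · rw [indicator_of_notMem h, indicator_of_notMem h]; simp
    simp_rw [this]
    rw [lintegral_indicator_const (shell_meas d η s), vol_shell d hd η s hη.le hs,
      ← ENNReal.ofReal_mul (by positivity), inv_mul_cancel₀ (by positivity), ENNReal.ofReal_one]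
  have hpr := polar_radial d hd1 K hKm
  have hmeasF : Measurable (fun p : Metric.sphere (0 : EE d) 1 × ℝ => F (x - p.2 • (p.1 : EE d))) := by
    apply hF.comp; fun_prop
  have hjm : Measurable (fun p : Metric.sphere (0 : EE d) 1 × ℝ =>
      ENNReal.ofReal (p.2^(d-1)) * (K p.2 * F (x - p.2 • (p.1 : EE d)))) := by
    refine Measurable.mul (by fun_prop) (Measurable.mul (hKm.comp measurable_snd) hmeasF)
  have e1 : AA d η s F x = ∫⁻ r in Ioi (0:ℝ), ∫⁻ θ, ENNReal.ofReal (r^(d-1)) * (K r * F (x - r • (θ : EE d))) ∂(sphereMeasure d) := by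
    unfold AA
    rw [polar d hd1 _ (by
      have := kk_meas d η s
      have h2 : Measurable (fun y : EE d => F (x - y)) := hF.comp (by fun_prop)
      exact this.ennreal_ofReal.mul h2)]
    refine Eq.trans ?_ (lintegral_lintegral_swap (f := fun (θ : Metric.sphere (0 : EE d) 1) (r : ℝ) => ENNReal.ofReal (r^(d-1)) * (K r * F (x - r • (θ : EE d)))) hjm.aemeasurable)
    congr 1
    ext θ
    apply setLIntegral_congr_fun measurableSet_Ioi
    intro r hr
    dsimp only
    rw [hkk]
    simp [norm_smul, abs_of_pos (show (0:ℝ) < r from hr)]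
  have hS0 := sphere_pos d hd1
  have hSt : sphereMeasure d univ ≠ ∞ := measure_ne_top _ _
  have e2 : ∀ r, ∫⁻ θ, F (x - r • (θ : EE d)) ∂(sphereMeasure d) = sphereMeasure d univ * SA d r F x := by
    intro r
    unfold SA nsm
    rw [lintegral_smul_measure, smul_eq_mul, ← mul_assoc, ENNReal.mul_inv_cancel hS0 hSt, one_mul]
  rw [e1]
  calc a = a * (sphereMeasure d univ * ∫⁻ r in Ioi (0:ℝ), ENNReal.ofReal (r^(d-1)) * K r) := by
        rw [← hpr, hone, mul_one]
    _ = ∫⁻ r in Ioi (0:ℝ), (a * sphereMeasure d univ) * (ENNReal.ofReal (r^(d-1)) * K r) := by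
        rw [lintegral_const_mul _ (by fun_prop), mul_assoc]
    _ ≤ _ := by
        apply setLIntegral_mono' measurableSet_Ioi
        intro r hr
        have hr0 : (0:ℝ) < r := hr
        have hm : Measurable (fun θ : Metric.sphere (0 : EE d) 1 => F (x - r • (θ : EE d))) := by
          apply hF.comp; fun_prop
        rw [lintegral_const_mul _ (hm.const_mul _), lintegral_const_mul _ hm, e2]
        by_cases h : r ∈ {r : ℝ | s^2 ≤ r^2 ∧ r^2 ≤ (1+η)*s^2}
        · have h1 : s ≤ r := by
            have := h.1
            exact (pow_le_pow_iff_left₀ hs.le hr0.le (by norm_num)).1 this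
          have h2 : r ≤ (1+η) * s := by
            have := h.2
            apply (pow_le_pow_iff_left₀ hr0.le (by positivity) (two_ne_zero)).1
            refine this.trans ?_
            rw [mul_pow]
            gcongr
            nlinarith
          have h3 := ha r h1 h2
          calc _ = ENNReal.ofReal (r^(d-1)) * (K r * (sphereMeasure d univ * a)) := by ring
            _ ≤ _ := by gcongr
        · have : K r = 0 := indicator_of_notMem h _
          simp [this]

lemma grid_close (t : ℝ) (ht : 0 < t) : ∃ n0 : ℕ, ∀ n : ℕ, n0 ≤ n → ∃ k ∈ Finset.Icc (-n:ℤ) n, ∃ i ∈ Finset.range (16^n+1),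
    tt k n i ≤ t ∧ t ≤ tt k n i + 3 * t / (n+1) := by
  obtain ⟨k, hk1, hk2⟩ := exists_mem_Ico_zpow (x := t) (y := 4) ht (by norm_num)
  refine ⟨k.natAbs, fun n hn => ⟨k, by rw [Finset.mem_Icc]; omega, ?_⟩⟩
  have h4 : (0:ℝ) < 4^k := by positivity
  set u : ℝ := (t / 4^k - 1) / 3 * 16^n with hu
  have hu0 : 0 ≤ u := by
    have : 1 ≤ t / 4^k := by rw [le_div_iff₀ h4]; simpa using hk1
    have : 0 ≤ t / 4^k - 1 := by linarith
    positivity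
  have hu1 : u ≤ 16^n := by
    have : t / 4^k ≤ 4 := by
      rw [div_le_iff₀ h4]
      rw [zpow_add_one₀ (by norm_num)] at hk2
      linarith
    rw [hu]
    have : (t / 4^k - 1) / 3 ≤ 1 := by linarith
    calc _ ≤ (1:ℝ) * 16^n := by gcongr
      _ = _ := one_mul _
  refine ⟨⌊u⌋₊, ?_, ?_, ?_⟩
  · rw [Finset.mem_range, Nat.lt_succ_iff]
    apply Nat.floor_le_of_le
    push_cast
    exact hu1
  · have := Nat.floor_le hu0
    unfold tt
    calc (4:ℝ)^k * (1 + 3 * (⌊u⌋₊:ℝ) / 16^n) ≤ 4^k * (1 + 3 * u / 16^n) := by gcongr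
      _ = t := by rw [hu]; field_simp; ring
  · have h1 := (Nat.lt_floor_add_one u).le
    have hn16 : (n:ℝ) + 1 ≤ 16^n := by
      have := Nat.lt_pow_self (n := n) (a := 16) (by norm_num)
      exact_mod_cast this
    have e : t = 4^k * (1 + 3 * u / 16^n) := by rw [hu]; field_simp; ring
    unfold tt
    calc t = 4^k * (1 + 3 * u / 16^n) := e
      _ ≤ 4^k * (1 + 3 * (⌊u⌋₊ + 1) / 16^n) := by gcongr
      _ = 4^k * (1 + 3 * (⌊u⌋₊:ℝ) / 16^n) + 3 * 4^k / 16^n := by field_simp; ring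
      _ ≤ 4^k * (1 + 3 * (⌊u⌋₊:ℝ) / 16^n) + 3 * t / (n+1) := by gcongr

lemma SA_le_liminf (d : ℕ) (hd : 2 ≤ d) (F : EE d → ℝ≥0∞) (hF : LowerSemicontinuous F) (t : ℝ) (ht : 0 < t) (x : EE d) :
    SA d t F x ≤ Filter.liminf (fun n : ℕ => MG d (1/(n+1)) n F x) Filter.atTop := by
  apply le_of_forall_lt
  intro a ha
  obtain ⟨b, hab, hb⟩ := exists_between ha
  refine lt_of_lt_of_le hab ?_
  refine Filter.le_liminf_of_le (by isBoundedDefault) ?_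
  have hev := SA_lsc d F hF t x b hb
  obtain ⟨δ, hδ, hball⟩ := Metric.eventually_nhds_iff.1 hev
  obtain ⟨n0, hn0⟩ := grid_close t ht
  obtain ⟨n1, hn1⟩ := exists_nat_gt (3 * t / δ)
  filter_upwards [Filter.eventually_ge_atTop (max n0 n1)] with n hn
  obtain ⟨k, hk, i, hi, h1, h2⟩ := hn0 n (le_trans (le_max_left _ _) hn)
  have hn' : (n1:ℝ) ≤ n := by exact_mod_cast le_trans (le_max_right _ _) hn
  have hlt : 3 * t / (n+1) < δ := by
    rw [div_lt_iff₀ (by positivity)]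
    rw [div_lt_iff₀ hδ] at hn1
    nlinarith
  refine le_trans ?_ (le_MG d _ n F x k hk i hi)
  refine AA_ge d hd F hF.measurable _ _ (by positivity) (tt_pos _ _ _) x b ?_
  intro r hr1 hr2
  refine (hball ?_).le
  rw [Real.dist_eq, abs_lt]
  constructor
  · linarith
  · have h3 : (1 + 1/((n:ℝ)+1)) * tt k n i ≤ (1 + 1/((n:ℝ)+1)) * t := by gcongr
    have h4 : 1/((n:ℝ)+1) * t ≤ 3 * t / (n+1) := by
      rw [div_mul_eq_mul_div]
      gcongr
      linarith
    nlinarith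

theorem main_aux (d : ℕ) (hd : 3 ≤ d) (p : ℝ) (hp : 2 ≤ p) :
    ∃ C : ℝ≥0, ∀ f : EuclideanSpace ℝ (Fin d) → ℂ, Measurable f →
      ∫⁻ x, sphMax d f x ^ p * wt d x ≤ C * ∫⁻ x, (‖f x‖₊ : ℝ≥0∞) ^ p * wt d x := by
  obtain ⟨C, hC⟩ := grid_weighted d hd
  refine ⟨C, fun f hf => ?_⟩
  have hw := wt_meas d
  set μ : Measure (EE d) := volume.withDensity (wt d) with hμ
  have hμint : ∀ g : EE d → ℝ≥0∞, Measurable g → ∫⁻ x, g x ∂μ = ∫⁻ x, g x * wt d x := by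
    intro g hg
    rw [hμ, lintegral_withDensity_eq_lintegral_mul _ hw hg]
    simp only [Pi.mul_apply, mul_comm]
  have hloc : IsLocallyFiniteMeasure μ := by
    constructor
    intro x
    obtain ⟨n, hn⟩ := exists_nat_gt ‖x‖
    refine ⟨closedBall 0 n, ?_, ?_⟩
    · refine Filter.mem_of_superset (isOpen_ball.mem_nhds ?_) ball_subset_closedBall
      simpa using hn
    · rw [hμ, withDensity_apply _ isClosed_closedBall.measurableSet]
      exact lt_of_le_of_ne le_top (wt_ball d hd n)
  have hgm : Measurable (fun x => (‖f x‖₊ : ℝ≥0∞) ^ p) := by fun_prop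
  rw [← hμint _ hgm]
  have key : ∀ ε : ℝ≥0∞, ε ≠ 0 → ∫⁻ x, sphMax d f x ^ p * wt d x ≤ C * (∫⁻ x, (‖f x‖₊ : ℝ≥0∞) ^ p ∂μ + ε) := by
    intro ε hε
    obtain ⟨h, hfh, hlsc, hint⟩ := exists_le_lowerSemicontinuous_lintegral_ge μ _ hgm hε
    set F : EE d → ℝ≥0∞ := fun x => h x ^ (1/2:ℝ) with hFd
    have hF : LowerSemicontinuous F :=
      (ENNReal.continuous_rpow_const (y := (1/2:ℝ))).comp_lowerSemicontinuous hlsc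
        (ENNReal.monotone_rpow_of_nonneg (by norm_num))
    have hFsq : ∀ x, (F x)^2 = h x := by
      intro x
      simp only [hFd]
      rw [← ENNReal.rpow_natCast, ← ENNReal.rpow_mul]
      norm_num
    have hFm := hF.measurable
    set L : EE d → ℝ≥0∞ := fun x => Filter.liminf (fun n : ℕ => (MG d (1/(n+1)) n F x)^2) Filter.atTop with hL
    have hMm : ∀ n : ℕ, Measurable (fun x => (MG d (1/((n:ℝ)+1)) n F x)^2) := fun n =>
      (MG_meas d _ n F hFm).pow_const 2
    have hLm : Measurable L := Measurable.liminf hMm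
    have hpt : ∀ x, sphMax d f x ^ p ≤ L x := by
      intro x
      have hsq : L x = (Filter.liminf (fun n : ℕ => MG d (1/(n+1)) n F x) Filter.atTop)^2 := by
        have hmono : Monotone (fun y : ℝ≥0∞ => y^2) := fun a b hab => by dsimp only; gcongr
        exact (hmono.map_liminf_of_continuousAt (F := Filter.atTop) (fun n : ℕ => MG d (1/(n+1)) n F x)
          (ENNReal.continuous_pow 2).continuousAt (by isBoundedDefault) (by isBoundedDefault)).symm
      have hp0 : 0 < p := by linarith
      have hroot : sphMax d f x ≤ (L x)^(p⁻¹) := by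
        unfold sphMax
        refine iSup₂_le fun t ht => ?_
        refine (sphAvg_le d f t x).trans ?_
        rw [ENNReal.le_rpow_inv_iff hp0, hsq]
        have hgm1 : Measurable (fun y => (‖f y‖₊ : ℝ≥0∞)) := by fun_prop
        have hj := SA_jensen d (by omega) (p/2) (by linarith) (fun y => (‖f y‖₊ : ℝ≥0∞)) hgm1 t x
        have hle : SA d t (fun y => (‖f y‖₊ : ℝ≥0∞) ^ (p/2)) x ≤ SA d t F x := by
          unfold SA
          apply lintegral_mono
          intro θ
          simp only [hFd]
          rw [one_div, ENNReal.le_rpow_inv_iff (by norm_num), ← ENNReal.rpow_mul]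
          have := hfh (x - t • (θ : EE d))
          rw [div_mul_cancel₀ _ (by norm_num)]
          exact this
        have hlim := SA_le_liminf d (by omega) F hF t ht x
        have e : ∀ z : ℝ≥0∞, z ^ p = (z ^ (p/2))^2 := by
          intro z
          rw [← ENNReal.rpow_natCast, ← ENNReal.rpow_mul]
          norm_num
        rw [e]
        gcongr
        exact hj.trans (hle.trans hlim)
      exact (ENNReal.le_rpow_inv_iff hp0).1 hroot
    calc _ ≤ ∫⁻ x, L x * wt d x := by
          apply lintegral_mono; intro x; dsimp only; gcongr; exact hpt x
      _ = ∫⁻ x, L x ∂μ := (hμint L hLm).symm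
      _ ≤ Filter.liminf (fun n : ℕ => ∫⁻ x, (MG d (1/((n:ℝ)+1)) n F x)^2 ∂μ) Filter.atTop := lintegral_liminf_le hMm
      _ ≤ C * ∫⁻ x, h x ∂μ := by
          apply Filter.liminf_le_of_le (by isBoundedDefault)
          intro b hb
          obtain ⟨n, hn⟩ := hb.exists
          refine hn.trans ?_
          rw [hμint _ (hMm n)]
          refine (hC (1/((n:ℝ)+1)) (by positivity) ?_ n F hFm).trans ?_
          · rw [div_le_one (by positivity)]
            have : (0:ℝ) ≤ n := by positivity
            linarith
          · rw [← hμint _ (hFm.pow_const 2)]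
            simp_rw [hFsq]
            exact le_rfl
      _ ≤ _ := by gcongr
  have hlim : Filter.Tendsto (fun ε : ℝ≥0∞ => (C:ℝ≥0∞) * (∫⁻ x, (‖f x‖₊ : ℝ≥0∞) ^ p ∂μ + ε)) (nhdsWithin 0 (Ioi 0))
      (nhds ((C:ℝ≥0∞) * (∫⁻ x, (‖f x‖₊ : ℝ≥0∞) ^ p ∂μ + 0))) := by
    apply Filter.Tendsto.mono_left _ nhdsWithin_le_nhds
    apply ENNReal.Tendsto.const_mul _ (Or.inr ENNReal.coe_ne_top)
    exact tendsto_const_nhds.add Filter.tendsto_id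
  rw [add_zero] at hlim
  refine ge_of_tendsto hlim ?_
  filter_upwards [self_mem_nhdsWithin] with ε hε
  exact key ε (ne_of_gt hε)

/-- For `d ≥ 3` and `p ≥ 2`, the global spherical maximal function `M` is
bounded on `L^p(|x|^{1-d})`. -/
theorem spherical_maximal_weighted_critical (d : ℕ) (hd : 3 ≤ d) (p : ℝ) (hp : 2 ≤ p) :
    ∃ C : ℝ≥0, ∀ f : EuclideanSpace ℝ (Fin d) → ℂ, Measurable f →
      ∫⁻ x, sphMax d f x ^ p * wt d x ≤ C * ∫⁻ x, (‖f x‖₊ : ℝ≥0∞) ^ p * wt d x := by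
  exact main_aux d hd p hp

end
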